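/- Let q be an even prime power (a power of 2), F a finite field with exactly q elements, and n ≥ 1. Then q^n ≤ k(Sp(2n,F)) ≤ q^n · Π_{i=1}^∞ (1 − q^{−4i}) / ((1 − q^{−(4i−2)}) (1 − q^{−i})²) ≤ 15.2 · q^n. -/

import Mathlib

open scoped Matrix

/-- The matrix of the standard symplectic form: `[[0, Iₙ], [-Iₙ, 0]]`. -/
def sympJ (n : ℕ) (F : Type*) [Field F] :
    Matrix (Fin n ⊕ Fin n) (Fin n ⊕ Fin n) F :=
  Matrix.fromBlocks 0 1 (-1) 0

/-- The symplectic group `Sp(2n, F)`: invertible `2n × 2n` matrices `A` with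
`Aᵀ * J * A = J`, where `J = [[0, Iₙ], [-Iₙ, 0]]`. -/
def Sp (n : ℕ) (F : Type*) [Field F] :
    Subgroup (Matrix.GeneralLinearGroup (Fin n ⊕ Fin n) F) where
  carrier := {A | (A : Matrix (Fin n ⊕ Fin n) (Fin n ⊕ Fin n) F)ᵀ * sympJ n F *
      (A : Matrix (Fin n ⊕ Fin n) (Fin n ⊕ Fin n) F) = sympJ n F}
  one_mem' := by simp
  mul_mem' := by
    intro A B hA hB
    simp only [Set.mem_setOf_eq] at hA hB ⊢
    rw [Units.val_mul, Matrix.transpose_mul]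
    calc (B : Matrix _ _ F)ᵀ * (A : Matrix _ _ F)ᵀ * sympJ n F *
          ((A : Matrix _ _ F) * (B : Matrix _ _ F))
        = (B : Matrix _ _ F)ᵀ * ((A : Matrix _ _ F)ᵀ * sympJ n F * (A : Matrix _ _ F)) *
            (B : Matrix _ _ F) := by simp only [mul_assoc]
      _ = sympJ n F := by rw [hA, hB]
  inv_mem' := by
    intro A hA
    simp only [Set.mem_setOf_eq] at hA ⊢
    have h1 : (A : Matrix (Fin n ⊕ Fin n) (Fin n ⊕ Fin n) F) *
        (↑A⁻¹ : Matrix (Fin n ⊕ Fin n) (Fin n ⊕ Fin n) F) = 1 := A.mul_inv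
    conv_lhs => rw [← hA]
    calc (↑A⁻¹ : Matrix _ _ F)ᵀ * ((A : Matrix _ _ F)ᵀ * sympJ n F * (A : Matrix _ _ F)) *
          (↑A⁻¹ : Matrix _ _ F)
        = ((A : Matrix _ _ F) * (↑A⁻¹ : Matrix _ _ F))ᵀ * sympJ n F *
            ((A : Matrix _ _ F) * (↑A⁻¹ : Matrix _ _ F)) := by
          rw [Matrix.transpose_mul]; simp only [mul_assoc]
      _ = sympJ n F := by rw [h1]; simp

section QSeries

open Filter Topology

/-- The finite `q`-Pochhammer symbol `(t; t)_n`. -/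
noncomputable def qPoch (t : ℝ) (n : ℕ) : ℝ := ∏ i ∈ Finset.range n, (1 - t ^ (i + 1))

lemma qPoch_succ (t : ℝ) (n : ℕ) : qPoch t (n + 1) = qPoch t n * (1 - t ^ (n + 1)) :=
  Finset.prod_range_succ _ _

variable {t : ℝ}

lemma one_sub_pow_pos (h0 : 0 < t) (h1 : t < 1) (n : ℕ) : 0 < 1 - t ^ (n + 1) :=
  sub_pos.2 (pow_lt_one₀ h0.le h1 n.succ_ne_zero)

lemma qPoch_pos (h0 : 0 < t) (h1 : t < 1) (n : ℕ) : 0 < qPoch t n :=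
  Finset.prod_pos fun i _ => one_sub_pow_pos h0 h1 i

lemma qPoch_antitone (h0 : 0 < t) (h1 : t < 1) : Antitone (qPoch t) := by
  refine antitone_nat_of_succ_le fun n => ?_
  rw [qPoch_succ]
  have := qPoch_pos h0 h1 n
  nlinarith [pow_pos h0 (n + 1)]

/-- The terms of the series governing the symplectic recursion. -/
noncomputable def thetaTerm (t : ℝ) (j l : ℕ) : ℝ := t ^ (l ^ 2 + l * (j + 1)) * qPoch t (2 * j + l) / qPoch t l

lemma thetaTerm_nonneg (h0 : 0 < t) (h1 : t < 1) (j l : ℕ) : 0 ≤ thetaTerm t j l :=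
  div_nonneg (mul_nonneg (by positivity) (qPoch_pos h0 h1 _).le) (qPoch_pos h0 h1 _).le

lemma thetaTerm_le (h0 : 0 < t) (h1 : t < 1) (j l : ℕ) : thetaTerm t j l ≤ t ^ l := by
  unfold thetaTerm
  rw [div_le_iff₀ (qPoch_pos h0 h1 _)]
  refine mul_le_mul (pow_le_pow_of_le_one h0.le h1.le ?_)
    (qPoch_antitone h0 h1 (by omega)) (qPoch_pos h0 h1 _).le (by positivity)
  nlinarith [Nat.zero_le (l ^ 2), Nat.zero_le (l * j)]

lemma summable_thetaTerm (h0 : 0 < t) (h1 : t < 1) (j : ℕ) : Summable (thetaTerm t j) :=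
  Summable.of_nonneg_of_le (thetaTerm_nonneg h0 h1 j) (thetaTerm_le h0 h1 j)
    (summable_geometric_of_lt_one h0.le h1)

/-- The companion terms. -/
noncomputable def thetaTerm' (t : ℝ) (j l : ℕ) : ℝ :=
  thetaTerm t j l * ((1 - t ^ (j + l + 1)) * (1 - t ^ (2 * j + l + 1)))

lemma thetaTerm'_nonneg (h0 : 0 < t) (h1 : t < 1) (j l : ℕ) : 0 ≤ thetaTerm' t j l :=
  mul_nonneg (thetaTerm_nonneg h0 h1 j l)
    (mul_nonneg (one_sub_pow_pos h0 h1 _).le (one_sub_pow_pos h0 h1 _).le)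

lemma summable_thetaTerm' (h0 : 0 < t) (h1 : t < 1) (j : ℕ) : Summable (thetaTerm' t j) := by
  refine Summable.of_nonneg_of_le (thetaTerm'_nonneg h0 h1 j) (fun l => ?_)
    (summable_thetaTerm h0 h1 j)
  have a := one_sub_pow_pos h0 h1 (j + l)
  have b := one_sub_pow_pos h0 h1 (2 * j + l)
  refine mul_le_of_le_one_right (thetaTerm_nonneg h0 h1 j l) ?_
  exact mul_le_one₀ (by linarith [pow_pos h0 (j + l + 1)]) b.le
    (by linarith [pow_pos h0 (2 * j + l + 1)])

lemma thetaTerm_succ (h0 : 0 < t) (h1 : t < 1) (j l : ℕ) :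
    thetaTerm t j (l + 1) * (1 - t ^ (l + 1)) =
      thetaTerm t j l * (t ^ (2 * l + j + 2) * (1 - t ^ (2 * j + l + 1))) := by
  have := (qPoch_pos h0 h1 l).ne'
  have := (one_sub_pow_pos h0 h1 l).ne'
  unfold thetaTerm
  rw [show 2 * j + (l + 1) = 2 * j + l + 1 by ring, qPoch_succ, qPoch_succ]
  field_simp
  ring

lemma thetaTerm_shift (j l : ℕ) :
    thetaTerm t (j + 1) l =
      thetaTerm t j l * (t ^ l * ((1 - t ^ (2 * j + l + 1)) * (1 - t ^ (2 * j + l + 2)))) := by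
  unfold thetaTerm
  rw [show 2 * (j + 1) + l = (2 * j + l + 1) + 1 by ring, qPoch_succ, qPoch_succ]
  ring

lemma tsum_eq_zero_of_telescope {f h : ℕ → ℝ} (hf : Summable f)
    (hfh : ∀ l, f l = h (l + 1) - h l) (h0 : h 0 = 0) (hl : Tendsto h atTop (𝓝 0)) :
    ∑' l, f l = 0 := by
  refine tendsto_nhds_unique hf.hasSum.tendsto_sum_nat ?_
  simp_rw [hfh, Finset.sum_range_sub, h0, sub_zero]
  exact hl

/-- `∑ thetaTerm t j`. -/
noncomputable def thetaF (t : ℝ) (j : ℕ) : ℝ := ∑' l, thetaTerm t j l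

/-- `∑ thetaTerm' t j`. -/
noncomputable def thetaW (t : ℝ) (j : ℕ) : ℝ := ∑' l, thetaTerm' t j l

lemma thetaF_nonneg (h0 : 0 < t) (h1 : t < 1) (j : ℕ) : 0 ≤ thetaF t j :=
  tsum_nonneg (thetaTerm_nonneg h0 h1 j)

lemma thetaW_nonneg (h0 : 0 < t) (h1 : t < 1) (j : ℕ) : 0 ≤ thetaW t j :=
  tsum_nonneg (thetaTerm'_nonneg h0 h1 j)

lemma thetaF_rec (h0 : 0 < t) (h1 : t < 1) (j : ℕ) :
    (1 - t ^ (2 * j + 1)) * thetaF t j = thetaW t j + t ^ (j + 1) * thetaF t (j + 1) := by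
  have s0 := summable_thetaTerm h0 h1 j
  have s1 := summable_thetaTerm h0 h1 (j + 1)
  have s2 := summable_thetaTerm' h0 h1 j
  rw [← sub_eq_zero]
  unfold thetaF thetaW
  rw [← tsum_mul_left, ← tsum_mul_left, ← s2.tsum_add (s1.mul_left _),
    ← (s0.mul_left _).tsum_sub (s2.add (s1.mul_left _))]
  refine tsum_eq_zero_of_telescope (h := fun l => t ^ (2 * j + 1) * (1 - t ^ l) * thetaTerm t j l)
    ((s0.mul_left _).sub (s2.add (s1.mul_left _))) (fun l => ?_) (by simp) ?_
  · rw [thetaTerm_shift]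
    have := thetaTerm_succ h0 h1 j l
    unfold thetaTerm'
    linear_combination -t ^ (2 * j + 1) * this
  · refine squeeze_zero' (g := fun l => thetaTerm t j l) ?_ ?_ s0.tendsto_atTop_zero
    · refine Eventually.of_forall fun l => mul_nonneg (mul_nonneg (by positivity) ?_)
        (thetaTerm_nonneg h0 h1 j l)
      exact sub_nonneg.2 (pow_le_one₀ h0.le h1.le)
    · refine Eventually.of_forall fun l => mul_le_of_le_one_left (thetaTerm_nonneg h0 h1 j l) ?_
      exact mul_le_one₀ (pow_le_one₀ h0.le h1.le) (sub_nonneg.2 (pow_le_one₀ h0.le h1.le))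
        (by linarith [pow_pos h0 l])

lemma thetaW_rec (h0 : 0 < t) (h1 : t < 1) (j : ℕ) :
    (1 + t ^ (j + 1)) * thetaW t j = 2 * thetaF t (j + 1) - thetaW t (j + 1) := by
  have s0 := summable_thetaTerm' h0 h1 j
  have s1 := summable_thetaTerm h0 h1 (j + 1)
  have s2 := summable_thetaTerm' h0 h1 (j + 1)
  rw [← sub_eq_zero]
  unfold thetaF thetaW
  rw [← tsum_mul_left, ← tsum_mul_left, ← (s1.mul_left _).tsum_sub s2,
    ← (s0.mul_left _).tsum_sub ((s1.mul_left _).sub s2)]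
  refine tsum_eq_zero_of_telescope (h := fun l => (t ^ (2 * j + 2) * t ^ l - (1 + t ^ (j + 1))) *
    (1 - t ^ l) * thetaTerm t j l * (1 - t ^ (2 * j + l + 1)))
    ((s0.mul_left _).sub ((s1.mul_left _).sub s2)) (fun l => ?_) (by simp) ?_
  · have := thetaTerm_succ h0 h1 j l
    unfold thetaTerm'
    rw [thetaTerm_shift]
    rw [show 2 * j + (l + 1) + 1 = 2 * j + l + 2 by ring]
    linear_combination -(t ^ (2 * j + 2) * t ^ (l + 1) - (1 + t ^ (j + 1))) *
      (1 - t ^ (2 * j + l + 2)) * this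
  · have key : Tendsto (fun l => ((t ^ (2 * j + 2) * t ^ l - (1 + t ^ (j + 1))) *
      (1 - t ^ l)) * thetaTerm t j l * (1 - t ^ (2 * j + 1) * t ^ l)) atTop
      (𝓝 (((t ^ (2 * j + 2) * 0 - (1 + t ^ (j + 1))) * (1 - 0)) * 0 *
        (1 - t ^ (2 * j + 1) * 0))) := by
      have ht := tendsto_pow_atTop_nhds_zero_of_lt_one h0.le h1
      have hT := (summable_thetaTerm h0 h1 j).tendsto_atTop_zero
      exact ((((ht.const_mul _).sub_const _).mul (ht.const_sub _)).mul hT).mul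
        ((ht.const_mul _).const_sub _)
    rw [mul_zero, zero_mul] at key
    refine key.congr fun l => ?_
    ring

/-- The majorant of the alternating counts. -/
noncomputable def majA (t : ℝ) (j : ℕ) : ℝ := qPoch t j * thetaW t j

/-- The majorant of the non-alternating counts. -/
noncomputable def majN (t : ℝ) (j : ℕ) : ℝ := t ^ (j + 1) * qPoch t j * thetaF t (j + 1)

lemma majA_rec (h0 : 0 < t) (h1 : t < 1) (j : ℕ) :
    majA t j * ((1 - t ^ (2 * j + 2)) * (1 - t ^ (2 * j + 3))) =
      majA t (j + 1) * (1 + t ^ (2 * j + 3)) + 2 * majN t (j + 1) := by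
  have e1 := thetaF_rec h0 h1 (j + 1)
  have e2 := thetaW_rec h0 h1 j
  unfold majA majN
  rw [qPoch_succ]
  rw [show 2 * (j + 1) + 1 = 2 * j + 3 by ring] at e1
  linear_combination qPoch t j * (1 - t ^ (j + 1)) *
    ((1 - t ^ (2 * j + 3)) * e2 + 2 * e1)

lemma majN_rec (h0 : 0 < t) (h1 : t < 1) (j : ℕ) :
    majN t j * ((1 - t ^ (2 * j + 2)) * (1 - t ^ (2 * j + 3))) =
      t ^ (j + 1) * (1 + t ^ (j + 1)) * (majA t (j + 1) + majN t (j + 1)) := by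
  have e1 := thetaF_rec h0 h1 (j + 1)
  unfold majA majN
  rw [qPoch_succ]
  rw [show 2 * (j + 1) + 1 = 2 * j + 3 by ring] at e1
  linear_combination t ^ (j + 1) * qPoch t j * (1 - t ^ (2 * j + 2)) * e1

lemma majN_nonneg (h0 : 0 < t) (h1 : t < 1) (j : ℕ) : 0 ≤ majN t j :=
  mul_nonneg (mul_nonneg (by positivity) (qPoch_pos h0 h1 _).le) (thetaF_nonneg h0 h1 _)

lemma majA_nonneg (h0 : 0 < t) (h1 : t < 1) (j : ℕ) : 0 ≤ majA t j :=
  mul_nonneg (qPoch_pos h0 h1 _).le (thetaW_nonneg h0 h1 _)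

lemma le_majA (h0 : 0 < t) (h1 : t < 1) (j N : ℕ) (hN : 2 * j + 1 ≤ N) :
    qPoch t N ^ 2 ≤ majA t j := by
  have hW : thetaTerm' t j 0 ≤ thetaW t j :=
    (summable_thetaTerm' h0 h1 j).le_tsum 0 fun l _ => thetaTerm'_nonneg h0 h1 j l
  have e : qPoch t j * thetaTerm' t j 0 = qPoch t (j + 1) * qPoch t (2 * j + 1) := by
    simp only [thetaTerm', thetaTerm, qPoch_succ]
    simp [qPoch]
    ring
  calc qPoch t N ^ 2 = qPoch t N * qPoch t N := sq _
    _ ≤ qPoch t (j + 1) * qPoch t (2 * j + 1) :=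
      mul_le_mul (qPoch_antitone h0 h1 (by omega)) (qPoch_antitone h0 h1 hN)
        (qPoch_pos h0 h1 _).le (qPoch_pos h0 h1 _).le
    _ = qPoch t j * thetaTerm' t j 0 := e.symm
    _ ≤ majA t j := mul_le_mul_of_nonneg_left hW (qPoch_pos h0 h1 _).le

lemma majA_zero_add_majN_zero (h0 : 0 < t) (h1 : t < 1) :
    majA t 0 + majN t 0 = (1 - t) * ∑' l : ℕ, t ^ (l ^ 2 + l) := by
  have e := thetaF_rec h0 h1 0
  have : thetaF t 0 = ∑' l : ℕ, t ^ (l ^ 2 + l) := by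
    refine tsum_congr fun l => ?_
    have := (qPoch_pos h0 h1 l).ne'
    simp [thetaTerm, this]
  rw [← this]
  have hq : qPoch t 0 = 1 := by simp [qPoch]
  simp only [majA, majN, hq] at e ⊢
  simp at e
  simp
  linarith

end QSeries

section GaussProduct

open Filter Topology

variable {t : ℝ}

/-- Partial products of Gauss's product for the triangular-number theta series. -/
noncomputable def gaussProd (t : ℝ) (n : ℕ) : ℝ :=
  ∏ i ∈ Finset.range n, (1 - t ^ (4 * i + 4)) / (1 - t ^ (4 * i + 2))

lemma gaussProd_succ (n : ℕ) : gaussProd t (n + 1) =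
    gaussProd t n * ((1 - t ^ (4 * n + 4)) / (1 - t ^ (4 * n + 2))) :=
  Finset.prod_range_succ _ _

lemma one_le_gaussProd (h0 : 0 < t) (h1 : t < 1) (n : ℕ) : 1 ≤ gaussProd t n := by
  induction n with
  | zero => simp [gaussProd]
  | succ i ih =>
    rw [gaussProd_succ]
    refine one_le_mul_of_one_le_of_one_le ih ?_
    rw [one_le_div (one_sub_pow_pos h0 h1 _)]
    have : t ^ (4 * i + 4) ≤ t ^ (4 * i + 2) := pow_le_pow_of_le_one h0.le h1.le (by omega)
    linarith

/-- Shanks's finite form of Gauss's identity. -/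
lemma sum_pow_eq_gaussProd_mul (h0 : 0 < t) (h1 : t < 1) (n : ℕ) :
    ∑ l ∈ Finset.range (2 * n), t ^ (l ^ 2 + l) =
      gaussProd t n * ∑ s ∈ Finset.range n, t ^ (2 * s * (2 * n + 1)) / gaussProd t s := by
  have hG : ∀ n, gaussProd t n ≠ 0 := fun n => (one_pos.trans_le (one_le_gaussProd h0 h1 n)).ne'
  induction n with
  | zero => simp
  | succ n ih =>
    have hd : ∀ m, 1 - t ^ (4 * m + 2) ≠ 0 := fun m => (one_sub_pow_pos h0 h1 _).ne'
    have hd4 : ∀ m, 1 - t ^ (4 * m + 4) ≠ 0 := fun m => (one_sub_pow_pos h0 h1 _).ne'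
    have tel : ∀ m, ∑ s ∈ Finset.range m, (t ^ (2 * s * (2 * n + 3)) * (1 - t ^ (4 * n + 4)) -
        t ^ (2 * s * (2 * n + 1)) * (1 - t ^ (4 * n + 2))) / gaussProd t s =
        t ^ (2 * m * (2 * n + 1)) * (1 - t ^ (4 * m)) / gaussProd t m := by
      intro m
      induction m with
      | zero => simp
      | succ m ihm =>
        rw [Finset.sum_range_succ, ihm, gaussProd_succ]
        have := hd m
        have := hd4 m
        have := hG m
        field_simp
        ring
    have tn := tel n
    simp only [sub_div, Finset.sum_sub_distrib, mul_div_right_comm, ← Finset.sum_mul] at tn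
    rw [show 2 * (n + 1) = 2 * n + 1 + 1 by ring, Finset.sum_range_succ, Finset.sum_range_succ, ih,
      Finset.sum_range_succ, gaussProd_succ]
    have e : ∑ s ∈ Finset.range n, t ^ (2 * s * (2 * n + 1 + 1 + 1)) / gaussProd t s =
        (t ^ (2 * n * (2 * n + 1)) * (1 - t ^ (4 * n)) / gaussProd t n +
          (∑ s ∈ Finset.range n, t ^ (2 * s * (2 * n + 1)) / gaussProd t s) *
            (1 - t ^ (4 * n + 2))) / (1 - t ^ (4 * n + 4)) := by
      rw [eq_div_iff (hd4 n)]
      rw [show 2 * n + 1 + 1 + 1 = 2 * n + 3 by ring]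
      have : t ^ (2 * n * (2 * n + 1)) * (1 - t ^ (4 * n)) / gaussProd t n =
        t ^ (2 * n * (2 * n + 1)) / gaussProd t n * (1 - t ^ (4 * n)) := by ring
      rw [this]
      linear_combination tn
    rw [e]
    have a1 := hd n
    have a2 := hd4 n
    have a3 := hG n
    generalize ∑ s ∈ Finset.range n, t ^ (2 * s * (2 * n + 1)) / gaussProd t s = A
    field_simp
    ring

lemma sum_pow_le_gaussProd (h0 : 0 < t) (h1 : t < 1) (n : ℕ) :
    (∑ l ∈ Finset.range (2 * n), t ^ (l ^ 2 + l)) * (1 - t ^ (4 * n + 2)) ≤ gaussProd t n := by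
  have hG := one_le_gaussProd h0 h1
  have hx : 0 < 1 - t ^ (4 * n + 2) := one_sub_pow_pos h0 h1 _
  rw [sum_pow_eq_gaussProd_mul h0 h1, mul_assoc]
  refine mul_le_of_le_one_right (by linarith [hG n]) ?_
  calc _ ≤ (∑ s ∈ Finset.range n, (t ^ (4 * n + 2)) ^ s) * (1 - t ^ (4 * n + 2)) := by
        refine mul_le_mul_of_nonneg_right (Finset.sum_le_sum fun s _ => ?_) hx.le
        rw [← pow_mul, show (4 * n + 2) * s = 2 * s * (2 * n + 1) by ring]
        exact div_le_self (by positivity) (hG s)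
    _ = 1 - (t ^ (4 * n + 2)) ^ n := by
        rw [geom_sum_mul_neg]
    _ ≤ 1 := by linarith [pow_pos (pow_pos h0 (4 * n + 2)) n]

/-- The general factor of the bounding product. -/
noncomputable def boundFactor (t : ℝ) (i : ℕ) : ℝ :=
  (1 - t ^ (4 * i + 4)) / ((1 - t ^ (4 * i + 2)) * (1 - t ^ (i + 1)) ^ 2)

lemma prod_boundFactor (n : ℕ) : ∏ i ∈ Finset.range n, boundFactor t i =
    gaussProd t n / qPoch t n ^ 2 := by
  unfold boundFactor gaussProd qPoch
  rw [← Finset.prod_pow, ← Finset.prod_div_distrib]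
  exact Finset.prod_congr rfl fun i _ => by rw [div_div]

lemma boundFactor_eq (h0 : 0 < t) (h1 : t < 1) (i : ℕ) : boundFactor t i =
    (1 + t ^ (i + 1)) * (1 + t ^ (2 * i + 2)) / ((1 - t ^ (4 * i + 2)) * (1 - t ^ (i + 1))) := by
  have := (one_sub_pow_pos h0 h1 i).ne'
  have : 1 - t ^ (4 * i + 2) ≠ 0 := (one_sub_pow_pos h0 h1 _).ne'
  unfold boundFactor
  field_simp
  ring

lemma boundFactor_mono {s : ℝ} (h0 : 0 < t) (hts : t ≤ s) (h1 : s < 1) (i : ℕ) :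
    boundFactor t i ≤ boundFactor s i := by
  have ht := hts.trans_lt h1
  have hs := h0.trans_le hts
  rw [boundFactor_eq h0 ht, boundFactor_eq hs h1]
  have p : ∀ n, t ^ n ≤ s ^ n := fun n => pow_le_pow_left₀ h0.le hts n
  have hs1 : 0 < 1 - s ^ (4 * i + 2) := one_sub_pow_pos hs h1 _
  refine div_le_div₀ (by positivity) ?_ (mul_pos hs1 (one_sub_pow_pos hs h1 _)) ?_
  · gcongr
  · exact mul_le_mul (by linarith [p (4 * i + 2)]) (by linarith [p (i + 1)])
      (one_sub_pow_pos hs h1 _).le (one_sub_pow_pos h0 ht _).le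

lemma one_le_boundFactor (h0 : 0 < t) (h1 : t < 1) (i : ℕ) : 1 ≤ boundFactor t i := by
  rw [boundFactor_eq h0 h1, one_le_div (mul_pos (one_sub_pow_pos h0 h1 _)
    (one_sub_pow_pos h0 h1 _))]
  have : 0 < 1 - t ^ (4 * i + 2) := one_sub_pow_pos h0 h1 _
  have := one_sub_pow_pos h0 h1 i
  have := pow_pos h0 (4 * i + 2)
  have := pow_pos h0 (2 * i + 2)
  have := pow_pos h0 (i + 1)
  nlinarith [mul_pos ‹0 < t ^ (i+1)› ‹0 < t ^ (2 * i + 2)›]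

/-- An elementary tail estimate. -/
lemma boundFactor_le (h0 : 0 < t) (h1 : t ≤ 1 / 2) (i : ℕ) :
    boundFactor t i ≤ 1 + 28 * t ^ (i + 1) := by
  have ht : t < 1 := by linarith
  set y := t ^ (i + 1) with hy
  have hy0 : 0 < y := pow_pos h0 _
  have hy1 : y ≤ 1 / 2 := (pow_le_of_le_one h0.le ht.le i.succ_ne_zero).trans h1
  have hz : t ^ (4 * i + 2) ≤ y := pow_le_pow_of_le_one h0.le ht.le (by omega)
  have hw : t ^ (2 * i + 2) = y ^ 2 := by rw [hy]; ring
  rw [boundFactor_eq h0 ht, ← hy, hw]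
  have hz' : 0 < 1 - t ^ (4 * i + 2) := one_sub_pow_pos h0 ht _
  rw [div_le_iff₀ (mul_pos hz' (by linarith))]
  calc (1 + y) * (1 + y ^ 2) ≤ (1 + 28 * y) * ((1 - y) * (1 - y)) := by
        nlinarith [mul_nonneg hy0.le (sub_nonneg.2 hy1), mul_nonneg (mul_nonneg hy0.le hy0.le) (sub_nonneg.2 hy1)]
    _ ≤ _ := by
        refine mul_le_mul_of_nonneg_left ?_ (by positivity)
        exact mul_le_mul_of_nonneg_right (by linarith) (by linarith)

lemma multipliable_boundFactor (h0 : 0 < t) (h1 : t ≤ 1 / 2) : Multipliable (boundFactor t) := by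
  have ht : t < 1 := by linarith
  have : Summable fun i => ‖boundFactor t i - 1‖ := by
    refine Summable.of_nonneg_of_le (fun _ => norm_nonneg _) (fun i => ?_)
      ((summable_geometric_of_lt_one h0.le ht).mul_left (28 * t))
    rw [Real.norm_of_nonneg (by linarith [one_le_boundFactor h0 ht i])]
    have := boundFactor_le h0 h1 i
    rw [pow_succ] at this
    linarith
  simpa using multipliable_one_add_of_summable this

lemma le_mul_tprod_boundFactor (h0 : 0 < t) (h1 : t ≤ 1 / 2) {k c : ℝ} (hk : 0 ≤ k) {N₀ : ℕ}
    (h : ∀ N, N₀ ≤ N → k * qPoch t N ^ 2 ≤ c * ∑' l : ℕ, t ^ (l ^ 2 + l)) :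
    k ≤ c * ∏' i, boundFactor t i := by
  have ht : t < 1 := by linarith
  have hs : Summable fun l : ℕ => t ^ (l ^ 2 + l) := by
    refine Summable.of_nonneg_of_le (fun _ => by positivity) (fun l => ?_)
      (summable_geometric_of_lt_one h0.le ht)
    exact pow_le_pow_of_le_one h0.le ht.le (by omega)
  set S := ∑' l : ℕ, t ^ (l ^ 2 + l) with hS
  have hS1 : 1 ≤ S := by simpa using hs.le_tsum 0 fun l _ => by positivity
  have hprod := (multipliable_boundFactor h0 h1).hasProd.tendsto_prod_nat
  have hsum : Tendsto (fun n => ∑ l ∈ Finset.range (2 * n), t ^ (l ^ 2 + l)) atTop (𝓝 S) :=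
    hs.hasSum.tendsto_sum_nat.comp (tendsto_id.const_mul_atTop' (by norm_num))
  have hpow : Tendsto (fun n => 1 - t ^ (4 * n + 2)) atTop (𝓝 (1 - 0)) :=
    ((tendsto_pow_atTop_nhds_zero_of_lt_one h0.le ht).comp
      (tendsto_atTop_mono (fun n => by simp only [id]; omega) tendsto_id)).const_sub 1
  have key : k * (S * (1 - 0)) ≤ c * S * ∏' i, boundFactor t i := by
    refine le_of_tendsto_of_tendsto ((hsum.mul hpow).const_mul k) (hprod.const_mul (c * S)) ?_
    filter_upwards [eventually_ge_atTop N₀] with N hN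
    have hq := pow_pos (qPoch_pos h0 ht N) 2
    have hg := one_le_gaussProd h0 ht N
    rw [prod_boundFactor, mul_div_assoc', le_div_iff₀ hq]
    calc _ ≤ k * gaussProd t N * qPoch t N ^ 2 := by
          gcongr
          exact sum_pow_le_gaussProd h0 ht N
      _ = k * qPoch t N ^ 2 * gaussProd t N := by ring
      _ ≤ _ := mul_le_mul_of_nonneg_right (h N hN) (by linarith)
  have hS0 : 0 < S := by linarith
  refine le_of_mul_le_mul_right ?_ hS0
  linarith

lemma tprod_boundFactor_le (h0 : 0 < t) (h1 : t ≤ 1 / 2) :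
    ∏' i, boundFactor t i ≤ 15.2 := by
  have ht : t < 1 := by linarith
  have hP : ∀ n, ∏ i ∈ Finset.range n, boundFactor t i ≤
      ∏ i ∈ Finset.range n, boundFactor (1 / 2) i := fun n =>
    Finset.prod_le_prod (fun i _ => (one_pos.trans_le (one_le_boundFactor h0 ht i)).le)
      fun i _ => boundFactor_mono h0 h1 (by norm_num) i
  have tail : ∀ n, ∏ i ∈ Finset.range (n + 14), boundFactor (1 / 2) i ≤
      15.2 * (1 - 3 * (1 / 2) ^ (n + 14)) := by
    intro n
    induction n with
    | zero =>
      unfold boundFactor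
      simp only [Finset.prod_range_succ, Finset.prod_range_zero]
      norm_num
    | succ n ih =>
      rw [show n + 1 + 14 = n + 14 + 1 by ring, Finset.prod_range_succ]
      have hf : boundFactor (1 / 2) (n + 14) ≤ 1 + 3 * (1 / 2) ^ (n + 14 + 1) := by
        have hy0 : (0 : ℝ) < (1 / 2) ^ (n + 15) := by positivity
        have hy1 : ((1 : ℝ) / 2) ^ (n + 15) ≤ 1 / 1000 :=
          (pow_le_pow_of_le_one (by norm_num) (by norm_num)
            (show 15 ≤ n + 15 by omega)).trans (by norm_num)
        have hz : ((1 : ℝ) / 2) ^ (4 * (n + 14) + 2) ≤ ((1 / 2) ^ (n + 15)) ^ 2 := by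
          rw [← pow_mul]
          exact pow_le_pow_of_le_one (by norm_num) (by norm_num) (by omega)
        rw [boundFactor_eq (by norm_num) (by norm_num)]
        have e : ((1 : ℝ) / 2) ^ (2 * (n + 14) + 2) = ((1 / 2) ^ (n + 15)) ^ 2 := by ring
        rw [e, show n + 14 + 1 = n + 15 by ring]
        set y := ((1 : ℝ) / 2) ^ (n + 15)
        have hz' : 0 < 1 - ((1 : ℝ) / 2) ^ (4 * (n + 14) + 2) := by nlinarith
        rw [div_le_iff₀ (mul_pos hz' (by linarith))]
        calc (1 + y) * (1 + y ^ 2) ≤ (1 + 3 * y) * ((1 - y ^ 2) * (1 - y)) := by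
              nlinarith [mul_pos hy0 hy0, mul_pos hy0 (mul_pos hy0 hy0),
                mul_nonneg hy0.le (sub_nonneg.2 hy1),
                mul_nonneg (mul_pos hy0 hy0).le (sub_nonneg.2 hy1)]
          _ ≤ _ := by
              refine mul_le_mul_of_nonneg_left ?_ (by positivity)
              exact mul_le_mul_of_nonneg_right (by linarith) (by linarith)
      have hy0 : (0 : ℝ) < (1 / 2) ^ (n + 14) := by positivity
      have hy1 : ((1 : ℝ) / 2) ^ (n + 14) ≤ 1 / 1000 :=
          (pow_le_pow_of_le_one (by norm_num) (by norm_num)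
            (show 14 ≤ n + 14 by omega)).trans (by norm_num)
      rw [pow_succ] at hf ⊢
      set y := ((1 : ℝ) / 2) ^ (n + 14)
      calc _ ≤ 15.2 * (1 - 3 * y) * (1 + 3 * (y * (1 / 2))) :=
            mul_le_mul ih hf (zero_le_one.trans (one_le_boundFactor (by norm_num) (by norm_num) _))
              (by linarith)
        _ ≤ _ := by nlinarith
  have hprod := (multipliable_boundFactor h0 h1).hasProd.tendsto_prod_nat
  refine le_of_tendsto hprod ?_
  filter_upwards [eventually_ge_atTop 14] with N hN
  obtain ⟨n, rfl⟩ := Nat.exists_eq_add_of_le' hN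
  refine (hP _).trans ((tail n).trans ?_)
  have : (0 : ℝ) < (1 / 2) ^ (n + 14) := by positivity
  linarith

end GaussProduct

section Isometry

open Module

open LinearMap (BilinForm)

variable {F : Type*} [Field F]
variable {V₁ V₂ V₃ : Type*} [AddCommGroup V₁] [Module F V₁] [AddCommGroup V₂] [Module F V₂]
  [AddCommGroup V₃] [Module F V₃]

/-- Two bilinear forms are isometric. -/
def Isometric {V₁ V₂ : Type*} [AddCommMonoid V₁] [Module F V₁] [AddCommMonoid V₂] [Module F V₂]
    (B₁ : BilinForm F V₁) (B₂ : BilinForm F V₂) : Prop :=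
  ∃ f : V₁ ≃ₗ[F] V₂, ∀ u v, B₂ (f u) (f v) = B₁ u v

lemma Isometric.refl (B : BilinForm F V₁) : Isometric B B := ⟨LinearEquiv.refl _ _, fun _ _ => rfl⟩

lemma Isometric.symm {B₁ : BilinForm F V₁} {B₂ : BilinForm F V₂} (h : Isometric B₁ B₂) :
    Isometric B₂ B₁ := by
  obtain ⟨f, hf⟩ := h
  exact ⟨f.symm, fun u v => by simp [← hf]⟩

lemma Isometric.trans {B₁ : BilinForm F V₁} {B₂ : BilinForm F V₂} {B₃ : BilinForm F V₃}
    (h : Isometric B₁ B₂) (h' : Isometric B₂ B₃) : Isometric B₁ B₃ := by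
  obtain ⟨f, hf⟩ := h
  obtain ⟨g, hg⟩ := h'
  exact ⟨f.trans g, fun u v => by simp [hf, hg]⟩

lemma Isometric.nondegenerate {B₁ : BilinForm F V₁} {B₂ : BilinForm F V₂} (h : Isometric B₁ B₂)
    (hB : B₁.Nondegenerate) : B₂.Nondegenerate := by
  obtain ⟨f, hf⟩ := h
  have : B₂ = LinearMap.BilinForm.congr f B₁ := by
    ext u v
    simp [← hf]
  exact this ▸ hB.congr f

/-- Isometries can be assembled from orthogonal decompositions. -/
lemma Isometric.of_isCompl {B₁ : BilinForm F V₁} {B₂ : BilinForm F V₂}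
    {W₁ U₁ : Submodule F V₁} {W₂ U₂ : Submodule F V₂} (h₁ : IsCompl W₁ U₁) (h₂ : IsCompl W₂ U₂)
    (o₁ : ∀ w ∈ W₁, ∀ u ∈ U₁, B₁ w u = 0) (o₁' : ∀ w ∈ W₁, ∀ u ∈ U₁, B₁ u w = 0)
    (o₂ : ∀ w ∈ W₂, ∀ u ∈ U₂, B₂ w u = 0) (o₂' : ∀ w ∈ W₂, ∀ u ∈ U₂, B₂ u w = 0)
    (hW : Isometric (B₁.restrict W₁) (B₂.restrict W₂))
    (hU : Isometric (B₁.restrict U₁) (B₂.restrict U₂)) : Isometric B₁ B₂ := by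
  obtain ⟨f, hf⟩ := hW
  obtain ⟨g, hg⟩ := hU
  let e : V₁ ≃ₗ[F] V₂ := (Submodule.prodEquivOfIsCompl W₁ U₁ h₁).symm.trans
    ((LinearEquiv.prodCongr f g).trans (Submodule.prodEquivOfIsCompl W₂ U₂ h₂))
  refine ⟨e, fun u v => ?_⟩
  obtain ⟨⟨w, a⟩, rfl⟩ := (Submodule.prodEquivOfIsCompl W₁ U₁ h₁).surjective u
  obtain ⟨⟨x, b⟩, rfl⟩ := (Submodule.prodEquivOfIsCompl W₁ U₁ h₁).surjective v
  have e1 := hf w x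
  have e2 := hg a b
  simp only [LinearMap.BilinForm.restrict_apply] at e1 e2
  simp [e, o₁ _ w.2 _ b.2, o₁' _ x.2 _ a.2, o₂ _ (f w).2 _ (g b).2, o₂' _ (f x).2 _ (g a).2]
  exact congrArg₂ _ e1 e2

lemma LinearMap.BilinForm.Nondegenerate.exists_right [FiniteDimensional F V₁] {B : BilinForm F V₁}
    (hB : B.Nondegenerate) (ψ : V₁ →ₗ[F] F) : ∃ u, ∀ w, B w u = ψ w :=
  ⟨(B.flip.toDual hB.flip).symm ψ, fun w =>
    LinearMap.BilinForm.apply_toDual_symm_apply (hB := hB.flip) ψ w⟩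

variable [FiniteDimensional F V₁] [FiniteDimensional F V₂]

/-- One step of Witt's theorem. -/
lemma exists_witt_vector {B₁ : BilinForm F V₁} {B₂ : BilinForm F V₂} (n₁ : B₁.Nondegenerate)
    (n₂ : B₂.Nondegenerate) (hdim : finrank F V₁ = finrank F V₂)
    (K : Submodule F V₁) (h : V₁ →ₗ[F] V₂) (hh : ∀ x ∈ K, ∀ y ∈ K, B₂ (h x) (h y) = B₁ x y)
    (hi : ∀ x ∈ K, h x = 0 → x = 0) (u : V₁) (hu : u ∉ K) :
    ∃ u', u' ∉ K.map h ∧ ∀ k ∈ K, B₂ (h k) u' = B₁ k u := by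
  have hinj : Function.Injective (h.domRestrict K) :=
    (injective_iff_map_eq_zero _).2 fun x hx => Subtype.ext (hi x x.2 hx)
  obtain ⟨g, hg⟩ := LinearMap.exists_leftInverse_of_injective (h.domRestrict K)
    (LinearMap.ker_eq_bot.2 hinj)
  obtain ⟨u₀, hu₀⟩ := n₂.exists_right ((B₁.flip u) ∘ₗ K.subtype ∘ₗ g)
  have hu₀' : ∀ k ∈ K, B₂ (h k) u₀ = B₁ k u := by
    intro k hk
    have := congrArg (fun f => f ⟨k, hk⟩) hg
    simp only [LinearMap.comp_apply, LinearMap.domRestrict_apply, LinearMap.id_apply] at this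
    simp [hu₀, this]
  by_cases h0 : u₀ ∉ K.map h
  · exact ⟨u₀, h0, hu₀'⟩
  rw [not_not] at h0
  by_cases hz : ∃ z ∈ B₂.orthogonal (K.map h), z ∉ K.map h
  · obtain ⟨z, hz, hz'⟩ := hz
    refine ⟨u₀ + z, fun hmem => hz' ?_, fun k hk => ?_⟩
    · simpa using Submodule.sub_mem _ hmem h0
    · have : B₂ (h k) z = 0 := hz _ (Submodule.mem_map_of_mem hk)
      rw [map_add, this, add_zero, hu₀' k hk]
  push Not at hz
  exfalso
  obtain ⟨k₀, hk₀, rfl⟩ := h0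
  have hrank : finrank F (K.map h) = finrank F K := by
    have := LinearMap.finrank_range_of_inj hinj
    rwa [LinearMap.range_domRestrict] at this
  have hT : (K ⊓ B₁.orthogonal K).map h = B₂.orthogonal (K.map h) := by
    apply le_antisymm
    · rintro _ ⟨x, ⟨hx, hx'⟩, rfl⟩ _ ⟨y, hy, rfl⟩
      exact (hh y hy x hx).trans (hx' y hy)
    · intro z hz'
      obtain ⟨x, hx, rfl⟩ := hz z hz'
      exact ⟨x, ⟨hx, fun y hy => (hh y hy x hx).symm.trans (hz' _ ⟨y, hy, rfl⟩)⟩, rfl⟩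
  have hle : K ⊓ B₁.orthogonal K = B₁.orthogonal K := by
    apply Submodule.eq_of_le_of_finrank_le inf_le_right
    rw [LinearMap.BilinForm.finrank_orthogonal n₁, hdim, ← hrank,
      ← LinearMap.BilinForm.finrank_orthogonal n₂, ← hT]
    exact Submodule.finrank_map_le _ _
  refine hu ?_
  have : u - k₀ ∈ K := inf_eq_right.1 hle fun k hk => by
    change B₁ k (u - k₀) = 0
    rw [map_sub, ← hu₀' k hk, hh k hk k₀ hk₀, sub_self]
  simpa using Submodule.add_mem _ this hk₀

/-- Witt's extension theorem for alternating forms. -/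
theorem exists_isometry_extending {B₁ : BilinForm F V₁} {B₂ : BilinForm F V₂}
    (n₁ : B₁.Nondegenerate) (n₂ : B₂.Nondegenerate) (a₁ : B₁.IsAlt) (a₂ : B₂.IsAlt)
    (hdim : finrank F V₁ = finrank F V₂) (K : Submodule F V₁) (h : V₁ →ₗ[F] V₂)
    (hh : ∀ x ∈ K, ∀ y ∈ K, B₂ (h x) (h y) = B₁ x y) (hi : ∀ x ∈ K, h x = 0 → x = 0) :
    ∃ f : V₁ ≃ₗ[F] V₂, (∀ u v, B₂ (f u) (f v) = B₁ u v) ∧ ∀ x ∈ K, f x = h x := by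
  induction hn : finrank F V₁ - finrank F K using Nat.strong_induction_on generalizing K h with
  | _ n ih =>
  by_cases hK : K = ⊤
  · subst hK
    have hinj : Function.Injective h :=
      (injective_iff_map_eq_zero _).2 fun x hx => hi x trivial hx
    exact ⟨LinearEquiv.ofInjectiveOfFinrankEq h hinj hdim, fun u v => hh u trivial v trivial,
      fun x _ => rfl⟩
  obtain ⟨u, hu⟩ : ∃ u, u ∉ K := by
    by_contra! hc
    exact hK (eq_top_iff.2 fun x _ => hc x)
  obtain ⟨u', hu', hku'⟩ := exists_witt_vector n₁ n₂ hdim K h hh hi u hu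
  obtain ⟨φ, hφu, hφK⟩ := Submodule.exists_le_ker_of_notMem hu
  let h' : V₁ →ₗ[F] V₂ := h + ((φ u)⁻¹ • φ).smulRight (u' - h u)
  have hK' : ∀ k ∈ K, h' k = h k := fun k hk => by
    have : φ k = 0 := hφK hk
    simp [h', this]
  have hu1 : h' u = u' := by simp [h', hφu]
  have hlt : K < K ⊔ F ∙ u := by
    refine lt_of_le_of_ne le_sup_left fun he => hu ?_
    rw [he]
    exact Submodule.mem_sup_right (Submodule.mem_span_singleton_self u)
  have hdec : ∀ x ∈ K ⊔ F ∙ u, ∃ k ∈ K, ∃ a : F, x = k + a • u := by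
    intro x hx
    obtain ⟨k, hk, y, hy, rfl⟩ := Submodule.mem_sup.1 hx
    obtain ⟨a, rfl⟩ := Submodule.mem_span_singleton.1 hy
    exact ⟨k, hk, a, rfl⟩
  have hrk := Submodule.finrank_lt_finrank_of_lt hlt
  have hle := Submodule.finrank_le (K ⊔ F ∙ u)
  obtain ⟨f, hf, hfx⟩ := ih _ (by omega) (K ⊔ F ∙ u) h' (fun x hx y hy => by
    obtain ⟨k, hk, a, rfl⟩ := hdec x hx
    obtain ⟨l, hl, b, rfl⟩ := hdec y hy
    have e1 : B₂ u' (h l) = B₁ u l := by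
      rw [← a₂.neg_eq, ← a₁.neg_eq, hku' l hl]
    simp [hK' k hk, hK' l hl, hu1, hh k hk l hl, hku' k hk, e1, a₁.self_eq_zero, a₂.self_eq_zero])
    (fun x hx h0 => by
      obtain ⟨k, hk, a, rfl⟩ := hdec x hx
      rw [map_add, map_smul, hK' k hk, hu1] at h0
      have ha : a = 0 := by
        by_contra ha
        refine hu' ⟨-a⁻¹ • k, Submodule.smul_mem _ _ hk, ?_⟩
        have : h k = -(a • u') := eq_neg_of_add_eq_zero_left h0
        rw [map_smul, this]
        simp [smul_smul, ha]
      subst ha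
      simp only [zero_smul, add_zero] at h0 ⊢
      exact hi k hk h0) rfl
  exact ⟨f, hf, fun x hx => (hfx x (Submodule.mem_sup_left hx)).trans (hK' x hx)⟩

/-- Nondegenerate alternating forms of the same dimension are isometric. -/
lemma isometric_of_isAlt {B₁ : BilinForm F V₁} {B₂ : BilinForm F V₂}
    (n₁ : B₁.Nondegenerate) (n₂ : B₂.Nondegenerate) (a₁ : B₁.IsAlt) (a₂ : B₂.IsAlt)
    (hdim : finrank F V₁ = finrank F V₂) : Isometric B₁ B₂ := by
  obtain ⟨f, hf, -⟩ := exists_isometry_extending n₁ n₂ a₁ a₂ hdim ⊥ 0 (by simp) (by simp)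
  exact ⟨f, hf⟩

end Isometry

section ModForm

open Module

open LinearMap (BilinForm)

variable {F : Type*} [Field F]
variable {V V₁ V₂ W W₁ W₂ : Type*} [AddCommGroup V] [Module F V]
  [AddCommGroup V₁] [Module F V₁] [AddCommGroup V₂] [Module F V₂]
  [AddCommGroup W] [Module F W] [AddCommGroup W₁] [Module F W₁] [AddCommGroup W₂] [Module F W₂]

/-- Every alternating form is the skew-symmetrization of a bilinear form. -/
lemma exists_sub_flip_eq_of_isAlt [FiniteDimensional F V] {Z : BilinForm F V} (hZ : Z.IsAlt) :
    ∃ β : BilinForm F V, ∀ u v, β u v - β v u = Z u v := by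
  let b := finBasis F V
  let β : BilinForm F V := Matrix.toBilin b
    (Matrix.of fun i j => if i < j then Z (b i) (b j) else 0)
  have hb : ∀ i j, β (b i) (b j) = if i < j then Z (b i) (b j) else 0 := by
    intro i j
    rw [← LinearMap.BilinForm.toMatrix_apply b, LinearMap.BilinForm.toMatrix_toBilin]
    rfl
  refine ⟨β, fun u v => ?_⟩
  have : β - β.flip = Z := by
    refine LinearMap.ext_basis b b fun i j => ?_
    change β (b i) (b j) - β (b j) (b i) = _
    rw [hb, hb]
    rcases lt_trichotomy i j with h | h | h
    · simp [h, h.not_gt]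
    · simp [h, hZ.self_eq_zero]
    · simp [h, h.not_gt, hZ.neg_eq]
  simpa using congrArg (fun B : BilinForm F V => B u v) this

/-- A relative version of `exists_sub_flip_eq_of_isAlt` in characteristic two. -/
lemma exists_add_flip_eq_of_isAlt [CharP F 2] [FiniteDimensional F V] {Z : BilinForm F V}
    (hZ : Z.IsAlt) (K : Submodule F V) (hK : ∀ u ∈ K, ∀ v ∈ K, Z u v = 0) :
    ∃ Φ : BilinForm F V, (∀ u, ∀ k ∈ K, Φ u k = 0) ∧ ∀ u v, Φ u v + Φ v u = Z u v := by
  obtain ⟨β, hβ⟩ := exists_sub_flip_eq_of_isAlt hZ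
  obtain ⟨g, hg⟩ := LinearMap.exists_leftInverse_of_injective K.subtype K.ker_subtype
  have hg' : ∀ k ∈ K, (g k : V) = k := fun k hk =>
    congrArg Subtype.val (LinearMap.congr_fun hg ⟨k, hk⟩)
  let γ : V →ₗ[F] V := K.subtype ∘ₗ g
  let π : V →ₗ[F] V := LinearMap.id - γ
  refine ⟨Z.compl₁₂ γ π + β.compl₁₂ π π, fun u k hk => ?_, fun u v => ?_⟩
  · have : π k = 0 := by simp [π, γ, hg' k hk]
    simp [this]
  · have h1 : Z (γ u) (γ v) = 0 := hK _ (g u).2 _ (g v).2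
    have h2 := hβ (π u) (π v)
    have h3 : Z u v = Z (γ u) (γ v) + Z (γ u) (π v) - Z (γ v) (π u) + Z (π u) (π v) := by
      have e : ∀ x, x = γ x + π x := fun x => by simp [π]
      rw [sub_eq_add_neg, hZ.neg_eq]
      conv_lhs => rw [e u, e v]
      simp only [map_add, LinearMap.add_apply]
      ring
    have two : (2 : F) = 0 := CharTwo.two_eq_zero
    simp only [LinearMap.add_apply, LinearMap.compl₁₂_apply]
    linear_combination h2 - h3 - h1 + (β (π v) (π u) + Z (γ v) (π u)) * two

/-- The orthogonal sum of `S` with the extension of the form `Y` on `V` by the totally isotropic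
space of functionals vanishing on `K`. -/
def modForm (S : BilinForm F W) (Y : BilinForm F V) (K : Submodule F V) :
    BilinForm F (W × Dual F (V ⧸ K) × V) :=
  LinearMap.mk₂ F (fun a b => S a.1 b.1 + a.2.1 (K.mkQ b.2.2) + b.2.1 (K.mkQ a.2.2) + Y a.2.2 b.2.2)
    (fun a a' b => by simp; ring) (fun c a b => by simp; ring)
    (fun a b b' => by simp; ring) (fun c a b => by simp; ring)

lemma modForm_apply (S : BilinForm F W) (Y : BilinForm F V) (K : Submodule F V)
    (a b : W × Dual F (V ⧸ K) × V) : modForm S Y K a b =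
      S a.1 b.1 + a.2.1 (K.mkQ b.2.2) + b.2.1 (K.mkQ a.2.2) + Y a.2.2 b.2.2 := rfl

variable [FiniteDimensional F V₁] [FiniteDimensional F V₂] [FiniteDimensional F W₁]
  [FiniteDimensional F W₂]

theorem modForm_isometric [CharP F 2] {S₁ : BilinForm F W₁} {S₂ : BilinForm F W₂}
    {Y₁ : BilinForm F V₁} {Y₂ : BilinForm F V₂} {K₁ : Submodule F V₁} {K₂ : Submodule F V₂}
    (f : V₁ ≃ₗ[F] V₂) (hf : K₁.map (f : V₁ →ₗ[F] V₂) = K₂) (h : W₁ ≃ₗ[F] W₂)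
    (hh : ∀ a b, S₂ (h a) (h b) = S₁ a b) (hS : ∀ a b, S₂ a b = S₂ b a)
    (g : V₁ →ₗ[F] W₂) (hg : ∀ k ∈ K₁, g k = 0)
    (hK : ∀ u ∈ K₁, ∀ v ∈ K₁, Y₂ (f u) (f v) = Y₁ u v)
    (hQ : ∀ v, Y₁ v v = Y₂ (f v) (f v) + S₂ (g v) (g v)) :
    Isometric (modForm S₁ Y₁ K₁) (modForm S₂ Y₂ K₂) := by
  have two : (2 : F) = 0 := CharTwo.two_eq_zero
  let Z : BilinForm F V₁ := Y₁ - Y₂.compl₁₂ (f : V₁ →ₗ[F] V₂) (f : V₁ →ₗ[F] V₂) - S₂.compl₁₂ g g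
  have hZ : ∀ u v, Z u v = Y₁ u v - Y₂ (f u) (f v) - S₂ (g u) (g v) := fun u v => rfl
  have hZa : Z.IsAlt := fun v => by
    change Z v v = 0
    rw [hZ, hQ]
    ring
  obtain ⟨Φ, hΦ, hΦZ⟩ := exists_add_flip_eq_of_isAlt hZa K₁ fun u hu v hv => by
    rw [hZ, hK u hu v hv, hg u hu]
    simp
  let τ : W₁ × Dual F (V₁ ⧸ K₁) × V₁ →ₗ[F] Dual F V₁ :=
    K₁.mkQ.dualMap ∘ₗ LinearMap.fst _ _ _ ∘ₗ LinearMap.snd _ _ _ +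
    Φ ∘ₗ LinearMap.snd _ _ _ ∘ₗ LinearMap.snd _ _ _ +
    (S₂.compl₁₂ (h : W₁ →ₗ[F] W₂) g) ∘ₗ LinearMap.fst _ _ _
  have hτ : ∀ a v, τ a v = a.2.1 (K₁.mkQ v) + Φ a.2.2 v + S₂ (h a.1) (g v) := fun a v => rfl
  have hτK : ∀ a, (f.symm : V₂ →ₗ[F] V₁).dualMap (τ a) ∈ K₂.dualAnnihilator := by
    intro a
    rw [Submodule.mem_dualAnnihilator]
    intro w hw
    rw [← hf] at hw
    obtain ⟨k, hk, rfl⟩ := hw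
    have : K₁.mkQ k = 0 := by simpa using hk
    rw [LinearMap.dualMap_apply, LinearEquiv.coe_coe, LinearEquiv.coe_coe, f.symm_apply_apply, hτ,
      this, hg k hk, hΦ _ k hk]
    simp
  let T : W₁ × Dual F (V₁ ⧸ K₁) × V₁ →ₗ[F] W₂ × Dual F (V₂ ⧸ K₂) × V₂ :=
    ((h : W₁ →ₗ[F] W₂) ∘ₗ LinearMap.fst _ _ _ +
        g ∘ₗ LinearMap.snd _ _ _ ∘ₗ LinearMap.snd _ _ _).prod
      (((K₂.dualQuotEquivDualAnnihilator.symm : _ →ₗ[F] Dual F (V₂ ⧸ K₂)) ∘ₗ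
        (((f.symm : V₂ →ₗ[F] V₁).dualMap ∘ₗ τ).codRestrict K₂.dualAnnihilator hτK)).prod
        ((f : V₁ →ₗ[F] V₂) ∘ₗ LinearMap.snd _ _ _ ∘ₗ LinearMap.snd _ _ _))
  have hT1 : ∀ a, (T a).1 = h a.1 + g a.2.2 := fun a => rfl
  have hT2 : ∀ a w, (T a).2.1 (K₂.mkQ (f w)) =
      a.2.1 (K₁.mkQ w) + Φ a.2.2 w + S₂ (h a.1) (g w) := fun a w => by
    rw [← hτ, ← f.symm_apply_apply w, f.apply_symm_apply]
    exact congrArg (fun l => l.1 (f w)) (K₂.dualQuotEquivDualAnnihilator.apply_symm_apply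
      ((((f.symm : V₂ →ₗ[F] V₁).dualMap ∘ₗ τ).codRestrict K₂.dualAnnihilator hτK) a))
  have hT3 : ∀ a, (T a).2.2 = f a.2.2 := fun a => rfl
  have hinj : Function.Injective T := by
    refine (injective_iff_map_eq_zero _).2 fun a ha => ?_
    have h3 : a.2.2 = 0 := by
      have := hT3 a
      rw [ha] at this
      exact f.map_eq_zero_iff.1 this.symm
    have h1 : a.1 = 0 := by
      have := hT1 a
      rw [ha, h3, map_zero, add_zero] at this
      exact h.map_eq_zero_iff.1 this.symm
    have h2 : a.2.1 = 0 := by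
      refine LinearMap.ext fun w => ?_
      obtain ⟨w, rfl⟩ := K₁.mkQ_surjective w
      have := hT2 a w
      rw [ha, h3, h1] at this
      simpa using this.symm
    exact Prod.ext h1 (Prod.ext h2 h3)
  have hrk : finrank F (W₁ × Dual F (V₁ ⧸ K₁) × V₁) =
      finrank F (W₂ × Dual F (V₂ ⧸ K₂) × V₂) := by
    have e1 := Submodule.finrank_quotient_add_finrank K₁
    have e2 := Submodule.finrank_quotient_add_finrank K₂
    have e3 : finrank F K₂ = finrank F K₁ := by rw [← hf]; exact LinearEquiv.finrank_map_eq f K₁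
    have e4 := f.finrank_eq
    have e5 := h.finrank_eq
    rw [finrank_prod, finrank_prod, finrank_prod, finrank_prod, Subspace.dual_finrank_eq,
      Subspace.dual_finrank_eq]
    omega
  refine ⟨LinearEquiv.ofInjectiveOfFinrankEq T hinj hrk, fun a b => ?_⟩
  change modForm S₂ Y₂ K₂ (T a) (T b) = _
  rw [modForm_apply, modForm_apply, hT1, hT1, hT3, hT3, hT2, hT2]
  simp only [map_add, LinearMap.add_apply, hh]
  have e1 := hΦZ a.2.2 b.2.2
  rw [hZ] at e1
  have e2 := hS (g a.2.2) (h b.1)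
  linear_combination e1 + e2 + (S₂ (h a.1) (g b.2.2) + S₂ (h b.1) (g a.2.2)) * two

end ModForm

section Decomposition

open Module

open LinearMap (BilinForm)

variable {F : Type*} [Field F] {V : Type*} [AddCommGroup V] [Module F V] [FiniteDimensional F V]

lemma LinearMap.BilinForm.nondegenerate_of_left {B : BilinForm F V}
    (h : ∀ u, (∀ v, B u v = 0) → u = 0) : B.Nondegenerate :=
  LinearMap.BilinForm.nondegenerate_iff_ker_eq_bot.2
    ((Submodule.eq_bot_iff _).2 fun u hu => h u fun v => by
      rw [LinearMap.mem_ker.1 hu, LinearMap.zero_apply])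

lemma even_finrank_of_isAlt {B : BilinForm F V} (hB : B.Nondegenerate) (ha : B.IsAlt) :
    Even (finrank F V) := by
  obtain ⟨K, hK, hmax⟩ := set_has_maximal_iff_noetherian.2 (inferInstance : IsNoetherian F V)
    {K : Submodule F V | K ≤ B.orthogonal K} ⟨⊥, show ⊥ ≤ B.orthogonal ⊥ from bot_le⟩
  have hKK : B.orthogonal K = K := by
    refine le_antisymm (fun u hu => ?_) hK
    by_contra hu'
    refine hmax (K ⊔ F ∙ u) ?_ (lt_of_le_of_ne le_sup_left fun he => hu' ?_)
    · intro x hx y hy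
      obtain ⟨k, hk, z, hz, rfl⟩ := Submodule.mem_sup.1 hx
      obtain ⟨a, rfl⟩ := Submodule.mem_span_singleton.1 hz
      obtain ⟨l, hl, z, hz, rfl⟩ := Submodule.mem_sup.1 hy
      obtain ⟨b, rfl⟩ := Submodule.mem_span_singleton.1 hz
      have e1 : B l k = 0 := hK hk l hl
      have e2 : B l u = 0 := hu l hl
      have e3 : B u k = 0 := by rw [← ha.neg_eq, hu k hk, neg_zero]
      change B _ _ = 0
      simp [e1, e2, e3, ha.self_eq_zero]
    · rw [he]
      exact Submodule.mem_sup_right (Submodule.mem_span_singleton_self u)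
  have h1 := LinearMap.BilinForm.finrank_orthogonal hB K
  rw [hKK] at h1
  have h2 := Submodule.finrank_le K
  exact ⟨finrank F K, by omega⟩

lemma even_finrank_sub_finrank_ker {B : BilinForm F V} (ha : B.IsAlt) :
    Even (finrank F V - finrank F (LinearMap.ker B)) := by
  obtain ⟨U, hU⟩ := Submodule.exists_isCompl (LinearMap.ker B)
  have h1 := Submodule.finrank_add_eq_of_isCompl hU
  have h2 : (B.restrict U).Nondegenerate := by
    refine LinearMap.BilinForm.nondegenerate_of_left fun u hu => Subtype.ext ?_
    refine (Submodule.disjoint_def.1 hU.disjoint) u (LinearMap.mem_ker.2 (LinearMap.ext fun v => ?_))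
      u.2
    obtain ⟨k, hk, l, hl, rfl⟩ := Submodule.mem_sup.1 (hU.sup_eq_top ▸ Submodule.mem_top (x := v))
    have e1 : B u l = 0 := hu ⟨l, hl⟩
    have e2 : B u k = 0 := by
      rw [← ha.neg_eq, LinearMap.mem_ker.1 hk]
      simp
    simp [e1, e2]
  have h3 := even_finrank_of_isAlt h2 fun u => ha u
  rwa [← h1, Nat.add_sub_cancel_left]

/-- The radical of the skew-symmetrization of a bilinear form. -/
def symRad (X : BilinForm F V) : Submodule F V := LinearMap.ker (X - X.flip)

omit [FiniteDimensional F V] in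
lemma mem_symRad {X : BilinForm F V} {u : V} : u ∈ symRad X ↔ ∀ v, X u v = X v u := by
  refine LinearMap.mem_ker.trans ⟨fun h v => ?_, fun h => LinearMap.ext fun v => ?_⟩
  · exact sub_eq_zero.1 (congrArg (fun f => f v) h)
  · exact sub_eq_zero.2 (h v)

lemma even_finrank_sub_finrank_symRad (X : BilinForm F V) :
    Even (finrank F V - finrank F (symRad X)) :=
  even_finrank_sub_finrank_ker fun u => sub_self (X u u)

/-- The form is alternating on its symmetric radical. -/
def RadAlt (X : BilinForm F V) : Prop := ∀ r ∈ symRad X, X r r = 0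

/-- A presentation of a bilinear form as a `modForm`. -/
structure IsDecomp (X : BilinForm F V) (R U : Submodule F V) (K : Submodule F U) : Prop where
  isometric : Isometric X (modForm (X.restrict R) (X.restrict U) K)
  symm : ∀ a b, X.restrict R a b = X.restrict R b a
  nondegenerate_left : (X.restrict R).Nondegenerate
  skew : ∀ u : U, (∀ v, X.restrict U u v = X.restrict U v u) → u = 0
  nondegenerate_right : ((X.restrict U).restrict K).Nondegenerate
  radAlt_iff : RadAlt X ↔ (X.restrict R).IsAlt
  finrank_eq : finrank F V = finrank F R + (finrank F U - finrank F K) + finrank F U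
  finrank_symRad : finrank F (symRad X) = finrank F R + (finrank F U - finrank F K)

theorem exists_isDecomp {X : BilinForm F V} (hX : X.Nondegenerate) :
    ∃ R U K, IsDecomp X R U K := by
  have hsym : ∀ r ∈ symRad X, ∀ v, X r v = X v r := fun r hr => mem_symRad.1 hr
  let R₀ := symRad X ⊓ X.orthogonal (symRad X)
  obtain ⟨R, hR0, hRs⟩ := IsModularLattice.exists_disjoint_and_sup_eq (inf_le_left : R₀ ≤ symRad X)
  have hRle : R ≤ symRad X := hRs ▸ le_sup_right
  have hR0le : R₀ ≤ symRad X := inf_le_left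
  have hR0R : ∀ r ∈ R₀, ∀ a ∈ symRad X, X r a = 0 := fun r hr a ha => by
    rw [hsym r hr.1]
    exact hr.2 a ha
  have hndR : (X.restrict R).Nondegenerate := by
    refine LinearMap.BilinForm.nondegenerate_of_left fun u hu => Subtype.ext ?_
    refine Submodule.disjoint_def.1 hR0 u ⟨hRle u.2, fun a ha => ?_⟩ u.2
    rw [← hRs] at ha
    obtain ⟨k, hk, l, hl, rfl⟩ := Submodule.mem_sup.1 ha
    have e1 : X u l = 0 := hu ⟨l, hl⟩
    have e2 : X k u = 0 := hR0R k hk _ (hRle u.2)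
    change X _ _ = 0
    rw [map_add, LinearMap.add_apply, e2, ← hsym u (hRle u.2), e1, add_zero]
  have hRdis : ∀ u ∈ R, u ∈ X.orthogonal R → u = 0 := fun u hu hu' =>
    congrArg Subtype.val (hndR.2 ⟨u, hu⟩ fun v => hu' v v.2)
  have hR0I : R₀ ≤ X.orthogonal R := fun u hu a ha => by
    change X a u = 0
    rw [hsym a (hRle ha)]
    exact hR0R u hu a (hRle ha)
  obtain ⟨U, hU0, hUs⟩ := IsModularLattice.exists_disjoint_and_sup_eq hR0I
  have hUle : U ≤ X.orthogonal R := hUs ▸ le_sup_right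
  have hfr : finrank F V = finrank F R + finrank F R₀ + finrank F U := by
    have h1 := LinearMap.BilinForm.finrank_orthogonal hX R
    have h2 := Submodule.finrank_sup_add_finrank_inf_eq R₀ U
    rw [hUs, hU0.eq_bot, finrank_bot] at h2
    have h3 := Submodule.finrank_le R
    omega
  have hfs : finrank F (symRad X) = finrank F R + finrank F R₀ := by
    have h2 := Submodule.finrank_sup_add_finrank_inf_eq R₀ R
    rw [hRs, hR0.eq_bot, finrank_bot] at h2
    omega
  -- The decomposition of the space.
  let T₀ : R × R₀ × U →ₗ[F] V := R.subtype.coprod (R₀.subtype.coprod U.subtype)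
  have hT₀ : ∀ a, T₀ a = a.1 + (a.2.1 + a.2.2) := fun a => rfl
  have hT₀inj : Function.Injective T₀ := by
    refine (injective_iff_map_eq_zero _).2 fun a ha => ?_
    rw [hT₀] at ha
    have h1 : (a.1 : V) = 0 := by
      refine hRdis _ a.1.2 ?_
      rw [eq_neg_of_add_eq_zero_left ha]
      exact neg_mem (add_mem (hR0I a.2.1.2) (hUle a.2.2.2))
    rw [h1, zero_add] at ha
    have h2 : (a.2.1 : V) = 0 := by
      refine Submodule.disjoint_def.1 hU0 _ a.2.1.2 ?_
      rw [eq_neg_of_add_eq_zero_left ha]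
      exact neg_mem a.2.2.2
    rw [h2, zero_add] at ha
    exact Prod.ext (Subtype.ext h1) (Prod.ext (Subtype.ext h2) (Subtype.ext ha))
  have hT₀sur : Function.Surjective T₀ := by
    refine (LinearMap.injective_iff_surjective_of_finrank_eq_finrank ?_).1 hT₀inj
    rw [finrank_prod, finrank_prod, hfr, add_assoc]
  -- The pairing between `R₀` and `U`.
  let K : Submodule F U := (X.orthogonal R₀).comap U.subtype
  have hK : ∀ k : U, k ∈ K ↔ ∀ r ∈ R₀, X r k = 0 := fun k => Iff.rfl
  let p : R₀ →ₗ[F] Dual F (U ⧸ K) := K.liftQ ((X.domRestrict₁₂ R₀ U).flip)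
    (fun k hk => LinearMap.ext fun r => (hK k).1 hk r r.2) |>.flip
  have hp : ∀ r u, p r (K.mkQ u) = X r u := fun r u => rfl
  have hpinj : Function.Injective p := by
    refine (injective_iff_map_eq_zero _).2 fun r hr => Subtype.ext ?_
    refine hX.1 _ fun v => ?_
    obtain ⟨a, rfl⟩ := hT₀sur v
    have e1 : X r a.2.2 = 0 := by rw [← hp, hr, LinearMap.zero_apply]
    rw [hT₀, map_add, map_add, e1, hR0R _ r.2 _ (hRle a.1.2), hR0R _ r.2 _ (hR0le a.2.1.2)]
    simp
  have hrk : finrank F R₀ = finrank F U - finrank F K := by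
    have h1 := LinearMap.finrank_le_finrank_of_injective hpinj
    have h2 : Function.Injective p.flip := by
      refine (injective_iff_map_eq_zero _).2 fun u hu => ?_
      obtain ⟨u, rfl⟩ := K.mkQ_surjective u
      refine (Submodule.Quotient.mk_eq_zero _).2 ((hK u).2 fun r hr => ?_)
      exact congrArg (fun l => l ⟨r, hr⟩) hu
    have h3 := LinearMap.finrank_le_finrank_of_injective h2
    have h4 := Submodule.finrank_quotient_add_finrank K
    rw [Subspace.dual_finrank_eq] at h1 h3
    omega
  have hrk' : finrank F R₀ = finrank F (Dual F (U ⧸ K)) := by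
    have h4 := Submodule.finrank_quotient_add_finrank K
    rw [Subspace.dual_finrank_eq]
    omega
  let e : R₀ ≃ₗ[F] Dual F (U ⧸ K) := LinearEquiv.ofInjectiveOfFinrankEq p hpinj hrk'
  have he : ∀ (ρ : Dual F (U ⧸ K)) (u : U), X (e.symm ρ) u = ρ (K.mkQ u) := fun ρ u => by
    rw [← hp]
    exact congrArg (fun l => l (K.mkQ u)) (e.apply_symm_apply ρ)
  let E : (R × Dual F (U ⧸ K) × U) ≃ₗ[F] V :=
    ((LinearEquiv.refl F R).prodCongr (e.symm.prodCongr (LinearEquiv.refl F U))).trans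
      (LinearEquiv.ofBijective T₀ ⟨hT₀inj, hT₀sur⟩)
  have hE : ∀ a, E a = a.1 + (e.symm a.2.1 + a.2.2) := fun a => rfl
  have hUR : ∀ u ∈ U, ∀ r ∈ R, X r u = 0 := fun u hu r hr => hUle hu r hr
  refine ⟨R, U, K, ⟨Isometric.symm ⟨E, fun a b => ?_⟩, fun a b => hsym a (hRle a.2) b, hndR,
    fun u hu => ?_, ?_, ?_, by omega, by omega⟩⟩
  · rw [modForm_apply, hE, hE, ← he, ← he]
    have e1 : X (e.symm a.2.1) (e.symm b.2.1) = 0 := hR0R _ (e.symm a.2.1).2 _ (e.symm b.2.1).2.1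
    have e2 : X (e.symm a.2.1) b.1 = 0 := hR0R _ (e.symm a.2.1).2 _ (hRle b.1.2)
    have e3 : X a.1 (e.symm b.2.1) = 0 := by
      rw [hsym _ (hRle a.1.2)]
      exact hR0R _ (e.symm b.2.1).2 _ (hRle a.1.2)
    have e4 : X a.2.2 b.1 = 0 := by
      rw [← hsym _ (hRle b.1.2)]
      exact hUR _ a.2.2.2 _ b.1.2
    have e5 : X a.1 b.2.2 = 0 := hUR _ b.2.2.2 _ a.1.2
    have e6 : X a.2.2 (e.symm b.2.1) = X (e.symm b.2.1) a.2.2 :=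
      (hsym _ (hR0le (e.symm b.2.1).2) _).symm
    simp only [map_add, LinearMap.add_apply, e1, e2, e3, e4, e5, e6,
      LinearMap.BilinForm.restrict_apply]
    change _ = X a.1 b.1 + _ + _ + X a.2.2 b.2.2
    ring
  · have h1 : (u : V) ∈ symRad X := mem_symRad.2 fun v => by
      obtain ⟨a, rfl⟩ := hT₀sur v
      have e1 : X u a.2.2 = X a.2.2 u := hu a.2.2
      rw [hT₀]
      simp only [map_add, LinearMap.add_apply, e1, hsym _ (hRle a.1.2) u,
        hsym _ (hR0le a.2.1.2) u]
    rw [← hRs] at h1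
    obtain ⟨k, hk, l, hl, hkl⟩ := Submodule.mem_sup.1 h1
    have hl0 : l = 0 := hRdis l hl (by
      rw [eq_sub_of_add_eq' hkl]
      exact sub_mem (hUle u.2) (hR0I hk))
    rw [hl0, add_zero] at hkl
    exact Subtype.ext (Submodule.disjoint_def.1 hU0 u (hkl ▸ hk) u.2)
  · refine LinearMap.BilinForm.nondegenerate_of_left fun k hk => ?_
    have hz : ∀ x ∈ K, (X.restrict U k.1) x = 0 := fun x hx => hk ⟨x, hx⟩
    let ψ : Dual F (U ⧸ K) := K.liftQ (X.restrict U k.1) fun x hx => LinearMap.mem_ker.2 (hz x hx)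
    have hψ : ∀ u, ψ (K.mkQ u) = X k.1 u := fun u => rfl
    have hk0 : (k.1 : V) - e.symm ψ = 0 := by
      refine hX.1 _ fun v => ?_
      obtain ⟨a, rfl⟩ := hT₀sur v
      have e1 : X k.1 a.2.2 = X (e.symm ψ) a.2.2 := by rw [he, hψ]
      have e2 : X k.1 a.2.1 = 0 := by
        rw [← hsym _ (hR0le a.2.1.2)]
        exact (hK _).1 k.2 _ a.2.1.2
      have e3 : X k.1 a.1 = 0 := by
        rw [← hsym _ (hRle a.1.2)]
        exact hUR _ k.1.2 _ a.1.2
      rw [hT₀]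
      simp only [map_add, map_sub, LinearMap.sub_apply, e1, e2, e3,
        hR0R _ (e.symm ψ).2 _ (hRle a.1.2), hR0R _ (e.symm ψ).2 _ (hR0le a.2.1.2)]
      ring
    refine Subtype.ext (Subtype.ext (Submodule.disjoint_def.1 hU0 _ ?_ k.1.2))
    rw [sub_eq_zero.1 hk0]
    exact (e.symm ψ).2
  · refine ⟨fun h a => h a (hRle a.2), fun h r hr => ?_⟩
    have hr' := hr
    rw [← hRs] at hr'
    obtain ⟨k, hk, l, hl, rfl⟩ := Submodule.mem_sup.1 hr'
    have e1 : X l l = 0 := h ⟨l, hl⟩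
    have e2 : X l k = 0 := by
      rw [hsym l (hRle hl)]
      exact hR0R k hk l (hRle hl)
    simp [e1, e2, hR0R k hk l (hRle hl), hR0R k hk k hk.1]

end Decomposition

section Fibers

open Module

open LinearMap (BilinForm)

lemma exists_sq_eq {F : Type*} [Field F] [Finite F] [CharP F 2] (a : F) : ∃ b, b ^ 2 = a := by
  obtain ⟨b, hb⟩ := FiniteField.isSquare_of_char_two (ringChar.eq F 2) a
  exact ⟨b, by rw [hb, sq]⟩

/-- The Artin-Schreier map `a ↦ a ^ 2 + a` in characteristic two. -/
def artinSchreier (F : Type*) [Field F] [CharP F 2] : F →+ F where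
  toFun a := a ^ 2 + a
  map_zero' := by simp
  map_add' a b := by rw [CharTwo.add_sq]; ring

lemma add_mem_range_artinSchreier {F : Type*} [Field F] [Finite F] [CharP F 2] {a b : F}
    (ha : a ∉ (artinSchreier F).range) (hb : b ∉ (artinSchreier F).range) :
    a + b ∈ (artinSchreier F).range := by
  have hk : Nat.card (artinSchreier F).ker = 2 := by
    have : ((artinSchreier F).ker : Set F) = {0, 1} := by
      ext x
      have e : x ^ 2 + x = x * (x + 1) := by ring
      have : x ^ 2 + x = 0 ↔ x = 0 ∨ x = 1 := by
        rw [e, mul_eq_zero, CharTwo.add_eq_zero]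
      exact this
    rw [← SetLike.coe_sort_coe, Nat.card_coe_set_eq, this, Set.ncard_pair zero_ne_one]
  have h1 := (artinSchreier F).ker.card_mul_index
  have h2 := (artinSchreier F).range.card_mul_index
  rw [AddSubgroup.index_ker, hk, ← h2, mul_comm] at h1
  have h3 : (artinSchreier F).range.index = 2 :=
    (Nat.eq_of_mul_eq_mul_left Nat.card_pos h1).symm
  rw [AddSubgroup.add_mem_iff_of_index_two h3]
  tauto

variable {F : Type*} [Field F] [Finite F] [CharP F 2]
variable {V₁ V₂ V₃ : Type*} [AddCommGroup V₁] [Module F V₁] [FiniteDimensional F V₁]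
  [AddCommGroup V₂] [Module F V₂] [FiniteDimensional F V₂]
  [AddCommGroup V₃] [Module F V₃] [FiniteDimensional F V₃]

section Symmetric

omit [FiniteDimensional F V₁] in
lemma exists_apply_self_eq_one {S : BilinForm F V₁} (h : ¬ S.IsAlt) : ∃ x, S x x = 1 := by
  obtain ⟨y, hy⟩ : ∃ y, S y y ≠ 0 := by
    by_contra! hc
    exact h hc
  obtain ⟨c, hc⟩ := exists_sq_eq (S y y)
  refine ⟨c⁻¹ • y, ?_⟩
  have : c ≠ 0 := by
    rintro rfl
    exact hy (by rw [← hc]; simp)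
  simp only [map_smul, LinearMap.smul_apply, smul_eq_mul, ← hc]
  field_simp

omit [Finite F] in
lemma exists_orthogonal_not_isAlt {S : BilinForm F V₁} (hn : S.Nondegenerate)
    (hs : S.IsSymm) {x : V₁} (hx : S x x = 1) (h2 : 2 ≤ finrank F V₁) :
    ∃ x, S x x = 1 ∧ ¬ (S.restrict (S.orthogonal (F ∙ x))).IsAlt := by
  by_cases ha : (S.restrict (S.orthogonal (F ∙ x))).IsAlt
  swap
  · exact ⟨x, hx, ha⟩
  have hx0 : S x x ≠ 0 := by simp [hx]
  have hn' := LinearMap.BilinForm.restrict_nondegenerate_orthogonal_spanSingleton S hn hs.isRefl hx0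
  have hx1 : x ≠ 0 := by
    rintro rfl
    simp at hx
  have hfr := Submodule.finrank_add_eq_of_isCompl
    (LinearMap.BilinForm.isCompl_span_singleton_orthogonal hx0)
  rw [finrank_span_singleton hx1] at hfr
  have : Nontrivial (S.orthogonal (F ∙ x)) :=
    Module.nontrivial_of_finrank_pos (R := F) (by omega)
  obtain ⟨e, he⟩ := exists_ne (0 : S.orthogonal (F ∙ x))
  obtain ⟨f, hf⟩ : ∃ f : S.orthogonal (F ∙ x), S e f = 1 := by
    obtain ⟨f, hf⟩ : ∃ f : S.orthogonal (F ∙ x), S e f ≠ 0 := by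
      by_contra! hc
      exact he (hn'.1 e hc)
    refine ⟨(S e f)⁻¹ • f, ?_⟩
    simp [hf]
  have hxo : ∀ u : S.orthogonal (F ∙ x), S x u = 0 := fun u =>
    u.2 x (Submodule.mem_span_singleton_self x)
  have hxo' : ∀ u : S.orthogonal (F ∙ x), S u x = 0 := fun u => by rw [hs.eq, hxo]
  have hee : S e e = 0 := ha e
  have hff : S f f = 0 := ha f
  refine ⟨x + e, by simp [hx, hxo, hxo', hee], fun hc => ?_⟩
  have hy : x + f ∈ S.orthogonal (F ∙ (x + e : V₁)) := by
    intro z hz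
    obtain ⟨c, rfl⟩ := Submodule.mem_span_singleton.1 hz
    change S _ _ = 0
    simp [hx, hxo, hxo', hf, CharTwo.add_self_eq_zero]
  have := hc ⟨x + f, hy⟩
  change S (x + f) (x + f) = 0 at this
  simp [hx, hxo, hxo', hff] at this

/-- Nonalternating symmetric nondegenerate forms of the same dimension are isometric. -/
theorem isometric_of_isSymm {S₁ : BilinForm F V₁} {S₂ : BilinForm F V₂} (n₁ : S₁.Nondegenerate)
    (n₂ : S₂.Nondegenerate) (s₁ : S₁.IsSymm) (s₂ : S₂.IsSymm)
    (a₁ : ¬ S₁.IsAlt) (a₂ : ¬ S₂.IsAlt) (hdim : finrank F V₁ = finrank F V₂) :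
    Isometric S₁ S₂ := by
  induction hd : finrank F V₁ using Nat.strong_induction_on generalizing V₁ V₂ with
  | _ d ih =>
  have key : ∀ {x₁ : V₁} {x₂ : V₂}, S₁ x₁ x₁ = 1 → S₂ x₂ x₂ = 1 →
      (finrank F V₁ = 1 ∨ (¬ (S₁.restrict (S₁.orthogonal (F ∙ x₁))).IsAlt ∧
        ¬ (S₂.restrict (S₂.orthogonal (F ∙ x₂))).IsAlt)) → Isometric S₁ S₂ := by
    intro x₁ x₂ h₁ h₂ h
    have z₁ : x₁ ≠ 0 := by
      rintro rfl
      simp at h₁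
    have z₂ : x₂ ≠ 0 := by
      rintro rfl
      simp at h₂
    have y₁ : S₁ x₁ x₁ ≠ 0 := by simp [h₁]
    have y₂ : S₂ x₂ x₂ ≠ 0 := by simp [h₂]
    have c₁ := LinearMap.BilinForm.isCompl_span_singleton_orthogonal y₁
    have c₂ := LinearMap.BilinForm.isCompl_span_singleton_orthogonal y₂
    have m₁ := LinearMap.BilinForm.restrict_nondegenerate_orthogonal_spanSingleton S₁ n₁
      s₁.isRefl y₁
    have m₂ := LinearMap.BilinForm.restrict_nondegenerate_orthogonal_spanSingleton S₂ n₂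
      s₂.isRefl y₂
    have f₁ := Submodule.finrank_add_eq_of_isCompl c₁
    have f₂ := Submodule.finrank_add_eq_of_isCompl c₂
    rw [finrank_span_singleton z₁] at f₁
    rw [finrank_span_singleton z₂] at f₂
    refine Isometric.of_isCompl c₁ c₂ (fun w hw u hu => hu w hw)
      (fun w hw u hu => (s₁.eq _ _).trans (hu w hw)) (fun w hw u hu => hu w hw)
      (fun w hw u hu => (s₂.eq _ _).trans (hu w hw)) ?_ ?_
    · refine ⟨(LinearEquiv.toSpanNonzeroSingleton F V₁ x₁ z₁).symm.trans
        (LinearEquiv.toSpanNonzeroSingleton F V₂ x₂ z₂), fun u v => ?_⟩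
      obtain ⟨a, rfl⟩ := (LinearEquiv.toSpanNonzeroSingleton F V₁ x₁ z₁).surjective u
      obtain ⟨b, rfl⟩ := (LinearEquiv.toSpanNonzeroSingleton F V₁ x₁ z₁).surjective v
      simp only [LinearEquiv.trans_apply, LinearEquiv.symm_apply_apply]
      change S₂ (a • x₂) (b • x₂) = S₁ (a • x₁) (b • x₁)
      simp [h₁, h₂]
    · rcases h with h | ⟨h, h'⟩
      · have t₁ : finrank F (S₁.orthogonal (F ∙ x₁)) = 0 := by omega
        have t₂ : finrank F (S₂.orthogonal (F ∙ x₂)) = 0 := by omega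
        have i₁ := Module.finrank_zero_iff.1 t₁
        have i₂ := Module.finrank_zero_iff.1 t₂
        exact ⟨LinearEquiv.ofFinrankEq _ _ (t₁.trans t₂.symm), fun u v => by
          rw [Subsingleton.elim u 0]
          simp⟩
      · exact ih _ (by omega) m₁ m₂ (s₁.restrict _) (s₂.restrict _) h h' (by omega) rfl
  obtain ⟨x₁, h₁⟩ := exists_apply_self_eq_one a₁
  obtain ⟨x₂, h₂⟩ := exists_apply_self_eq_one a₂
  rcases le_or_gt 2 (finrank F V₁) with h | h
  · obtain ⟨x₁, h₁, h₁'⟩ := exists_orthogonal_not_isAlt n₁ s₁ h₁ h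
    obtain ⟨x₂, h₂, h₂'⟩ := exists_orthogonal_not_isAlt n₂ s₂ h₂ (hdim ▸ h)
    exact key h₁ h₂ (Or.inr ⟨h₁', h₂'⟩)
  · have : finrank F V₁ ≠ 0 := fun h0 => by
      have := Module.finrank_zero_iff.1 h0
      rw [Subsingleton.elim x₁ 0] at h₁
      simp at h₁
    exact key h₁ h₂ (Or.inl (by omega))

end Symmetric

/-- The data comparing two forms with isometric restrictions and isometric skew-symmetrizations. -/
structure IsLink (Y₁ : BilinForm F V₁) (Y₂ : BilinForm F V₂) (K₁ : Submodule F V₁)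
    (K₂ : Submodule F V₂) (f : V₁ ≃ₗ[F] V₂) (w : V₁) : Prop where
  map : K₁.map (f : V₁ →ₗ[F] V₂) = K₂
  form : ∀ u ∈ K₁, ∀ v ∈ K₁, Y₂ (f u) (f v) = Y₁ u v
  skew : ∀ u v, Y₂ (f u) (f v) - Y₂ (f v) (f u) = Y₁ u v - Y₁ v u
  orth : ∀ k ∈ K₁, Y₁ k w - Y₁ w k = 0
  quad : ∀ v, Y₁ v v = Y₂ (f v) (f v) + (Y₁ v w - Y₁ w v) ^ 2

theorem exists_isLink {Y₁ : BilinForm F V₁} {Y₂ : BilinForm F V₂}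
    {K₁ : Submodule F V₁} {K₂ : Submodule F V₂}
    (n₁ : ∀ u, (∀ v, Y₁ u v = Y₁ v u) → u = 0) (n₂ : ∀ u, (∀ v, Y₂ u v = Y₂ v u) → u = 0)
    (hdim : finrank F V₁ = finrank F V₂) (hK : Isometric (Y₁.restrict K₁) (Y₂.restrict K₂)) :
    ∃ f w, IsLink Y₁ Y₂ K₁ K₂ f w := by
  obtain ⟨φ, hφ⟩ := hK
  have d₁ : (Y₁ - Y₁.flip).Nondegenerate := LinearMap.BilinForm.nondegenerate_of_left fun u hu =>
    n₁ u fun v => sub_eq_zero.1 (hu v)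
  have d₂ : (Y₂ - Y₂.flip).Nondegenerate := LinearMap.BilinForm.nondegenerate_of_left fun u hu =>
    n₂ u fun v => sub_eq_zero.1 (hu v)
  obtain ⟨g, hg⟩ := LinearMap.exists_leftInverse_of_injective K₁.subtype K₁.ker_subtype
  have hg' : ∀ k : K₁, g k = k := fun k => LinearMap.congr_fun hg k
  let h : V₁ →ₗ[F] V₂ := K₂.subtype ∘ₗ (φ : K₁ →ₗ[F] K₂) ∘ₗ g
  have hh : ∀ k : K₁, h k = φ k := fun k => by simp [h, hg']
  have hφ' : ∀ u ∈ K₁, ∀ v ∈ K₁, Y₂ (h u) (h v) = Y₁ u v := fun u hu v hv => by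
    rw [hh ⟨u, hu⟩, hh ⟨v, hv⟩]
    exact hφ ⟨u, hu⟩ ⟨v, hv⟩
  obtain ⟨f, hf, hfh⟩ := exists_isometry_extending d₁ d₂ (fun u => sub_self (Y₁ u u))
    (fun u => sub_self (Y₂ u u)) hdim K₁ h (fun x hx y hy => by
      change Y₂ (h x) (h y) - Y₂ (h y) (h x) = Y₁ x y - Y₁ y x
      rw [hφ' x hx y hy, hφ' y hy x hx]) (fun x hx h0 => by
      rw [hh ⟨x, hx⟩] at h0
      exact congrArg Subtype.val (φ.map_eq_zero_iff.1 (Subtype.ext h0)))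
  have hsk : ∀ u v, Y₂ (f u) (f v) - Y₂ (f v) (f u) = Y₁ u v - Y₁ v u := hf
  have hform : ∀ u ∈ K₁, ∀ v ∈ K₁, Y₂ (f u) (f v) = Y₁ u v := fun u hu v hv => by
    rw [hfh u hu, hfh v hv, hφ' u hu v hv]
  have two : (2 : F) = 0 := CharTwo.two_eq_zero
  choose r hr using fun a : F => exists_sq_eq a
  let ℓ : V₁ →ₗ[F] F :=
    { toFun := fun v => r (Y₁ v v - Y₂ (f v) (f v))
      map_add' := fun u v => by
        refine CharTwo.sq_injective ?_
        simp only [CharTwo.add_sq, hr, map_add, LinearMap.add_apply]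
        linear_combination -hsk u v + (Y₁ v u - Y₂ (f v) (f u)) * two
      map_smul' := fun c v => by
        refine CharTwo.sq_injective ?_
        simp only [smul_eq_mul, mul_pow, hr, map_smul, LinearMap.smul_apply, RingHom.id_apply]
        ring }
  have hℓ : ∀ v, ℓ v ^ 2 = Y₁ v v - Y₂ (f v) (f v) := fun v => hr _
  obtain ⟨w, hw⟩ := d₁.exists_right ℓ
  have hw' : ∀ v, Y₁ v w - Y₁ w v = ℓ v := hw
  refine ⟨f, w, ⟨?_, hform, hsk, fun k hk => ?_, fun v => ?_⟩⟩
  · ext y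
    refine ⟨?_, fun hy => ?_⟩
    · rintro ⟨x, hx, rfl⟩
      change f x ∈ K₂
      rw [hfh x hx, hh ⟨x, hx⟩]
      exact (φ ⟨x, hx⟩).2
    · refine ⟨φ.symm ⟨y, hy⟩, (φ.symm ⟨y, hy⟩).2, ?_⟩
      change f _ = y
      rw [hfh _ (φ.symm ⟨y, hy⟩).2, hh, φ.apply_symm_apply]
  · rw [hw']
    have := hℓ k
    rw [hform k hk k hk, sub_self] at this
    exact pow_eq_zero_iff two_ne_zero |>.1 this
  · rw [hw', hℓ]
    ring

omit [Finite F] [FiniteDimensional F V₁] [FiniteDimensional F V₂] [FiniteDimensional F V₃] in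
lemma IsLink.comp {Y₁ : BilinForm F V₁} {Y₂ : BilinForm F V₂} {Y₃ : BilinForm F V₃}
    {K₁ : Submodule F V₁} {K₂ : Submodule F V₂} {K₃ : Submodule F V₃} {f : V₁ ≃ₗ[F] V₂}
    {g : V₁ ≃ₗ[F] V₃} {w z : V₁} (hf : IsLink Y₁ Y₂ K₁ K₂ f w) (hg : IsLink Y₁ Y₃ K₁ K₃ g z) :
    IsLink Y₂ Y₃ K₂ K₃ (f.symm.trans g) (f (w + z)) ∧
      Y₂ (f (w + z)) (f (w + z)) = Y₁ w w + Y₁ z z + artinSchreier F (Y₁ w z - Y₁ z w) := by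
  have two : (2 : F) = 0 := CharTwo.two_eq_zero
  have hm : ∀ x ∈ K₂, f.symm x ∈ K₁ := fun x hx => by
    rw [← hf.map] at hx
    obtain ⟨y, hy, rfl⟩ := hx
    simpa using hy
  refine ⟨⟨?_, fun u hu v hv => ?_, fun u v => ?_, fun k hk => ?_, fun v => ?_⟩, ?_⟩
  · rw [← hf.map, ← hg.map]
    ext y
    simp
  · have := hf.form _ (hm u hu) _ (hm v hv)
    rw [LinearEquiv.trans_apply, LinearEquiv.trans_apply, hg.form _ (hm u hu) _ (hm v hv), ← this,
      f.apply_symm_apply, f.apply_symm_apply]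
  · rw [LinearEquiv.trans_apply, LinearEquiv.trans_apply, hg.skew, ← hf.skew, f.apply_symm_apply,
      f.apply_symm_apply]
  · obtain ⟨k, rfl⟩ := f.surjective k
    have hk' := hm _ hk
    rw [f.symm_apply_apply] at hk'
    rw [hf.skew, map_add, map_add, LinearMap.add_apply]
    linear_combination hf.orth k hk' + hg.orth k hk'
  · obtain ⟨v, rfl⟩ := f.surjective v
    rw [hf.skew, LinearEquiv.trans_apply, f.symm_apply_apply, map_add, map_add,
      LinearMap.add_apply]
    have e : Y₁ v w + Y₁ v z - (Y₁ w v + Y₁ z v) = (Y₁ v w - Y₁ w v) + (Y₁ v z - Y₁ z v) := by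
      ring
    rw [e, CharTwo.add_sq]
    linear_combination hg.quad v - hf.quad v - (Y₁ v w - Y₁ w v) ^ 2 * two
  · have h := hf.quad (w + z)
    have e : Y₁ (w + z) w - Y₁ w (w + z) = Y₁ z w - Y₁ w z := by
      simp only [map_add, LinearMap.add_apply]
      ring
    rw [e] at h
    have h' : Y₁ (w + z) (w + z) = Y₁ w w + Y₁ z z + Y₁ w z + Y₁ z w := by
      simp only [map_add, LinearMap.add_apply]
      ring
    change _ = _ + _ + ((Y₁ w z - Y₁ z w) ^ 2 + (Y₁ w z - Y₁ z w))
    linear_combination h' - h + (Y₁ z w - (Y₁ w z - Y₁ z w) ^ 2) * two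

omit [Finite F] [FiniteDimensional F V₁] [FiniteDimensional F V₂] in
/-- Correcting a link by a transvection. -/
lemma IsLink.exists_equiv {Y₁ : BilinForm F V₁} {Y₂ : BilinForm F V₂}
    {K₁ : Submodule F V₁} {K₂ : Submodule F V₂} {f : V₁ ≃ₗ[F] V₂} {w : V₁}
    (hf : IsLink Y₁ Y₂ K₁ K₂ f w) (hw : Y₁ w w ∈ (artinSchreier F).range) :
    ∃ g : V₁ ≃ₗ[F] V₂, K₁.map (g : V₁ →ₗ[F] V₂) = K₂ ∧
      (∀ u ∈ K₁, ∀ v ∈ K₁, Y₂ (g u) (g v) = Y₁ u v) ∧ ∀ v, Y₁ v v = Y₂ (g v) (g v) := by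
  have two : (2 : F) = 0 := CharTwo.two_eq_zero
  obtain ⟨a, ha⟩ := hw
  replace ha : a ^ 2 + a = Y₁ w w := ha
  obtain ⟨b, hb⟩ : ∃ b, b ^ 2 * Y₁ w w + b + 1 = 0 := by
    by_cases h0 : Y₁ w w = 0
    · exact ⟨1, by rw [h0]; linear_combination two⟩
    · refine ⟨a / Y₁ w w, ?_⟩
      field_simp
      linear_combination ha + Y₁ w w * two
  let T : V₁ →ₗ[F] V₁ := LinearMap.id + (b • (Y₁.flip w - Y₁ w)).smulRight w
  have hT : ∀ v, T v = v + (b * (Y₁ v w - Y₁ w v)) • w := fun v => rfl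
  have hTT : Function.Involutive T := fun v => by
    rw [hT (T v), hT]
    simp only [map_add, map_smul, LinearMap.add_apply, LinearMap.smul_apply, smul_eq_mul]
    rw [add_assoc, ← add_smul]
    convert add_zero v
    rw [← zero_smul F w]
    congr 1
    linear_combination b * (Y₁ v w - Y₁ w v) * two
  let t := LinearEquiv.ofInvolutive T hTT
  have ht : ∀ v, t v = T v := fun v => rfl
  have hTK : ∀ k ∈ K₁, T k = k := fun k hk => by rw [hT, hf.orth k hk]; simp
  have hmap : K₁.map (t : V₁ →ₗ[F] V₁) = K₁ := by
    ext y
    refine ⟨?_, fun hy => ⟨y, hy, hTK y hy⟩⟩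
    rintro ⟨x, hx, rfl⟩
    change T x ∈ K₁
    rwa [hTK x hx]
  refine ⟨t.trans f, ?_, fun u hu v hv => ?_, fun v => ?_⟩
  · rw [← hf.map, LinearEquiv.coe_trans, Submodule.map_comp, hmap]
  · rw [LinearEquiv.trans_apply, LinearEquiv.trans_apply, ht, ht, hTK u hu, hTK v hv,
      hf.form u hu v hv]
  · rw [LinearEquiv.trans_apply, ht]
    have h := hf.quad (T v)
    have e1 : Y₁ (T v) w - Y₁ w (T v) = Y₁ v w - Y₁ w v := by
      rw [hT]
      simp only [map_add, map_smul, LinearMap.add_apply, LinearMap.smul_apply, smul_eq_mul]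
      ring
    have e2 : Y₁ (T v) (T v) = Y₁ v v + (Y₁ v w - Y₁ w v) * b * (Y₁ v w + Y₁ w v) +
        b ^ 2 * (Y₁ v w - Y₁ w v) ^ 2 * Y₁ w w := by
      rw [hT]
      simp only [map_add, map_smul, LinearMap.add_apply, LinearMap.smul_apply, smul_eq_mul]
      ring
    rw [e1, e2] at h
    linear_combination h - (Y₁ v w - Y₁ w v) ^ 2 * hb +
      ((Y₁ v w - Y₁ w v) ^ 2 - (Y₁ v w - Y₁ w v) * b * Y₁ w v) * two

end Fibers

section FormClass

open Module

open LinearMap (BilinForm)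

section Invariance

variable {F : Type*} [Field F]
variable {V₁ V₂ : Type*} [AddCommGroup V₁] [Module F V₁] [AddCommGroup V₂] [Module F V₂]

lemma Isometric.finrank_eq {B₁ : BilinForm F V₁} {B₂ : BilinForm F V₂} (h : Isometric B₁ B₂) :
    finrank F V₁ = finrank F V₂ := h.choose.finrank_eq

lemma symRad_map {B₁ : BilinForm F V₁} {B₂ : BilinForm F V₂} (f : V₁ ≃ₗ[F] V₂)
    (hf : ∀ u v, B₂ (f u) (f v) = B₁ u v) :
    (symRad B₁).map (f : V₁ →ₗ[F] V₂) = symRad B₂ := by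
  ext y
  obtain ⟨x, rfl⟩ := f.surjective y
  rw [Submodule.mem_map_equiv, f.symm_apply_apply, mem_symRad, mem_symRad]
  refine ⟨fun h v => ?_, fun h v => ?_⟩
  · obtain ⟨v, rfl⟩ := f.surjective v
    rw [hf, hf, h]
  · rw [← hf, ← hf, h]

lemma Isometric.finrank_symRad {B₁ : BilinForm F V₁} {B₂ : BilinForm F V₂}
    (h : Isometric B₁ B₂) : finrank F (symRad B₁) = finrank F (symRad B₂) := by
  obtain ⟨f, hf⟩ := h
  rw [← symRad_map f hf, LinearEquiv.finrank_map_eq]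

lemma Isometric.radAlt {B₁ : BilinForm F V₁} {B₂ : BilinForm F V₂}
    (h : Isometric B₁ B₂) (ha : RadAlt B₁) : RadAlt B₂ := by
  obtain ⟨f, hf⟩ := h
  intro r hr
  rw [← symRad_map f hf] at hr
  obtain ⟨x, hx, rfl⟩ := hr
  exact (hf x x).trans (ha x hx)

end Invariance

variable (F : Type*) [Field F]

/-- Isometry of nondegenerate bilinear forms on coordinate spaces. -/
def formSetoid : Setoid (Σ d : ℕ, {B : BilinForm F (Fin d → F) // B.Nondegenerate}) where
  r X Y := Isometric X.2.1 Y.2.1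
  iseqv := ⟨fun _ => Isometric.refl _, Isometric.symm, Isometric.trans⟩

/-- Isometry classes of nondegenerate bilinear forms. -/
def FormClass := Quotient (formSetoid F)

variable {F}

namespace FormClass

/-- The dimension of a class of forms. -/
def dim : FormClass F → ℕ := Quotient.lift (s := formSetoid F) (fun X => X.1) fun X Y h => by
  simpa using Isometric.finrank_eq h

/-- The dimension of the symmetric radical of a class of forms. -/
noncomputable def rad : FormClass F → ℕ :=
  Quotient.lift (s := formSetoid F) (fun X => finrank F (symRad X.2.1)) fun _ _ h =>
    Isometric.finrank_symRad h

/-- The property `RadAlt` for a class of forms. -/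
def Alt : FormClass F → Prop :=
  Quotient.lift (s := formSetoid F) (fun X => RadAlt X.2.1) fun _ _ h =>
    propext ⟨Isometric.radAlt h, Isometric.radAlt (Isometric.symm h)⟩

variable {V V₁ V₂ V₃ : Type*} [AddCommGroup V] [Module F V] [FiniteDimensional F V]
  [AddCommGroup V₁] [Module F V₁] [FiniteDimensional F V₁]
  [AddCommGroup V₂] [Module F V₂] [FiniteDimensional F V₂]
  [AddCommGroup V₃] [Module F V₃] [FiniteDimensional F V₃]

omit [FiniteDimensional F V₁] [FiniteDimensional F V₂] in
lemma _root_.isometric_congr (e : V₁ ≃ₗ[F] V₂) (B : BilinForm F V₁) :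
    Isometric B (LinearMap.BilinForm.congr e B) := ⟨e, fun u v => by simp⟩

/-- The class of a nondegenerate form. -/
noncomputable def mk (B : BilinForm F V) (hB : B.Nondegenerate) : FormClass F :=
  Quotient.mk (formSetoid F) ⟨finrank F V, LinearMap.BilinForm.congr (finBasis F V).equivFun B,
    (isometric_congr (finBasis F V).equivFun B).nondegenerate hB⟩

lemma mk_eq_mk {B₁ : BilinForm F V₁} {h₁ : B₁.Nondegenerate} {B₂ : BilinForm F V₂}
    {h₂ : B₂.Nondegenerate} : mk B₁ h₁ = mk B₂ h₂ ↔ Isometric B₁ B₂ := by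
  have e₁ := isometric_congr (finBasis F V₁).equivFun B₁
  have e₂ := isometric_congr (finBasis F V₂).equivFun B₂
  refine ⟨fun h => ?_, fun h => Quotient.sound (s := formSetoid F) (e₁.symm.trans (h.trans e₂))⟩
  have : Isometric _ _ := Quotient.exact h
  exact e₁.trans (this.trans e₂.symm)

lemma exists_rep (c : FormClass F) :
    ∃ (d : ℕ) (B : BilinForm F (Fin d → F)) (hB : B.Nondegenerate), mk B hB = c := by
  obtain ⟨⟨d, B, hB⟩, rfl⟩ := Quotient.exists_rep c
  refine ⟨d, B, hB, Quotient.sound (s := formSetoid F) ?_⟩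
  exact (isometric_congr (finBasis F _).equivFun B).symm

@[simp]
lemma dim_mk {B : BilinForm F V} {hB : B.Nondegenerate} : (mk B hB).dim = finrank F V := rfl

@[simp]
lemma rad_mk {B : BilinForm F V} {hB : B.Nondegenerate} :
    (mk B hB).rad = finrank F (symRad B) :=
  (isometric_congr (finBasis F V).equivFun B).symm.finrank_symRad

@[simp]
lemma alt_mk {B : BilinForm F V} {hB : B.Nondegenerate} : (mk B hB).Alt ↔ RadAlt B :=
  have h := isometric_congr (finBasis F V).equivFun B
  ⟨fun h' => h.symm.radAlt h', fun h' => h.radAlt h'⟩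

lemma finite_dim_le [Finite F] (D : ℕ) : {c : FormClass F | c.dim ≤ D}.Finite := by
  have : ∀ d, Finite {B : BilinForm F (Fin d → F) // B.Nondegenerate} := fun d =>
    have : Finite (BilinForm F (Fin d → F)) := Module.finite_of_finite F
    inferInstance
  let g : (Σ d : Fin (D + 1), {B : BilinForm F (Fin d → F) // B.Nondegenerate}) → FormClass F :=
    fun X => mk X.2.1 X.2.2
  refine (Set.finite_range g).subset fun c hc => ?_
  obtain ⟨d, B, hB, rfl⟩ := exists_rep c
  have hd : d ≤ D := by simpa using hc
  exact ⟨⟨⟨d, Nat.lt_succ_of_le hd⟩, B, hB⟩, rfl⟩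

/-- The class `c` has a presentation with symmetric part of dimension `s`, core `c'`, and
`i` measuring the excess of the dimension of the isotropic part. -/
def HasType (c : FormClass F) (s i : ℕ) (c' : FormClass F) : Prop :=
  ∃ (d : ℕ) (X : BilinForm F (Fin d → F)) (hX : X.Nondegenerate) (R U : Submodule F (Fin d → F))
    (K : Submodule F U) (h : IsDecomp X R U K), mk X hX = c ∧
    mk (V := K) ((X.restrict U).restrict K) h.nondegenerate_right = c' ∧ finrank F R = s ∧
    finrank F U = c'.dim + (c'.rad + 2 * i)

lemma exists_hasType (c : FormClass F) : ∃ s i c', HasType c s i c' := by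
  obtain ⟨d, X, hX, rfl⟩ := exists_rep c
  obtain ⟨R, U, K, h⟩ := exists_isDecomp hX
  have hA : (X.restrict U - (X.restrict U).flip).Nondegenerate :=
    LinearMap.BilinForm.nondegenerate_of_left fun u hu => h.skew u fun v => sub_eq_zero.1 (hu v)
  have h1 := even_finrank_of_isAlt hA fun u => sub_self (X.restrict U u u)
  have h2 := even_finrank_sub_finrank_symRad (V := K) ((X.restrict U).restrict K)
  have h3 := LinearMap.BilinForm.finrank_orthogonal hA K
  have h4 : (symRad (V := K) ((X.restrict U).restrict K)).map K.subtype ≤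
      (X.restrict U - (X.restrict U).flip).orthogonal K := by
    rintro _ ⟨k, hk, rfl⟩ l hl
    exact sub_eq_zero.2 ((mem_symRad.1 hk ⟨l, hl⟩).symm)
  have h5 := Submodule.finrank_mono h4
  rw [Submodule.finrank_map_subtype_eq] at h5
  have h6 := Submodule.finrank_le K
  have h7 := Submodule.finrank_le (symRad (V := K) ((X.restrict U).restrict K))
  obtain ⟨a, ha⟩ := h1
  obtain ⟨b, hb⟩ := h2
  refine ⟨finrank F R, (finrank F U - finrank F K -
    finrank F (symRad (V := K) ((X.restrict U).restrict K))) / 2, _, d, X, hX, R, U, K, h, rfl, rfl, rfl, ?_⟩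
  rw [dim_mk, rad_mk]
  omega

lemma HasType.dim_eq {c c' : FormClass F} {s i : ℕ} (h : HasType c s i c') :
    c.dim = s + 2 * (c'.rad + 2 * i) + c'.dim := by
  obtain ⟨d, X, hX, R, U, K, hd, rfl, rfl, rfl, h⟩ := h
  have h1 := hd.finrank_eq
  rw [dim_mk] at h
  rw [dim_mk, dim_mk]
  omega

lemma HasType.rad_eq {c c' : FormClass F} {s i : ℕ} (h : HasType c s i c') :
    c.rad = s + (c'.rad + 2 * i) := by
  obtain ⟨d, X, hX, R, U, K, hd, rfl, rfl, rfl, h⟩ := h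
  have h1 := hd.finrank_symRad
  rw [dim_mk] at h
  rw [rad_mk, h1]
  omega

lemma HasType.even_of_alt {c c' : FormClass F} {s i : ℕ} (h : HasType c s i c') (ha : c.Alt) :
    Even s := by
  obtain ⟨d, X, hX, R, U, K, hd, rfl, rfl, rfl, h⟩ := h
  exact even_finrank_of_isAlt hd.nondegenerate_left (hd.radAlt_iff.1 (alt_mk.1 ha))

lemma HasType.pos_of_not_alt {c c' : FormClass F} {s i : ℕ} (h : HasType c s i c')
    (ha : ¬ c.Alt) : 0 < s := by
  obtain ⟨d, X, hX, R, U, K, hd, rfl, rfl, rfl, h⟩ := h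
  refine Nat.pos_of_ne_zero fun h0 => ha (alt_mk.2 (hd.radAlt_iff.2 fun x => ?_))
  have := Module.finrank_zero_iff.1 h0
  rw [Subsingleton.elim x 0]
  simp

variable [Finite F] [CharP F 2]

/-- Forms of the same type with nonalternating radical coincide. -/
lemma HasType.eq_of_not_alt {c₁ c₂ c' : FormClass F} {s i : ℕ} (h₁ : HasType c₁ s i c')
    (h₂ : HasType c₂ s i c') (a₁ : ¬ c₁.Alt) (a₂ : ¬ c₂.Alt) : c₁ = c₂ := by
  obtain ⟨d₁, X₁, hX₁, R₁, U₁, K₁, D₁, rfl, rfl, rfl, t₁⟩ := h₁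
  obtain ⟨d₂, X₂, hX₂, R₂, U₂, K₂, D₂, rfl, e, e', t₂⟩ := h₂
  rw [alt_mk, D₁.radAlt_iff] at a₁
  rw [alt_mk, D₂.radAlt_iff] at a₂
  obtain ⟨f, w, hf⟩ := exists_isLink D₁.skew D₂.skew (t₁.trans t₂.symm) (mk_eq_mk.1 e.symm)
  obtain ⟨h, hh⟩ := isometric_of_isSymm D₁.nondegenerate_left D₂.nondegenerate_left ⟨D₁.symm⟩
    ⟨D₂.symm⟩ a₁ a₂ e'.symm
  obtain ⟨x, hx⟩ := exists_apply_self_eq_one a₂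
  refine mk_eq_mk.2 (D₁.isometric.trans (Isometric.trans ?_ D₂.isometric.symm))
  let l : U₁ →ₗ[F] F := (X₁.restrict U₁).flip w - X₁.restrict U₁ w
  have hl : ∀ v, l v = X₁.restrict U₁ v w - X₁.restrict U₁ w v := fun v => rfl
  refine modForm_isometric f hf.map h hh D₂.symm (l.smulRight x) (fun k hk => ?_) hf.form
    fun v => ?_
  · rw [LinearMap.smulRight_apply, hl, hf.orth k hk, zero_smul]
  · rw [hf.quad v, LinearMap.smulRight_apply, LinearMap.BilinForm.smul_left,
      LinearMap.BilinForm.smul_right, hx, hl, mul_one, sq]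

omit [Finite F] in
lemma _root_.IsDecomp.isometric_of_isLink {X₁ : BilinForm F V₁} {X₂ : BilinForm F V₂}
    {R₁ U₁ : Submodule F V₁} {K₁ : Submodule F U₁} {R₂ U₂ : Submodule F V₂} {K₂ : Submodule F U₂}
    (D₁ : IsDecomp X₁ R₁ U₁ K₁) (D₂ : IsDecomp X₂ R₂ U₂ K₂) (a₁ : RadAlt X₁) (a₂ : RadAlt X₂)
    (hR : finrank F R₁ = finrank F R₂) {f w}
    (hf : IsLink (X₁.restrict U₁) (X₂.restrict U₂) K₁ K₂ f w)
    (hw : X₁.restrict U₁ w w ∈ (artinSchreier F).range) : Isometric X₁ X₂ := by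
  obtain ⟨h, hh⟩ := isometric_of_isAlt D₁.nondegenerate_left D₂.nondegenerate_left
    (D₁.radAlt_iff.1 a₁) (D₂.radAlt_iff.1 a₂) hR
  obtain ⟨g, hg, hg', hg''⟩ := hf.exists_equiv hw
  refine D₁.isometric.trans (Isometric.trans ?_ D₂.isometric.symm)
  refine modForm_isometric g hg h hh D₂.symm 0 (fun k hk => rfl) hg' fun v => ?_
  rw [hg'']
  simp

/-- There are at most two forms of a given type with alternating radical. -/
lemma HasType.eq_or_eq_of_alt {c₁ c₂ c₃ c' : FormClass F} {s i : ℕ} (h₁ : HasType c₁ s i c')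
    (h₂ : HasType c₂ s i c') (h₃ : HasType c₃ s i c') (a₁ : c₁.Alt) (a₂ : c₂.Alt) (a₃ : c₃.Alt) :
    c₁ = c₂ ∨ c₁ = c₃ ∨ c₂ = c₃ := by
  obtain ⟨d₁, X₁, hX₁, R₁, U₁, K₁, D₁, rfl, rfl, rfl, t₁⟩ := h₁
  obtain ⟨d₂, X₂, hX₂, R₂, U₂, K₂, D₂, rfl, e₂, e₂', t₂⟩ := h₂
  obtain ⟨d₃, X₃, hX₃, R₃, U₃, K₃, D₃, rfl, e₃, e₃', t₃⟩ := h₃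
  rw [alt_mk] at a₁ a₂ a₃
  obtain ⟨f, w, hf⟩ := exists_isLink D₁.skew D₂.skew (t₁.trans t₂.symm) (mk_eq_mk.1 e₂.symm)
  obtain ⟨g, z, hg⟩ := exists_isLink D₁.skew D₃.skew (t₁.trans t₃.symm) (mk_eq_mk.1 e₃.symm)
  simp only [mk_eq_mk]
  by_cases hw : X₁.restrict U₁ w w ∈ (artinSchreier F).range
  · exact Or.inl (D₁.isometric_of_isLink D₂ a₁ a₂ e₂'.symm hf hw)
  by_cases hz : X₁.restrict U₁ z z ∈ (artinSchreier F).range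
  · exact Or.inr (Or.inl (D₁.isometric_of_isLink D₃ a₁ a₃ e₃'.symm hg hz))
  obtain ⟨hfg, hq⟩ := hf.comp hg
  refine Or.inr (Or.inr (D₂.isometric_of_isLink D₃ a₂ a₃ (e₂'.trans e₃'.symm) hfg ?_))
  rw [hq]
  exact add_mem (add_mem_range_artinSchreier hw hz) ⟨_, rfl⟩

/-- There is at most one form of a given type with alternating radical, core with alternating
radical, and no excess. -/
lemma HasType.eq_of_alt {c₁ c₂ c' : FormClass F} {s : ℕ} (h₁ : HasType c₁ s 0 c')
    (h₂ : HasType c₂ s 0 c') (a₁ : c₁.Alt) (a₂ : c₂.Alt) (a' : c'.Alt) : c₁ = c₂ := by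
  obtain ⟨d₁, X₁, hX₁, R₁, U₁, K₁, D₁, rfl, rfl, rfl, t₁⟩ := h₁
  obtain ⟨d₂, X₂, hX₂, R₂, U₂, K₂, D₂, rfl, e₂, e₂', t₂⟩ := h₂
  rw [alt_mk] at a₁ a₂ a'
  obtain ⟨f, w, hf⟩ := exists_isLink D₁.skew D₂.skew (t₁.trans t₂.symm) (mk_eq_mk.1 e₂.symm)
  refine mk_eq_mk.2 (D₁.isometric_of_isLink D₂ a₁ a₂ e₂'.symm hf ?_)
  have hA : (X₁.restrict U₁ - (X₁.restrict U₁).flip).Nondegenerate :=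
    LinearMap.BilinForm.nondegenerate_of_left fun u hu => D₁.skew u fun v => sub_eq_zero.1 (hu v)
  have h3 := LinearMap.BilinForm.finrank_orthogonal hA K₁
  have h4 : (symRad (V := K₁) ((X₁.restrict U₁).restrict K₁)).map K₁.subtype ≤
      (X₁.restrict U₁ - (X₁.restrict U₁).flip).orthogonal K₁ := by
    rintro _ ⟨k, hk, rfl⟩ l hl
    exact sub_eq_zero.2 ((mem_symRad.1 hk ⟨l, hl⟩).symm)
  have h5 := Submodule.eq_of_le_of_finrank_le h4 (by
    rw [Submodule.finrank_map_subtype_eq, h3, t₁, dim_mk, rad_mk]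
    omega)
  have h6 : w ∈ (X₁.restrict U₁ - (X₁.restrict U₁).flip).orthogonal K₁ := hf.orth
  rw [← h5] at h6
  obtain ⟨k, hk, rfl⟩ := h6
  have : X₁.restrict U₁ k k = 0 := a' k hk
  refine ⟨0, ?_⟩
  change (0 : F) ^ 2 + 0 = X₁.restrict U₁ k k
  rw [this]
  simp

end FormClass

end FormClass

section Counting

open Finset

lemma Finset.card_le_sum_of_exists_rel {α β : Type*} {S : Finset α} {T : Finset β}
    {R : α → β → Prop} {m : β → ℕ} (hS : ∀ a ∈ S, ∃ b ∈ T, R a b)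
    (hm : ∀ b ∈ T, ∀ U ⊆ S, (∀ a ∈ U, R a b) → #U ≤ m b) : #S ≤ ∑ b ∈ T, m b := by
  classical
  calc #S ≤ #(T.biUnion fun b => S.filter fun a => R a b) := card_le_card fun a ha => by
        obtain ⟨b, hb, h⟩ := hS a ha
        exact mem_biUnion.2 ⟨b, hb, mem_filter.2 ⟨ha, h⟩⟩
    _ ≤ _ := card_biUnion_le.trans (sum_le_sum fun b hb =>
        hm b hb _ (filter_subset _ _) fun a ha => (mem_filter.1 ha).2)

lemma sum_range_pow_le {x : ℝ} (h0 : 0 ≤ x) (h1 : x < 1) (N : ℕ) :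
    ∑ i ∈ range N, x ^ i ≤ (1 - x)⁻¹ := by
  rw [← tsum_geometric_of_lt_one h0 h1]
  exact (summable_geometric_of_lt_one h0 h1).sum_le_tsum _ fun i _ => pow_nonneg h0 i

namespace FormClass

variable {F : Type*} [Field F] [Finite F]

open Classical in
/-- The classes of forms with a given property of bounded weight. -/
noncomputable def ofWeight (P : FormClass F → Prop) (j M : ℕ) : Finset (FormClass F) :=
  (finite_dim_le (2 * M)).toFinset.filter fun c => P c ∧ c.dim + (2 * j + 1) * c.rad ≤ 2 * M

lemma mem_ofWeight {P : FormClass F → Prop} {j M : ℕ} {c : FormClass F} :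
    c ∈ ofWeight P j M ↔ P c ∧ c.dim + (2 * j + 1) * c.rad ≤ 2 * M := by
  simp only [ofWeight, mem_filter, Set.Finite.mem_toFinset, Set.mem_ofPred_eq]
  exact ⟨fun h => h.2, fun h => ⟨(Nat.le_add_right _ _).trans h.2, h⟩⟩

omit [Finite F] in
lemma HasType.weight_eq {c c' : FormClass F} {s i : ℕ} (h : HasType c s i c') (j : ℕ) :
    c.dim + (2 * j + 1) * c.rad =
      c'.dim + (2 * (j + 1) + 1) * c'.rad + 2 * (s * (j + 1) + i * (2 * j + 3)) := by
  rw [h.dim_eq, h.rad_eq]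
  ring

/-- The indices of the types of weight at most `M`. -/
def typeIndex (a b M : ℕ) : Finset (ℕ × ℕ) :=
  (range (M + 1) ×ˢ range (M + 1)).filter fun p => p.1 * a + p.2 * b ≤ M

omit [Finite F] in
lemma HasType.mem_typeIndex {c c' : FormClass F} {s i j M k u : ℕ} (h : HasType c (s * k + u) i c')
    (hM : c.dim + (2 * j + 1) * c.rad ≤ 2 * M) (hk : 0 < k) :
    (s, i) ∈ typeIndex (k * (j + 1)) (2 * j + 3) M := by
  have h1 := h.weight_eq j
  have h2 : s * (k * (j + 1)) + i * (2 * j + 3) ≤ M := by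
    have : (s * k + u) * (j + 1) = s * (k * (j + 1)) + u * (j + 1) := by ring
    omega
  have h3 : s ≤ s * (k * (j + 1)) := Nat.le_mul_of_pos_right _ (by positivity)
  have h4 : i ≤ i * (2 * j + 3) := Nat.le_mul_of_pos_right _ (by positivity)
  simp only [typeIndex, mem_filter, mem_product, mem_range]
  omega

lemma HasType.mem_ofWeight {c c' : FormClass F} {s i j M w : ℕ} (h : HasType c s i c')
    (hM : c.dim + (2 * j + 1) * c.rad ≤ 2 * M) (hw : s * (j + 1) + i * (2 * j + 3) = w)
    {P : FormClass F → Prop} (hP : P c') :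
    c' ∈ ofWeight P (j + 1) (M - w) := by
  have h1 := h.weight_eq j
  refine FormClass.mem_ofWeight.2 ⟨hP, ?_⟩
  omega

variable [CharP F 2]

lemma card_ofWeight_alt_le (j M : ℕ) :
    #(ofWeight (F := F) Alt j M) ≤ ∑ p ∈ typeIndex (2 * (j + 1)) (2 * j + 3) M,
      ((if p.2 = 0 then 1 else 2) *
        #(ofWeight (F := F) Alt (j + 1) (M - (p.1 * (2 * (j + 1)) + p.2 * (2 * j + 3)))) +
      2 * #(ofWeight (F := F) (fun c => ¬ c.Alt) (j + 1)
        (M - (p.1 * (2 * (j + 1)) + p.2 * (2 * j + 3))))) := by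
  classical
  refine card_le_sum_of_exists_rel (R := fun c p => ∃ c', HasType c (p.1 * 2) p.2 c')
    (fun c hc => ?_) fun p hp U hU hU' => ?_
  · rw [mem_ofWeight] at hc
    obtain ⟨s, i, c', h⟩ := exists_hasType c
    obtain ⟨s, rfl⟩ := (h.even_of_alt hc.1).two_dvd
    rw [mul_comm] at h
    exact ⟨(s, i), HasType.mem_typeIndex (u := 0) h hc.2 two_pos, c', h⟩
  obtain ⟨s, i⟩ := p
  have hU : ∀ c ∈ U, c.Alt ∧ c.dim + (2 * j + 1) * c.rad ≤ 2 * M := fun c hc =>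
    mem_ofWeight.1 (hU hc)
  have key : ∀ U' ⊆ U, ∀ c', (∀ c ∈ U', HasType c (s * 2) i c') → #U' ≤ 2 := by
    intro U' hU' c' h
    by_contra! hlt
    obtain ⟨c₁, h₁, c₂, h₂, c₃, h₃, n₁, n₂, n₃⟩ := Finset.two_lt_card.1 hlt
    have := (h c₁ h₁).eq_or_eq_of_alt (h c₂ h₂) (h c₃ h₃) (hU _ (hU' h₁)).1 (hU _ (hU' h₂)).1
      (hU _ (hU' h₃)).1
    tauto
  rw [← card_filter_add_card_filter_not (s := U)
    fun c => ∃ c', HasType c (s * 2) i c' ∧ c'.Alt]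
  refine Nat.add_le_add ?_ ?_
  · rw [mul_comm (ite _ _ _), ← smul_eq_mul (#_), ← sum_const]
    refine card_le_sum_of_exists_rel (R := fun c c' => HasType c (s * 2) i c')
      (fun c hc => ?_) fun c' hc' U' hU' h => ?_
    · obtain ⟨hc, c', h, ha⟩ := mem_filter.1 hc
      exact ⟨c', h.mem_ofWeight (hU c hc).2 (by ring) ha, h⟩
    · have hU'' : U' ⊆ U := hU'.trans (filter_subset _ _)
      split_ifs with hi
      · dsimp only at hi
        subst hi
        exact card_le_one.2 fun c₁ h₁ c₂ h₂ => (h c₁ h₁).eq_of_alt (h c₂ h₂) (hU _ (hU'' h₁)).1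
          (hU _ (hU'' h₂)).1 (mem_ofWeight.1 hc').1
      · exact key U' hU'' c' h
  · rw [mul_comm 2 (#_), ← smul_eq_mul (#_), ← sum_const]
    refine card_le_sum_of_exists_rel (R := fun c c' => HasType c (s * 2) i c')
      (fun c hc => ?_) fun c' hc' U' hU' h => key U' (hU'.trans (filter_subset _ _)) c' h
    obtain ⟨hc, hn⟩ := mem_filter.1 hc
    obtain ⟨c', h⟩ := hU' c hc
    exact ⟨c', h.mem_ofWeight (hU c hc).2 (by ring) fun ha => hn ⟨c', h, ha⟩, h⟩

lemma card_ofWeight_not_alt_le (j M : ℕ) :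
    #(ofWeight (F := F) (fun c => ¬ c.Alt) j M) ≤
      ∑ p ∈ (typeIndex (j + 1) (2 * j + 3) M).filter fun p => 0 < p.1,
      (#(ofWeight (F := F) Alt (j + 1) (M - (p.1 * (j + 1) + p.2 * (2 * j + 3)))) +
      #(ofWeight (F := F) (fun c => ¬ c.Alt) (j + 1)
        (M - (p.1 * (j + 1) + p.2 * (2 * j + 3))))) := by
  classical
  refine card_le_sum_of_exists_rel (R := fun c p => ∃ c', HasType c p.1 p.2 c')
    (fun c hc => ?_) fun p hp U hU hU' => ?_
  · rw [mem_ofWeight] at hc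
    obtain ⟨s, i, c', h⟩ := exists_hasType c
    have := HasType.mem_typeIndex (u := 0) (k := 1) (s := s) (by simpa using h) hc.2 one_pos
    rw [one_mul] at this
    exact ⟨(s, i), mem_filter.2 ⟨this, h.pos_of_not_alt hc.1⟩, c', h⟩
  obtain ⟨s, i⟩ := p
  have hU : ∀ c ∈ U, ¬ c.Alt ∧ c.dim + (2 * j + 1) * c.rad ≤ 2 * M := fun c hc =>
    mem_ofWeight.1 (hU hc)
  have key : ∀ U' ⊆ U, ∀ c', (∀ c ∈ U', HasType c s i c') → #U' ≤ 1 := fun U' hU' c' h =>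
    card_le_one.2 fun c₁ h₁ c₂ h₂ => (h c₁ h₁).eq_of_not_alt (h c₂ h₂) (hU _ (hU' h₁)).1
      (hU _ (hU' h₂)).1
  rw [← card_filter_add_card_filter_not (s := U) fun c => ∃ c', HasType c s i c' ∧ c'.Alt]
  refine Nat.add_le_add ?_ ?_
  · rw [card_eq_sum_ones (ofWeight _ _ _)]
    refine card_le_sum_of_exists_rel (R := fun c c' => HasType c s i c')
      (fun c hc => ?_) fun c' hc' U' hU' h => key U' (hU'.trans (filter_subset _ _)) c' h
    obtain ⟨hc, c', h, ha⟩ := mem_filter.1 hc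
    exact ⟨c', h.mem_ofWeight (hU c hc).2 rfl ha, h⟩
  · rw [card_eq_sum_ones (ofWeight _ _ _)]
    refine card_le_sum_of_exists_rel (R := fun c c' => HasType c s i c')
      (fun c hc => ?_) fun c' hc' U' hU' h => key U' (hU'.trans (filter_subset _ _)) c' h
    obtain ⟨hc, hn⟩ := mem_filter.1 hc
    obtain ⟨c', h⟩ := hU' c hc
    exact ⟨c', h.mem_ofWeight (hU c hc).2 rfl fun ha => hn ⟨c', h, ha⟩, h⟩

/-- A bound on the number of classes of bounded weight, by descent on the weight parameter. -/
theorem card_ofWeight_le {t C : ℝ} (h0 : 0 < t) (h1 : t < 1) (hC : 0 ≤ C) {n : ℕ}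
    (hA : ∀ M ≤ n, (#(ofWeight (F := F) Alt n M) : ℝ) ≤ C * majA t n * (t⁻¹) ^ M)
    (hN : ∀ M ≤ n, (#(ofWeight (F := F) (fun c => ¬ c.Alt) n M) : ℝ) ≤
      C * majN t n * (t⁻¹) ^ M) :
    ∀ k j, j + k = n → ∀ M ≤ n,
      (#(ofWeight (F := F) Alt j M) : ℝ) ≤ C * majA t j * (t⁻¹) ^ M ∧
      (#(ofWeight (F := F) (fun c => ¬ c.Alt) j M) : ℝ) ≤ C * majN t j * (t⁻¹) ^ M := by
  intro k
  induction k with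
  | zero =>
    rintro j rfl M hM
    exact ⟨hA M hM, hN M hM⟩
  | succ k ih =>
    intro j hj M hM
    have IH := ih (j + 1) (by omega)
    have hα := majA_nonneg h0 h1 (j + 1)
    have hν := majN_nonneg h0 h1 (j + 1)
    have hy0 : 0 < t ^ (2 * j + 3) := by positivity
    have hy1 : 0 < 1 - t ^ (2 * j + 3) := one_sub_pow_pos h0 h1 _
    have hx1 : 0 < 1 - t ^ (2 * j + 2) := one_sub_pow_pos h0 h1 _
    have hz1 : 0 < 1 - t ^ (j + 1) := one_sub_pow_pos h0 h1 _
    have hpow : ∀ w ≤ M, (t⁻¹) ^ (M - w) = (t⁻¹) ^ M * t ^ w := fun w hw => by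
      rw [pow_sub₀ _ (inv_ne_zero h0.ne') hw, inv_pow t w, inv_inv]
    have hsy : ∑ i ∈ range (M + 1), (t ^ (2 * j + 3)) ^ i ≤ (1 - t ^ (2 * j + 3))⁻¹ :=
      sum_range_pow_le hy0.le (by linarith) _
    constructor
    · calc (#(ofWeight (F := F) Alt j M) : ℝ)
          ≤ ∑ p ∈ typeIndex (2 * (j + 1)) (2 * j + 3) M,
            C * (t⁻¹) ^ M * ((t ^ (2 * j + 2)) ^ p.1 * (((if p.2 = 0 then 1 else 2) *
              majA t (j + 1) + 2 * majN t (j + 1)) * (t ^ (2 * j + 3)) ^ p.2)) := by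
            refine (Nat.cast_le.2 (card_ofWeight_alt_le j M)).trans ?_
            push_cast
            refine sum_le_sum fun p hp => ?_
            have hw := (mem_filter.1 hp).2
            have e := IH (M - (p.1 * (2 * (j + 1)) + p.2 * (2 * j + 3))) (by omega)
            rw [hpow _ hw] at e
            have e1 : t ^ (p.1 * (2 * (j + 1)) + p.2 * (2 * j + 3)) =
                (t ^ (2 * j + 2)) ^ p.1 * (t ^ (2 * j + 3)) ^ p.2 := by
              rw [← pow_mul, ← pow_mul, ← pow_add]
              congr 1
              ring
            rw [e1] at e
            have e2 : (0 : ℝ) ≤ if p.2 = 0 then 1 else 2 := by split_ifs <;> norm_num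
            refine (add_le_add (mul_le_mul_of_nonneg_left e.1 e2)
              (mul_le_mul_of_nonneg_left e.2 zero_le_two)).trans_eq ?_
            ring
        _ ≤ ∑ p ∈ range (M + 1) ×ˢ range (M + 1),
            C * (t⁻¹) ^ M * ((t ^ (2 * j + 2)) ^ p.1 * (((if p.2 = 0 then 1 else 2) *
              majA t (j + 1) + 2 * majN t (j + 1)) * (t ^ (2 * j + 3)) ^ p.2)) :=
            sum_le_sum_of_subset_of_nonneg (filter_subset _ _) fun p _ _ => by
              have e2 : (0 : ℝ) ≤ if p.2 = 0 then 1 else 2 := by split_ifs <;> norm_num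
              positivity
        _ = C * (t⁻¹) ^ M * ((∑ s ∈ range (M + 1), (t ^ (2 * j + 2)) ^ s) *
              ∑ i ∈ range (M + 1), ((if i = 0 then 1 else 2) *
              majA t (j + 1) + 2 * majN t (j + 1)) * (t ^ (2 * j + 3)) ^ i) := by
            rw [← mul_sum, sum_mul_sum, sum_product]
        _ ≤ C * (t⁻¹) ^ M * ((1 - t ^ (2 * j + 2))⁻¹ *
              ((majA t (j + 1) * (1 + t ^ (2 * j + 3)) + 2 * majN t (j + 1)) *
                (1 - t ^ (2 * j + 3))⁻¹)) := by
            have e : ∑ i ∈ range (M + 1), (((if i = 0 then 1 else 2) *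
                majA t (j + 1) + 2 * majN t (j + 1)) * (t ^ (2 * j + 3)) ^ i) =
                2 * (majA t (j + 1) + majN t (j + 1)) *
                  ∑ i ∈ range (M + 1), (t ^ (2 * j + 3)) ^ i - majA t (j + 1) := by
              rw [sum_range_succ', sum_range_succ' (fun i => (t ^ (2 * j + 3)) ^ i), mul_add, mul_sum]
              simp only [Nat.add_eq_zero_iff, one_ne_zero, and_false, if_false, if_true, pow_zero]
              rw [sum_congr rfl fun i _ => by rw [← mul_add]]
              ring
            have e' : (majA t (j + 1) * (1 + t ^ (2 * j + 3)) + 2 * majN t (j + 1)) *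
                (1 - t ^ (2 * j + 3))⁻¹ = 2 * (majA t (j + 1) + majN t (j + 1)) *
                (1 - t ^ (2 * j + 3))⁻¹ - majA t (j + 1) := by
              field_simp
              ring
            have e3 := sum_range_pow_le (pow_nonneg h0.le (2 * j + 2)) (by linarith) (M + 1)
            refine mul_le_mul_of_nonneg_left (mul_le_mul e3 ?_ (sum_nonneg fun i _ => ?_)
              (inv_nonneg.2 hx1.le)) (by positivity)
            · rw [e, e']
              gcongr
            · have e2 : (0 : ℝ) ≤ if i = 0 then 1 else 2 := by split_ifs <;> norm_num
              positivity
        _ = C * majA t j * (t⁻¹) ^ M := by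
            rw [← majA_rec h0 h1 j]
            field_simp
    · calc (#(ofWeight (F := F) (fun c => ¬ c.Alt) j M) : ℝ)
          ≤ ∑ p ∈ (typeIndex (j + 1) (2 * j + 3) M).filter fun p => 0 < p.1,
            C * (t⁻¹) ^ M * ((t ^ (j + 1)) ^ p.1 * ((majA t (j + 1) + majN t (j + 1)) *
              (t ^ (2 * j + 3)) ^ p.2)) := by
            refine (Nat.cast_le.2 (card_ofWeight_not_alt_le j M)).trans ?_
            push_cast
            refine sum_le_sum fun p hp => ?_
            have hw := (mem_filter.1 (mem_filter.1 hp).1).2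
            have e := IH (M - (p.1 * (j + 1) + p.2 * (2 * j + 3))) (by omega)
            rw [hpow _ hw] at e
            have e1 : t ^ (p.1 * (j + 1) + p.2 * (2 * j + 3)) =
                (t ^ (j + 1)) ^ p.1 * (t ^ (2 * j + 3)) ^ p.2 := by
              rw [← pow_mul, ← pow_mul, ← pow_add]
              congr 1
              ring
            rw [e1] at e
            refine (add_le_add e.1 e.2).trans_eq ?_
            ring
        _ ≤ ∑ p ∈ (range (M + 1)).filter (0 < ·) ×ˢ range (M + 1),
            C * (t⁻¹) ^ M * ((t ^ (j + 1)) ^ p.1 * ((majA t (j + 1) + majN t (j + 1)) *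
              (t ^ (2 * j + 3)) ^ p.2)) := by
            refine sum_le_sum_of_subset_of_nonneg (fun p hp => ?_) fun p _ _ => by positivity
            simp only [typeIndex, mem_filter, mem_product] at hp ⊢
            tauto
        _ = C * (t⁻¹) ^ M * ((∑ s ∈ (range (M + 1)).filter (0 < ·), (t ^ (j + 1)) ^ s) *
              ((majA t (j + 1) + majN t (j + 1)) *
                ∑ i ∈ range (M + 1), (t ^ (2 * j + 3)) ^ i)) := by
            rw [← mul_sum, mul_sum _ _ (majA t (j + 1) + _), sum_mul_sum, sum_product]
        _ ≤ C * (t⁻¹) ^ M * ((t ^ (j + 1) * (1 - t ^ (j + 1))⁻¹) *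
              ((majA t (j + 1) + majN t (j + 1)) * (1 - t ^ (2 * j + 3))⁻¹)) := by
            have e : ∑ s ∈ (range (M + 1)).filter (0 < ·), (t ^ (j + 1)) ^ s ≤
                t ^ (j + 1) * (1 - t ^ (j + 1))⁻¹ := by
              have e4 : (range (M + 1)).filter (0 < ·) = (range M).map ⟨(· + 1), add_left_injective 1⟩ := by
                ext s
                simp only [mem_filter, mem_range, mem_map, Function.Embedding.coeFn_mk]
                exact ⟨fun h => ⟨s - 1, by omega, by omega⟩, fun ⟨a, h, h'⟩ => by omega⟩
              rw [e4, sum_map]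
              simp only [Function.Embedding.coeFn_mk, pow_succ' (t ^ (j + 1))]
              rw [← mul_sum]
              have := sum_range_pow_le (pow_nonneg h0.le (j + 1)) (by linarith) M
              gcongr
            gcongr
        _ = C * majN t j * (t⁻¹) ^ M := by
            have e := majN_rec h0 h1 j
            have e5 : 1 - t ^ (2 * j + 2) = (1 - t ^ (j + 1)) * (1 + t ^ (j + 1)) := by ring
            have e6 : 0 < 1 + t ^ (j + 1) := by positivity
            have e7 : t ^ (j + 1) * (majA t (j + 1) + majN t (j + 1)) =
                majN t j * ((1 - t ^ (j + 1)) * (1 - t ^ (2 * j + 3))) := by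
              refine mul_left_cancel₀ e6.ne' ?_
              rw [e5] at e
              linear_combination -e
            rw [show ∀ a b c d e f : ℝ, a * b * (c * d * (e * f)) = a * b * (c * e) * (d * f) by
              intros; ring, e7]
            field_simp

end FormClass

end Counting

section TwistedForm

open Module

open LinearMap (BilinForm)

lemma exists_sq_sub_isNilpotent {O : Type*} [CommRing O] [Finite O] [CharP O 2] (u : Oˣ) :
    ∃ a : Oˣ, IsNilpotent ((a : O) ^ 2 - u) := by
  obtain ⟨e, m, hm, h⟩ := Nat.exists_eq_two_pow_mul_odd (orderOf_pos u).ne'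
  obtain ⟨l, rfl⟩ := hm
  refine ⟨u ^ (l + 1), ?_⟩
  have h1 : ((u ^ (l + 1) : Oˣ) : O) ^ 2 - u = u * ((u : O) ^ (2 * l + 1) - 1) := by
    push_cast
    ring
  rw [h1]
  refine Commute.isNilpotent_mul_left (Commute.all _ _) ⟨2 ^ e, ?_⟩
  rw [sub_pow_char_pow, one_pow, ← pow_mul, mul_comm, ← h, ← Units.val_pow_eq_pow_val,
    pow_orderOf_eq_one, Units.val_one, sub_self]

/-- Over a finite ring of characteristic two, the norm form of a quadratic extension generated by
a root of `x ^ 2 + x = y` represents all units. -/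
lemma exists_sq_add_mul_add_eq {O : Type*} [CommRing O] [Finite O] [CharP O 2] (y c : Oˣ) :
    ∃ a b : O, a ^ 2 + a * b + y * b ^ 2 = c := by
  obtain ⟨b, hb⟩ := exists_sq_sub_isNilpotent (c * y⁻¹)
  obtain ⟨d, hd⟩ : ∃ d, d = y * (b : O) ^ 2 - c := ⟨_, rfl⟩
  let P : Polynomial O := Polynomial.X ^ 2 + Polynomial.C (b : O) * Polynomial.X + Polynomial.C d
  obtain ⟨a, ⟨-, ha⟩, -⟩ := Polynomial.existsUnique_nilpotent_sub_and_aeval_eq_zero (P := P)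
    (x := (0 : O)) (by
      have : Polynomial.aeval (0 : O) P = y * ((b : O) ^ 2 - ((c * y⁻¹ : Oˣ) : O)) := by
        simp [P, hd, mul_sub, mul_left_comm (y : O)]
      rw [this]
      exact Commute.isNilpotent_mul_left (Commute.all _ _) hb) (by
      have : Polynomial.aeval (0 : O) (Polynomial.derivative P) = b := by simp [P]
      rw [this]
      exact b.isUnit)
  refine ⟨a, b, ?_⟩
  have : a ^ 2 + b * a + d = 0 := by simpa [P] using ha
  linear_combination this - hd

variable {F : Type*} [Field F] {O : Type*} [CommRing O] [Algebra F O]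

/-- The form `ν (a * conj b)` on the quadratic extension of `O` by a root of `x ^ 2 + x = y`, read
off in the constant coefficient. -/
def twistedForm (y : O) (ν : O →ₗ[F] F) : BilinForm F (O × O) :=
  LinearMap.mk₂ F (fun a b => ν (a.1 * b.1 + a.2 * b.1 + y * (a.2 * b.2)))
    (fun a a' b => by rw [← map_add]; congr 1; simp only [Prod.fst_add, Prod.snd_add]; ring)
    (fun r a b => by
      rw [← map_smul]; congr 1
      simp only [Prod.smul_fst, Prod.smul_snd, smul_mul_assoc, mul_smul_comm, smul_add])
    (fun a b b' => by rw [← map_add]; congr 1; simp only [Prod.fst_add, Prod.snd_add]; ring)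
    (fun r a b => by
      rw [← map_smul]; congr 1
      simp only [Prod.smul_fst, Prod.smul_snd, mul_smul_comm, smul_add])

lemma twistedForm_apply (y : O) (ν : O →ₗ[F] F) (a b : O × O) :
    twistedForm y ν a b = ν (a.1 * b.1 + a.2 * b.1 + y * (a.2 * b.2)) := rfl

variable {ν ν₁ ν₂ : O →ₗ[F] F}

lemma eq_zero_of_twistedForm {y : O} (hy : IsUnit y) (hν : ∀ o, (∀ o', ν (o * o') = 0) → o = 0)
    {a : O × O} (h : ∀ b, twistedForm y ν a b = 0) : a = 0 := by
  have h1 : a.1 + a.2 = 0 := hν _ fun o => by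
    rw [← h (o, 0), twistedForm_apply]
    congr 1
    ring
  have h2 : y * a.2 = 0 := hν _ fun o => by
    rw [← h (0, o), twistedForm_apply]
    congr 1
    ring
  have h3 := hy.mul_right_eq_zero.1 h2
  rw [h3, add_zero] at h1
  exact Prod.ext h1 h3

theorem twistedForm_isometric [Finite F] [CharP F 2] [Module.Finite F O] {y : O} (hy : IsUnit y)
    (h₁ : ∀ o, (∀ o', ν₁ (o * o') = 0) → o = 0) (h₂ : ∀ o, (∀ o', ν₂ (o * o') = 0) → o = 0) :
    Isometric (twistedForm y ν₁) (twistedForm y ν₂) := by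
  cases subsingleton_or_nontrivial O with
  | inl h => exact ⟨LinearEquiv.refl F _, fun a b => by
      rw [Subsingleton.elim a 0, map_zero, map_zero, map_zero]
      rfl⟩
  | inr h =>
  have : Finite O := Module.finite_of_finite F
  have : CharP O 2 := charP_of_injective_algebraMap (algebraMap F O).injective 2
  have h2 : (2 : O) = 0 := CharTwo.two_eq_zero
  let T : O →ₗ[F] Dual F O := (LinearMap.mul F O).compr₂ ν₂
  have hT : Function.Injective T := (injective_iff_map_eq_zero _).2 fun o ho => h₂ o fun o' =>
    congrArg (fun l : Dual F O => l o') ho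
  obtain ⟨c, hc⟩ := (LinearMap.injective_iff_surjective_of_finrank_eq_finrank
    Subspace.dual_finrank_eq.symm).1 hT ν₁
  have hc : ∀ o, ν₂ (c * o) = ν₁ o := fun o => congrArg (fun l : Dual F O => l o) hc
  have hcu : IsUnit c := by
    have : Function.Injective (c * ·) := (injective_iff_map_eq_zero
      (AddMonoidHom.mulLeft c)).2 fun o ho => h₁ o fun o' => by
        rw [← hc, ← mul_assoc, show c * o = 0 from ho, zero_mul, map_zero]
    obtain ⟨d, hd⟩ := Finite.surjective_of_injective this 1
    exact IsUnit.of_mul_eq_one d hd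
  obtain ⟨a, b, hab⟩ := exists_sq_add_mul_add_eq hy.unit hcu.unit
  rw [IsUnit.unit_spec, IsUnit.unit_spec] at hab
  let φ : O × O →ₗ[F] O × O :=
    { toFun := fun p => (p.1 * a + p.2 * b * y, p.1 * b + p.2 * a + p.2 * b)
      map_add' := fun p p' => by
        ext <;> simp only [Prod.fst_add, Prod.snd_add] <;> ring
      map_smul' := fun r p => by
        ext <;> simp only [Prod.smul_fst, Prod.smul_snd, smul_mul_assoc, smul_add, RingHom.id_apply] }
  have hφ : ∀ p p', twistedForm y ν₂ (φ p) (φ p') = twistedForm y ν₁ p p' := fun p p' => by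
    rw [twistedForm_apply y ν₁, ← hc, twistedForm_apply, ← hab]
    congr 1
    change (p.1 * a + p.2 * b * y) * (p'.1 * a + p'.2 * b * y) +
      (p.1 * b + p.2 * a + p.2 * b) * (p'.1 * a + p'.2 * b * y) +
      y * ((p.1 * b + p.2 * a + p.2 * b) * (p'.1 * b + p'.2 * a + p'.2 * b)) = _
    linear_combination (p.1 * a * b * y * p'.2 + p.1 * b ^ 2 * y * p'.2 + a * b * y * p.2 * p'.2 +
      a * b * y * p'.1 * p.2 + b ^ 2 * y * p.2 * p'.2) * h2
  have hφi : Function.Injective φ := (injective_iff_map_eq_zero φ).2 fun p hp =>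
    eq_zero_of_twistedForm hy h₁ fun p' => by
      rw [← hφ, hp, map_zero, LinearMap.zero_apply]
  exact ⟨LinearEquiv.ofInjectiveEndo φ hφi, fun u v => hφ u v⟩

end TwistedForm

section SymbolMap

open Module Polynomial

open LinearMap (BilinForm)

variable {F : Type*} [Field F] {V : Type*} [AddCommGroup V] [Module F V]

/-- The skew-symmetrization of a bilinear form. -/
def skewForm (X : BilinForm F V) : BilinForm F V := X - X.flip

lemma skewForm_apply (X : BilinForm F V) (u v : V) : skewForm X u v = X u v - X v u := rfl

/-- The form `X` and its skew-symmetrization are nondegenerate, and are related by `x`. -/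
structure IsSymbol (X : BilinForm F V) (x : End F V) : Prop where
  nondegenerate : X.Nondegenerate
  skew : (skewForm X).Nondegenerate
  apply_eq : ∀ u v, skewForm X (x u) v = X u v

lemma exists_isSymbol [FiniteDimensional F V] {X : BilinForm F V} (hX : X.Nondegenerate)
    (hA : (skewForm X).Nondegenerate) : ∃ x, IsSymbol X x := by
  let e := (skewForm X).toDual hA
  refine ⟨e.symm.toLinearMap ∘ₗ X, hX, hA, fun u v => ?_⟩
  change e (e.symm (X u)) v = X u v
  rw [e.apply_symm_apply]

/-- The endomorphism `x + x ^ 2`. -/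
def normEnd (x : End F V) : End F V := x + x * x

lemma aeval_mul_apply (y : End F V) (p q : F[X]) (v : V) :
    aeval y (p * q) v = aeval y p (aeval y q v) := by
  rw [map_mul, Module.End.mul_apply]

lemma aeval_normEnd_apply (x : End F V) (p : F[X]) (v : V) :
    aeval (normEnd x) p (x v) = x (aeval (normEnd x) p v) := by
  have h : normEnd x = aeval x (X + X * X : F[X]) := by simp [normEnd]
  rw [h, ← aeval_comp]
  change (aeval x _ * x) v = (x * aeval x _) v
  congr 1
  have h2 : aeval x (X : F[X]) = x := aeval_X x
  conv_lhs => rw [← h2, aeval_X, ← h2, aeval_X]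
  simpa using ((Commute.all (p.comp (X + X * X)) X).map (aeval x)).eq

namespace IsSymbol

variable [CharP F 2] {X : BilinForm F V} {x : End F V} (h : IsSymbol X x)

include h

omit h [CharP F 2] in
lemma skewForm_self (u : V) : skewForm X u u = 0 := sub_self _

omit h in
lemma skewForm_comm (u v : V) : skewForm X u v = skewForm X v u := by
  rw [skewForm_apply, skewForm_apply, CharTwo.sub_eq_add, CharTwo.sub_eq_add, add_comm]

lemma adjoint (u v : V) : skewForm X (x u) v = skewForm X u v + skewForm X u (x v) := by
  rw [skewForm_comm u (x v), h.apply_eq, h.apply_eq, skewForm_apply]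
  ring

lemma skewForm_normEnd (u v : V) : skewForm X (normEnd x u) v = skewForm X (x u) (x v) := by
  change skewForm X (x u + x (x u)) v = _
  rw [map_add, LinearMap.add_apply, h.adjoint (x u), ← add_assoc, CharTwo.add_self_eq_zero, zero_add]

lemma skewForm_aeval (p : F[X]) (u v : V) :
    skewForm X (aeval (normEnd x) p u) v = skewForm X u (aeval (normEnd x) p v) := by
  induction p using Polynomial.induction_on' generalizing u v with
  | add p q hp hq => simp only [map_add, LinearMap.add_apply, hp, hq]
  | monomial n a =>
    simp only [aeval_monomial, Module.End.mul_apply, algebraMap_end_apply, map_smul,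
      LinearMap.smul_apply]
    congr 1
    induction n generalizing u v with
    | zero => rfl
    | succ n ih =>
      rw [pow_succ, Module.End.mul_apply, ih, h.skewForm_normEnd, skewForm_comm,
        ← h.skewForm_normEnd, skewForm_comm, ← Module.End.mul_apply (normEnd x), ← pow_succ',
        pow_succ]

lemma skewForm_aeval_self (p : F[X]) (v : V) : skewForm X (aeval (normEnd x) p v) v = 0 := by
  induction p using Polynomial.induction_on' with
  | add p q hp hq => simp only [map_add, LinearMap.add_apply, hp, hq, add_zero]
  | monomial n a =>
    rw [← C_mul_X_pow_eq_monomial, aeval_mul_apply, aeval_C, algebraMap_end_apply, map_smul,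
      LinearMap.smul_apply]
    obtain ⟨k, rfl | rfl⟩ := Nat.even_or_odd' n
    · rw [two_mul, pow_add, aeval_mul_apply, h.skewForm_aeval, skewForm_self, smul_zero]
    · rw [pow_succ', two_mul, pow_add, mul_left_comm, aeval_mul_apply, h.skewForm_aeval,
        aeval_mul_apply, aeval_X, h.skewForm_normEnd, skewForm_self,
        smul_zero]

omit h in
lemma apply_apply (v : V) : x (x v) = normEnd x v + x v := by
  change _ = x v + x (x v) + x v
  have : x v + x v = 0 := by
    rw [← two_smul F, CharTwo.two_eq_zero, zero_smul]
  rw [add_right_comm, this, zero_add]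

lemma normEnd_injective : Function.Injective (normEnd x) := by
  refine (injective_iff_map_eq_zero _).2 fun u hu => ?_
  have h1 : x u = 0 := h.nondegenerate.2 _ fun w => by
    rw [← h.apply_eq, skewForm_comm, ← h.skewForm_normEnd, hu, map_zero, LinearMap.zero_apply]
  exact h.nondegenerate.1 _ fun w => by rw [← h.apply_eq, h1, map_zero, LinearMap.zero_apply]

/-- The functional `p ↦ A (p x v) v` on polynomials. -/
noncomputable def functional (_ : IsSymbol X x) (v : V) : F[X] →ₗ[F] F :=
  (skewForm X).flip v ∘ₗ LinearMap.applyₗ (x v) ∘ₗ (aeval (normEnd x)).toLinearMap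

omit [CharP F 2] in
lemma functional_apply (v : V) (p : F[X]) :
    h.functional v p = skewForm X (aeval (normEnd x) p (x v)) v := rfl

lemma apply_cyclic (v : V) (f g f' g' : F[X]) :
    X (aeval (normEnd x) f v + aeval (normEnd x) g (x v))
      (aeval (normEnd x) f' v + aeval (normEnd x) g' (x v)) =
    h.functional v (f * f' + g * f' + Polynomial.X * (g * g')) := by
  have hY : ∀ u, normEnd x u = aeval (normEnd x) (Polynomial.X : F[X]) u := fun u => by
    rw [aeval_X]
  have e1 : ∀ f f' : F[X], X (aeval (normEnd x) f v) (aeval (normEnd x) f' v) =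
      h.functional v (f * f') := fun f f' => by
    rw [← h.apply_eq, ← h.skewForm_aeval, ← aeval_normEnd_apply, ← aeval_mul_apply, mul_comm,
      functional_apply]
  have e2 : ∀ f g' : F[X], X (aeval (normEnd x) f v) (aeval (normEnd x) g' (x v)) = 0 :=
      fun f g' => by
    rw [← h.apply_eq, ← h.skewForm_aeval, ← aeval_normEnd_apply, ← aeval_mul_apply,
      h.skewForm_aeval_self]
  have e3 : ∀ g f' : F[X], X (aeval (normEnd x) g (x v)) (aeval (normEnd x) f' v) =
      h.functional v (g * f') := fun g f' => by
    rw [← h.apply_eq, ← h.skewForm_aeval, ← aeval_normEnd_apply, ← aeval_mul_apply, apply_apply,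
      map_add, map_add, LinearMap.add_apply, hY, ← aeval_mul_apply, h.skewForm_aeval_self,
      zero_add, mul_comm, functional_apply]
  have e4 : ∀ g g' : F[X], X (aeval (normEnd x) g (x v)) (aeval (normEnd x) g' (x v)) =
      h.functional v (Polynomial.X * (g * g')) := fun g g' => by
    rw [← h.apply_eq, ← h.skewForm_aeval, ← aeval_normEnd_apply, ← aeval_mul_apply, apply_apply,
      map_add, map_add, LinearMap.add_apply, h.skewForm_aeval_self, add_zero, hY,
      ← aeval_mul_apply, h.skewForm_aeval, skewForm_comm, functional_apply]
    congr 3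
    rw [mul_comm g', mul_comm _ Polynomial.X]
  simp only [map_add, LinearMap.add_apply, e1, e2, e3, e4]
  ring

end IsSymbol

end SymbolMap

section CyclicVector

open Module Polynomial

open LinearMap (BilinForm)

namespace IsSymbol

variable {F : Type*} [Field F] {V : Type*} [AddCommGroup V] [Module F V] [CharP F 2]
  {X : BilinForm F V} {x : End F V} (h : IsSymbol X x)

include h

lemma functional_aeval (v : V) (c p : F[X]) :
    h.functional (aeval (normEnd x) c v) p = h.functional v (c * c * p) := by
  rw [functional_apply, functional_apply, ← aeval_normEnd_apply, ← h.skewForm_aeval,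
    ← aeval_mul_apply, ← aeval_mul_apply, mul_right_comm]

omit [CharP F 2] in
lemma functional_add (v w : V) (p : F[X]) :
    h.functional (v + w) p = h.functional v p + h.functional w p +
      (skewForm X (aeval (normEnd x) p (x v)) w + skewForm X (aeval (normEnd x) p (x w)) v) := by
  simp only [functional_apply, map_add, LinearMap.add_apply]
  ring

lemma functional_polar (v w : V) (p : F[X]) :
    skewForm X (aeval (normEnd x) p (x v)) w + skewForm X (aeval (normEnd x) p (x w)) v =
      skewForm X (aeval (normEnd x) p v) w := by
  rw [h.skewForm_aeval (p := p) (u := x w), h.adjoint, aeval_normEnd_apply, skewForm_comm _ w,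
    skewForm_comm w (x _), add_left_comm, skewForm_comm w, CharTwo.add_self_eq_zero, add_zero]

lemma exists_cyclic_prime_pow {p c : F[X]} (hp : Prime p) (i : ℕ) (hc : IsCoprime (p ^ (i + 1)) c)
    (h0 : ∀ f : F[X], aeval (normEnd x) f = 0 ↔ p ^ (i + 1) * c ∣ f) :
    ∃ v, aeval (normEnd x) (p ^ (i + 1)) v = 0 ∧
      ∀ f, (∀ g, h.functional v (f * g) = 0) → p ^ (i + 1) ∣ f := by
  classical
  have hc0 : c ≠ 0 := by
    rintro rfl
    have := (isCoprime_zero_right.1 hc)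
    exact hp.not_isUnit (isUnit_of_dvd_unit (dvd_pow_self p i.succ_ne_zero) this)
  obtain ⟨v, hv⟩ : ∃ v, h.functional v (c * c * p ^ i) ≠ 0 := by
    by_contra! hv
    have h1 : aeval (normEnd x) (c * c * p ^ i) = 0 := by
      ext u
      refine h.skew.1 _ fun w => ?_
      have e := hv (u + w)
      rwa [h.functional_add, hv, hv, zero_add, zero_add, h.functional_polar] at e
    rw [h0, pow_succ, mul_assoc, mul_comm (c * c)] at h1
    have h2 := (mul_dvd_mul_iff_left (pow_ne_zero i hp.ne_zero)).1 h1
    rw [mul_comm p] at h2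
    have h3 := (mul_dvd_mul_iff_left hc0).1 h2
    have h4 : IsCoprime p c := hc.of_isCoprime_of_dvd_left (dvd_pow_self p i.succ_ne_zero)
    exact hp.not_isUnit (h4.isUnit_of_dvd' dvd_rfl h3)
  refine ⟨aeval (normEnd x) c v, ?_, fun f hf => ?_⟩
  · rw [← aeval_mul_apply, (h0 _).2 dvd_rfl, LinearMap.zero_apply]
  · have hdvd : EuclideanDomain.gcd f (p ^ (i + 1)) ∣ p ^ (i + 1) :=
      EuclideanDomain.gcd_dvd_right _ _
    obtain ⟨j, hj, hjp⟩ := (dvd_prime_pow hp _).1 hdvd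
    rcases hj.eq_or_lt with rfl | hj
    · exact hjp.symm.dvd.trans (EuclideanDomain.gcd_dvd_left _ _)
    · exfalso
      obtain ⟨r, hr⟩ := hjp.dvd.trans (pow_dvd_pow p (Nat.lt_succ_iff.1 hj))
      apply hv
      rw [← h.functional_aeval, hr, EuclideanDomain.gcd_eq_gcd_ab, add_mul, map_add, mul_assoc,
        mul_assoc, hf, zero_add]
      rw [functional_apply, aeval_mul_apply, h.skewForm_aeval, ← aeval_mul_apply,
        (h0 _).2 dvd_rfl, LinearMap.zero_apply, map_zero]

lemma functional_mul_eq_zero {d : F[X]} {v : V} (hv : aeval (normEnd x) d v = 0) (w : V)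
    (p : F[X]) : skewForm X (aeval (normEnd x) (d * p) (x v)) w = 0 ∧
      skewForm X (aeval (normEnd x) (d * p) (x w)) v = 0 := by
  constructor
  · rw [mul_comm, aeval_mul_apply, aeval_normEnd_apply, hv, map_zero, map_zero, map_zero,
      LinearMap.zero_apply]
  · rw [aeval_mul_apply, h.skewForm_aeval, hv, map_zero]

lemma exists_cyclic_of_mul {μ : F[X]} (hμ : μ ≠ 0)
    (h0 : ∀ f : F[X], aeval (normEnd x) f = 0 ↔ μ ∣ f) (d : F[X]) :
    ∀ c, d * c = μ → IsCoprime d c → ∃ v, aeval (normEnd x) d v = 0 ∧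
      ∀ f, (∀ g, h.functional v (f * g) = 0) → d ∣ f := by
  induction d using UniqueFactorizationMonoid.induction_on_coprime with
  | h0 => rintro c rfl; simp at hμ
  | h1 hd => exact fun c _ _ => ⟨0, map_zero _, fun f _ => hd.dvd⟩
  | hpr i hp =>
    rintro c rfl hc
    cases i with
    | zero => exact ⟨0, map_zero _, fun f _ => by simp⟩
    | succ i => exact h.exists_cyclic_prime_pow hp i hc h0
  | hcp hxy ih₁ ih₂ =>
    rename_i d₁ d₂
    rintro c rfl hc
    have h12 : IsCoprime d₁ d₂ := hxy.isCoprime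
    obtain ⟨v, hv, hv'⟩ := ih₁ (d₂ * c) (mul_assoc _ _ _).symm
      (h12.mul_right hc.of_mul_left_left)
    obtain ⟨w, hw, hw'⟩ := ih₂ (d₁ * c) (by ring) (h12.symm.mul_right hc.of_mul_left_right)
    refine ⟨v + w, ?_, fun f hf => h12.mul_dvd ?_ ?_⟩
    · rw [map_add, aeval_mul_apply (v := w), hw, map_zero, mul_comm d₁, aeval_mul_apply, hv,
        map_zero, add_zero]
    · refine h12.dvd_of_dvd_mul_right (hv' (f * d₂) fun g => ?_)
      have e := hf (d₂ * g)
      rw [mul_left_comm, h.functional_add, (h.functional_mul_eq_zero hw _ _).1,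
        (h.functional_mul_eq_zero hw _ _).2, functional_apply (v := w),
        (h.functional_mul_eq_zero hw _ _).1] at e
      rw [mul_assoc, mul_left_comm]
      simpa using e
    · refine h12.symm.dvd_of_dvd_mul_right (hw' (f * d₁) fun g => ?_)
      have e := hf (d₁ * g)
      rw [mul_left_comm, h.functional_add, (h.functional_mul_eq_zero hv _ _).1,
        (h.functional_mul_eq_zero hv _ _).2, functional_apply (v := v),
        (h.functional_mul_eq_zero hv _ _).1] at e
      rw [mul_assoc, mul_left_comm]
      simpa using e

lemma exists_cyclic [FiniteDimensional F V] :
    ∃ v, ∀ f, (∀ g, h.functional v (f * g) = 0) → minpoly F (normEnd x) ∣ f := by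
  obtain ⟨v, -, hv⟩ := h.exists_cyclic_of_mul (minpoly.ne_zero (Algebra.IsIntegral.isIntegral _))
    (fun f => (minpoly.dvd_iff (A := F) (x := normEnd x)).symm) _ 1 (mul_one _) isCoprime_one_right
  exact ⟨v, hv⟩

end IsSymbol

end CyclicVector

section CyclicSummand

open Module Polynomial

open LinearMap (BilinForm)

variable {F : Type*} [Field F] {V : Type*} [AddCommGroup V] [Module F V]

lemma aeval_apply_of_comp_eq {U : Type*} [AddCommGroup U] [Module F U] {a : End F U} {b : End F V}
    {i : U →ₗ[F] V} (h : ∀ u, i (a u) = b (i u)) (p : F[X]) (u : U) :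
    i (aeval a p u) = aeval b p (i u) := by
  induction p using Polynomial.induction_on' with
  | add p q hp hq => simp only [map_add, LinearMap.add_apply, hp, hq]
  | monomial n r =>
    simp only [aeval_monomial, Module.End.mul_apply, algebraMap_end_apply, map_smul]
    congr 1
    induction n generalizing u with
    | zero => rfl
    | succ n ih => rw [pow_succ, pow_succ, Module.End.mul_apply, Module.End.mul_apply, ih, h]

lemma LinearMap.BilinForm.Nondegenerate.restrict_of_isCompl [FiniteDimensional F V]
    {B : BilinForm F V} (hB : B.Nondegenerate) {W U : Submodule F V} (h : IsCompl W U)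
    (ho : ∀ w ∈ W, ∀ u ∈ U, B u w = 0) : (B.restrict U).Nondegenerate := by
  refine LinearMap.BilinForm.nondegenerate_of_left fun u hu => Subtype.ext (hB.1 _ fun v => ?_)
  obtain ⟨w, hw, u', hu', rfl⟩ := Submodule.mem_sup.1 (h.sup_eq_top ▸ Submodule.mem_top (x := v))
  rw [map_add, ho w hw u u.2, zero_add]
  exact hu ⟨u', hu'⟩

lemma isUnit_root_of_coeff_zero_ne_zero {f : F[X]} (h : f.coeff 0 ≠ 0) :
    IsUnit (AdjoinRoot.root f) := by
  have h1 : AdjoinRoot.mk f (f.divX * Polynomial.X + C (f.coeff 0)) = 0 := by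
    rw [divX_mul_X_add, AdjoinRoot.mk_self]
  rw [map_add, map_mul, AdjoinRoot.mk_X, AdjoinRoot.mk_C, mul_comm] at h1
  have h2 := eq_neg_of_add_eq_zero_left h1
  exact isUnit_of_mul_isUnit_left (h2 ▸ ((isUnit_iff_ne_zero.2 h).map _).neg)

lemma minpoly_coeff_zero_ne_zero [FiniteDimensional F V] {y : End F V}
    (hy : Function.Injective y) : (minpoly F y).coeff 0 ≠ 0 := by
  intro h
  have hi : IsIntegral F y := Algebra.IsIntegral.isIntegral y
  obtain ⟨g, hg⟩ := X_dvd_iff.2 h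
  have h1 : minpoly F y ∣ g := by
    refine minpoly.dvd F y (LinearMap.ext fun v => hy ?_)
    have := minpoly.aeval F y
    rw [hg] at this
    have h2 := congrArg (fun l : End F V => l v) this
    simp only [aeval_mul_apply, aeval_X] at h2
    rw [LinearMap.zero_apply, map_zero]
    exact h2
  have hg0 : g ≠ 0 := by
    rintro rfl
    exact minpoly.ne_zero hi (by rw [hg, mul_zero])
  have h3 := natDegree_le_of_dvd h1 hg0
  rw [hg, natDegree_X_mul hg0] at h3
  omega

lemma finrank_adjoinRoot {f : F[X]} (hf : f.Monic) : finrank F (AdjoinRoot f) = f.natDegree :=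
  (AdjoinRoot.powerBasis' hf).finrank

theorem IsSymbol.exists_summand [CharP F 2] [FiniteDimensional F V] {X : BilinForm F V}
    {x : End F V} (h : IsSymbol X x) :
    ∃ W U : Submodule F V, IsCompl W U ∧ (∀ w ∈ W, ∀ u ∈ U, X w u = 0) ∧
      (∀ w ∈ W, ∀ u ∈ U, X u w = 0) ∧
      (∃ ν : AdjoinRoot (minpoly F (normEnd x)) →ₗ[F] F, (∀ o, (∀ o', ν (o * o') = 0) → o = 0) ∧
        Isometric (X.restrict W) (twistedForm (AdjoinRoot.root _) ν)) ∧
      (∃ x' : End F U, IsSymbol (X.restrict U) x' ∧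
        minpoly F (normEnd x') ∣ minpoly F (normEnd x)) ∧
      2 * (minpoly F (normEnd x)).natDegree + finrank F U = finrank F V := by
  obtain ⟨v, hv⟩ := h.exists_cyclic
  have hy := isUnit_root_of_coeff_zero_ne_zero (minpoly_coeff_zero_ne_zero h.normEnd_injective)
  have hm : (minpoly F (normEnd x)).Monic := minpoly.monic (Algebra.IsIntegral.isIntegral _)
  have hμ := minpoly.aeval F (normEnd x)
  generalize minpoly F (normEnd x) = μ at *
  have : Module.Finite F (AdjoinRoot μ) := hm.finite_adjoinRoot
  let τ : V → AdjoinRoot μ →ₗ[F] V := fun w =>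
    LinearMap.applyₗ w ∘ₗ (aeval (normEnd x)).toLinearMap ∘ₗ AdjoinRoot.modByMonicHom hm
  have hτ : ∀ w f, τ w (AdjoinRoot.mk μ f) = aeval (normEnd x) f w := fun w f => by
    change aeval (normEnd x) (AdjoinRoot.modByMonicHom hm (AdjoinRoot.mk μ f)) w = _
    rw [AdjoinRoot.modByMonicHom_mk]
    conv_rhs => rw [← modByMonic_add_div f μ]
    rw [map_add, map_mul, hμ, zero_mul, add_zero]
  let T : AdjoinRoot μ × AdjoinRoot μ →ₗ[F] V := (τ v).coprod (τ (x v))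
  have hT : ∀ f g, T (AdjoinRoot.mk μ f, AdjoinRoot.mk μ g) =
      aeval (normEnd x) f v + aeval (normEnd x) g (x v) := fun f g => by
    rw [← hτ, ← hτ]
    rfl
  let ν : AdjoinRoot μ →ₗ[F] F := (skewForm X).flip v ∘ₗ τ (x v)
  have hν : ∀ f, ν (AdjoinRoot.mk μ f) = h.functional v f := fun f => by
    rw [h.functional_apply, ← hτ]
    rfl
  have hν0 : ∀ o, (∀ o', ν (o * o') = 0) → o = 0 := fun o ho => by
    obtain ⟨f, rfl⟩ := AdjoinRoot.mk_surjective o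
    exact AdjoinRoot.mk_eq_zero.2 (hv f fun g => by rw [← hν, map_mul, ho])
  have hXT : ∀ a b, X (T a) (T b) = twistedForm (AdjoinRoot.root μ) ν a b := by
    rintro ⟨a₁, a₂⟩ ⟨b₁, b₂⟩
    obtain ⟨f, rfl⟩ := AdjoinRoot.mk_surjective a₁
    obtain ⟨g, rfl⟩ := AdjoinRoot.mk_surjective a₂
    obtain ⟨f', rfl⟩ := AdjoinRoot.mk_surjective b₁
    obtain ⟨g', rfl⟩ := AdjoinRoot.mk_surjective b₂
    rw [hT, hT, h.apply_cyclic, twistedForm_apply, ← hν]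
    simp only [map_add, map_mul, AdjoinRoot.mk_X]
  have hTi : Function.Injective T := (injective_iff_map_eq_zero T).2 fun a ha =>
    eq_zero_of_twistedForm hy hν0 fun b => by rw [← hXT, ha, map_zero, LinearMap.zero_apply]
  have hAT : ∀ a b : AdjoinRoot μ × AdjoinRoot μ, skewForm X (T a) (T b) = ν (a.2 * b.1 - b.2 * a.1) := fun a b => by
    rw [skewForm_apply, hXT, hXT, twistedForm_apply, twistedForm_apply, ← map_sub]
    congr 1
    ring
  have hR : (skewForm X).IsRefl := fun a b hab => by rw [skewForm_comm, hab]
  have hc : IsCompl (LinearMap.range T) ((skewForm X).orthogonal (LinearMap.range T)) := by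
    refine LinearMap.BilinForm.isCompl_orthogonal_of_restrict_nondegenerate hR
      (LinearMap.BilinForm.nondegenerate_of_left ?_)
    rintro ⟨_, a, rfl⟩ ha
    have ha : ∀ b : AdjoinRoot μ × AdjoinRoot μ, ν (a.2 * b.1 - b.2 * a.1) = 0 := fun b => by
      rw [← hAT]
      exact ha ⟨T b, b, rfl⟩
    have h2 : a.2 = 0 := hν0 _ fun o => by simpa using ha (o, 0)
    have h1 : a.1 = 0 := hν0 _ fun o => by simpa [mul_comm] using ha (0, o)
    refine Subtype.ext ?_
    change T a = 0
    rw [show a = 0 from Prod.ext h1 h2, map_zero]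
  have hW : ∀ a, ∃ b, x (T a) = T b := by
    rintro ⟨a₁, a₂⟩
    obtain ⟨f, rfl⟩ := AdjoinRoot.mk_surjective a₁
    obtain ⟨g, rfl⟩ := AdjoinRoot.mk_surjective a₂
    refine ⟨(AdjoinRoot.mk μ (g * Polynomial.X), AdjoinRoot.mk μ (f + g)), ?_⟩
    rw [hT, hT, map_add, ← aeval_normEnd_apply, ← aeval_normEnd_apply, apply_apply, map_add,
      aeval_mul_apply, aeval_X, map_add, LinearMap.add_apply]
    abel
  have hU0 : ∀ u ∈ (skewForm X).orthogonal (LinearMap.range T), ∀ a, skewForm X (T a) u = 0 :=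
    fun u hu a => hu _ ⟨a, rfl⟩
  have hU : ∀ u ∈ (skewForm X).orthogonal (LinearMap.range T),
      x u ∈ (skewForm X).orthogonal (LinearMap.range T) := by
    rintro u hu _ ⟨a, rfl⟩
    obtain ⟨b, hb⟩ := hW a
    have := h.adjoint (T a) u
    rw [hb, hU0 u hu, hU0 u hu, zero_add] at this
    exact this.symm
  have o₁ : ∀ w ∈ LinearMap.range T, ∀ u ∈ (skewForm X).orthogonal (LinearMap.range T),
      X w u = 0 := by
    rintro _ ⟨a, rfl⟩ u hu
    obtain ⟨b, hb⟩ := hW a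
    rw [← h.apply_eq, hb, hU0 u hu]
  have o₂ : ∀ w ∈ LinearMap.range T, ∀ u ∈ (skewForm X).orthogonal (LinearMap.range T),
      X u w = 0 := by
    rintro _ ⟨a, rfl⟩ u hu
    rw [← h.apply_eq, skewForm_comm, hU0 _ (hU u hu)]
  refine ⟨LinearMap.range T, (skewForm X).orthogonal (LinearMap.range T), hc, o₁, o₂,
    ⟨ν, hν0, Isometric.symm ⟨LinearEquiv.ofInjective T hTi, hXT⟩⟩, ⟨x.restrict hU,
    ⟨h.nondegenerate.restrict_of_isCompl hc o₂, ?_, ?_⟩, ?_⟩, ?_⟩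
  · exact h.skew.restrict_of_isCompl hc fun w hw u hu => by
      rw [skewForm_apply, o₁ w hw u hu, o₂ w hw u hu, sub_zero]
  · exact fun u v => h.apply_eq u v
  · refine minpoly.dvd F _ (LinearMap.ext fun u => Subtype.ext ?_)
    have := aeval_apply_of_comp_eq (i := Submodule.subtype _) (a := normEnd (x.restrict hU))
      (b := normEnd x) (fun _ => rfl) μ u
    rw [hμ] at this
    exact this
  · rw [← Submodule.finrank_add_eq_of_isCompl hc, LinearMap.finrank_range_of_inj hTi,
      finrank_prod, finrank_adjoinRoot hm, two_mul]

end CyclicSummand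

section ChainDecomposition

open Module Polynomial

open LinearMap (BilinForm)

universe u

variable {F : Type*} [Field F]

/-- The form is isometric to a nondegenerate twisted trace form over `F[X] / (f)`. -/
def HasTwist {W : Type*} [AddCommGroup W] [Module F W] (f : F[X]) (B : BilinForm F W) : Prop :=
  ∃ ν : AdjoinRoot f →ₗ[F] F, (∀ o, (∀ o', ν (o * o') = 0) → o = 0) ∧
    Isometric B (twistedForm (AdjoinRoot.root f) ν)

/-- The form is an orthogonal sum of twisted trace forms over `F[X] / (f)`, where `f` runs over
the products of the tails of the list. -/
def HasChain : List F[X] → (V : Type u) → [AddCommGroup V] → [Module F V] → BilinForm F V → Prop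
  | [], V, _, _, _ => Subsingleton V
  | f :: fs, V, _, _, X => ∃ W U : Submodule F V, IsCompl W U ∧ (∀ w ∈ W, ∀ u ∈ U, X w u = 0) ∧
      (∀ w ∈ W, ∀ u ∈ U, X u w = 0) ∧ HasTwist (f :: fs).prod (X.restrict W) ∧
      HasChain fs U (X.restrict U)

/-- The sum of the degrees of the products of the tails of a list of polynomials. -/
noncomputable def chainDegree : List F[X] → ℕ
  | [] => 0
  | f :: fs => (f :: fs).prod.natDegree + chainDegree fs

/-- The entries of the list are monic with nonzero constant coefficient. -/
def IsUnitChain (fs : List F[X]) : Prop := ∀ f ∈ fs, f.Monic ∧ f.coeff 0 ≠ 0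

lemma IsUnitChain.prod {fs : List F[X]} (h : IsUnitChain fs) : fs.prod.Monic ∧ fs.prod.coeff 0 ≠ 0 := by
  induction fs with
  | nil => simp
  | cons f fs ih =>
    obtain ⟨h1, h2⟩ := ih fun g hg => h g (List.mem_cons_of_mem _ hg)
    obtain ⟨h3, h4⟩ := h f List.mem_cons_self
    rw [List.prod_cons, mul_coeff_zero]
    exact ⟨h3.mul h1, mul_ne_zero h4 h2⟩

lemma HasTwist.isometric [Finite F] [CharP F 2] {W W' : Type*} [AddCommGroup W] [Module F W]
    [AddCommGroup W'] [Module F W'] {f : F[X]} (hf : f.Monic) (hf0 : f.coeff 0 ≠ 0)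
    {B : BilinForm F W} {B' : BilinForm F W'} (h : HasTwist f B) (h' : HasTwist f B') :
    Isometric B B' := by
  obtain ⟨ν, hν, hB⟩ := h
  obtain ⟨ν', hν', hB'⟩ := h'
  have : Module.Finite F (AdjoinRoot f) := hf.finite_adjoinRoot
  exact hB.trans ((twistedForm_isometric (isUnit_root_of_coeff_zero_ne_zero hf0) hν hν').trans
    hB'.symm)

lemma HasChain.isometric [Finite F] [CharP F 2] {fs : List F[X]} (hfs : IsUnitChain fs) {V V' : Type u}
    [AddCommGroup V] [Module F V] [AddCommGroup V'] [Module F V'] {X : BilinForm F V}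
    {X' : BilinForm F V'} (h : HasChain fs V X) (h' : HasChain fs V' X') : Isometric X X' := by
  induction fs generalizing V V' with
  | nil =>
    have : Subsingleton V := h
    have : Subsingleton V' := h'
    exact ⟨0, fun u v => by rw [Subsingleton.elim u 0, map_zero, map_zero, map_zero]; rfl⟩
  | cons f fs ih =>
    obtain ⟨W, U, hc, o₁, o₂, ht, hU⟩ := h
    obtain ⟨W', U', hc', o₁', o₂', ht', hU'⟩ := h'
    exact .of_isCompl hc hc' o₁ o₂ o₁' o₂' (ht.isometric hfs.prod.1 hfs.prod.2 ht')
      (ih (fun g hg => hfs g (List.mem_cons_of_mem _ hg)) hU hU')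

lemma IsSymbol.exists_hasChain [CharP F 2] (N : ℕ) {V : Type u} [AddCommGroup V] [Module F V]
    [FiniteDimensional F V] {X : BilinForm F V} {x : End F V} (h : IsSymbol X x)
    (hN : finrank F V ≤ 2 * N) :
    ∃ fs : List F[X], fs.length = N ∧ IsUnitChain fs ∧ fs.prod = minpoly F (normEnd x) ∧
      HasChain fs V X ∧ 2 * chainDegree fs = finrank F V := by
  induction N generalizing V with
  | zero =>
    have h0 : finrank F V = 0 := by omega
    have : Subsingleton V := finrank_zero_iff.1 h0
    refine ⟨[], rfl, by simp [IsUnitChain], (minpoly.subsingleton _ _).symm, this, h0.symm⟩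
  | succ N ih =>
    obtain ⟨W, U, hc, o₁, o₂, ht, ⟨x', hx', hd⟩, hr⟩ := h.exists_summand
    have hU : finrank F U ≤ 2 * N := by
      by_cases h0 : finrank F V = 0
      · omega
      · have : Nontrivial V := nontrivial_of_finrank_pos (Nat.pos_of_ne_zero h0)
        have := minpoly.natDegree_pos (A := F) (Algebra.IsIntegral.isIntegral (normEnd x))
        omega
    obtain ⟨fs, hl, hfs, hp, hch, hdeg⟩ := ih hx' hU
    obtain ⟨g, hg⟩ := hd
    have hm : (minpoly F (normEnd x)).Monic := minpoly.monic (Algebra.IsIntegral.isIntegral _)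
    have h0 := minpoly_coeff_zero_ne_zero h.normEnd_injective
    have hprod : (g :: fs).prod = minpoly F (normEnd x) := by
      rw [List.prod_cons, hp, hg, mul_comm]
    refine ⟨g :: fs, by rw [List.length_cons, hl], ?_, hprod, ?_, ?_⟩
    · intro f hf
      rcases List.mem_cons.1 hf with rfl | hf
      · rw [hg, mul_coeff_zero] at h0
        exact ⟨Monic.of_mul_monic_left (hp ▸ hfs.prod.1) (hg ▸ hm), right_ne_zero_of_mul h0⟩
      · exact hfs f hf
    · exact ⟨W, U, hc, o₁, o₂, hprod ▸ ht, hch⟩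
    · rw [chainDegree, hprod]
      omega

lemma chainDegree_append {fs : List F[X]} {f : F[X]} (h : IsUnitChain (fs ++ [f])) :
    chainDegree (fs ++ [f]) = chainDegree fs + (fs.length + 1) * f.natDegree := by
  induction fs with
  | nil => simp [chainDegree]
  | cons g fs ih =>
    have h' : IsUnitChain (fs ++ [f]) := fun a ha => h a (List.mem_cons_of_mem _ ha)
    have h1 : (g :: (fs ++ [f])).prod = (g :: fs).prod * f := by simp [mul_assoc]
    have h2 : IsUnitChain (g :: fs) := fun a ha => h a (by
      rw [List.cons_append]
      rcases List.mem_cons.1 ha with rfl | ha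
      · exact List.mem_cons_self
      · exact List.mem_cons_of_mem _ (List.mem_append_left _ ha))
    have h3 : f.Monic := (h f (by simp)).1
    rw [List.cons_append, chainDegree, h1, h2.prod.1.natDegree_mul h3, ih h', chainDegree,
      List.length_cons]
    ring

end ChainDecomposition

section ChainCount

open Finset Polynomial

variable {F : Type*} [Field F] [Fintype F]

open Classical in
/-- The monic polynomials of the given degree with nonzero constant coefficient. -/
noncomputable def monicUnits : ℕ → Finset F[X]
  | 0 => {1}
  | e + 1 => univ.image fun a : Fˣ × (Fin e → F) =>
      X ^ (e + 1) + (∑ i : Fin e, C (a.2 i) * X ^ ((i : ℕ) + 1) + C (a.1 : F))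

lemma mem_monicUnits {f : F[X]} (hf : f.Monic) (h0 : f.coeff 0 ≠ 0) :
    f ∈ monicUnits f.natDegree := by
  classical
  rcases h : f.natDegree with - | e
  · rw [hf.natDegree_eq_zero.1 h]
    exact mem_singleton_self 1
  · refine mem_image.2 ⟨(Units.mk0 _ h0, fun i => f.coeff (i + 1)), mem_univ _, ?_⟩
    conv_rhs => rw [hf.as_sum, h, sum_range_succ', ← Fin.sum_univ_eq_sum_range
      (fun i => C (f.coeff (i + 1)) * X ^ (i + 1))]
    simp

lemma card_monicUnits_le (e : ℕ) :
    (#(monicUnits (F := F) (e + 1)) : ℝ) ≤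
      (1 - (Fintype.card F : ℝ)⁻¹) * (Fintype.card F : ℝ) ^ (e + 1) := by
  classical
  have h : #(monicUnits (F := F) (e + 1)) ≤ (Fintype.card F - 1) * Fintype.card F ^ e := by
    refine card_image_le.trans ?_
    rw [card_univ, Fintype.card_prod, Fintype.card_units, Fintype.card_fun, Fintype.card_fin]
  have h1 : (1 : ℕ) ≤ Fintype.card F := Fintype.card_pos
  have h2 : (Fintype.card F : ℝ) ≠ 0 := by positivity
  calc (#(monicUnits (F := F) (e + 1)) : ℝ)
      ≤ ((Fintype.card F - 1 : ℕ) : ℝ) * (Fintype.card F : ℝ) ^ e := mod_cast h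
    _ = _ := by
      rw [Nat.cast_sub h1, pow_succ']
      field_simp
      simp

open Classical in
/-- A finite set containing the chains of length `N` and degree at most `M`. -/
noncomputable def chainsOf : ℕ → ℕ → Finset (List F[X])
  | 0, _ => {[]}
  | N + 1, M => ((range (M + 1)).filter fun e => (N + 1) * e ≤ M).biUnion fun e =>
      image₂ (fun fs f => fs ++ [f]) (chainsOf N (M - (N + 1) * e)) (monicUnits e)

lemma IsUnitChain.mem_chainsOf {N M : ℕ} {fs : List F[X]} (h : IsUnitChain fs) (hN : fs.length = N)
    (hM : chainDegree fs ≤ M) : fs ∈ chainsOf N M := by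
  classical
  induction N generalizing fs M with
  | zero => exact mem_singleton.2 (List.length_eq_zero_iff.1 hN)
  | succ N ih =>
    rcases List.eq_nil_or_concat fs with rfl | ⟨gs, f, rfl⟩
    · simp at hN
    rw [List.concat_eq_append] at *
    have hl : gs.length = N := by simpa using hN
    rw [chainDegree_append h, hl] at hM
    have hf := h f (by simp)
    have h1 : f.natDegree ≤ (N + 1) * f.natDegree := Nat.le_mul_of_pos_left _ N.succ_pos
    refine mem_biUnion.2 ⟨f.natDegree, mem_filter.2 ⟨mem_range.2 (by omega), by omega⟩,
      mem_image₂.2 ⟨gs, ih (fun g hg => h g (List.mem_append_left _ hg)) hl (by omega), f,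
        mem_monicUnits hf.1 hf.2, rfl⟩⟩

lemma card_chainsOf_succ (N M : ℕ) : (#(chainsOf (F := F) (N + 1) M) : ℝ) ≤
    ∑ e ∈ (range (M + 1)).filter fun e => (N + 1) * e ≤ M,
      (#(chainsOf (F := F) N (M - (N + 1) * e)) : ℝ) * #(monicUnits (F := F) e) := by
  classical
  have h : #(chainsOf (F := F) (N + 1) M) ≤
      ∑ e ∈ (range (M + 1)).filter fun e => (N + 1) * e ≤ M,
      #(chainsOf (F := F) N (M - (N + 1) * e)) * #(monicUnits (F := F) e) := by
    rw [chainsOf]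
    exact card_biUnion_le.trans (sum_le_sum fun e _ => card_image₂_le _ _ _)
  exact_mod_cast h

lemma card_chainsOf_one (M : ℕ) :
    (#(chainsOf (F := F) 1 M) : ℝ) ≤ (Fintype.card F : ℝ) ^ M := by
  have hq : (0 : ℝ) < Fintype.card F := by
    have := Fintype.card_pos (α := F)
    positivity
  have h : ∀ e, (#(monicUnits (F := F) (e + 1)) : ℝ) ≤
      (Fintype.card F : ℝ) ^ (e + 1) - (Fintype.card F : ℝ) ^ e := fun e => by
    refine (card_monicUnits_le e).trans_eq ?_
    rw [sub_mul, one_mul, pow_succ', inv_mul_cancel_left₀ hq.ne']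
  calc (#(chainsOf (F := F) 1 M) : ℝ)
      ≤ ∑ e ∈ (range (M + 1)).filter fun e => (0 + 1) * e ≤ M,
        (#(chainsOf (F := F) 0 (M - (0 + 1) * e)) : ℝ) * #(monicUnits (F := F) e) :=
        card_chainsOf_succ 0 M
    _ ≤ ∑ e ∈ range (M + 1), (#(monicUnits (F := F) e) : ℝ) := by
        refine (sum_le_sum_of_subset_of_nonneg (filter_subset _ _) fun e _ _ => by
          positivity).trans_eq (sum_congr rfl fun e _ => ?_)
        rw [chainsOf, card_singleton, Nat.cast_one, one_mul]
    _ ≤ ∑ e ∈ range M, ((Fintype.card F : ℝ) ^ (e + 1) - (Fintype.card F : ℝ) ^ e) + 1 := by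
        rw [sum_range_succ']
        refine add_le_add (sum_le_sum fun e _ => h e) ?_
        rw [monicUnits, card_singleton, Nat.cast_one]
    _ = _ := by rw [sum_range_sub, pow_zero, sub_add_cancel]

theorem card_chainsOf_le (N M : ℕ) : (#(chainsOf (F := F) (N + 1) M) : ℝ) ≤
    (1 - (Fintype.card F : ℝ)⁻¹ ^ (N + 1)) / (1 - (Fintype.card F : ℝ)⁻¹) *
      (Fintype.card F : ℝ) ^ M := by
  have hq : (1 : ℝ) < Fintype.card F := mod_cast Fintype.one_lt_card
  have h2 := card_monicUnits_le (F := F)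
  have h3 := card_chainsOf_one (F := F)
  generalize (Fintype.card F : ℝ) = q at *
  have h0 : 0 < q⁻¹ := by positivity
  have h1 : q⁻¹ < 1 := inv_lt_one_of_one_lt₀ hq
  induction N generalizing M with
  | zero =>
    rw [zero_add, pow_one, div_self (by linarith), one_mul]
    exact h3 M
  | succ N ih =>
    have hN : 0 < 1 - q⁻¹ ^ (N + 1) := sub_pos.2 (pow_lt_one₀ h0.le h1 N.succ_ne_zero)
    have h1' : 0 < 1 - q⁻¹ := sub_pos.2 h1
    obtain ⟨c, hc⟩ : ∃ c, c = (1 - q⁻¹ ^ (N + 1)) / (1 - q⁻¹) := ⟨_, rfl⟩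
    have hc0 : 0 < c := hc ▸ div_pos hN h1'
    rw [← hc] at ih
    let w : ℕ → ℝ := fun e => if e = 0 then 1 else (1 - q⁻¹) * (q⁻¹ ^ (N + 1)) ^ e
    have hw : ∀ e, 0 ≤ w e := fun e => by
      change 0 ≤ ite _ _ _
      split_ifs
      · exact zero_le_one
      · positivity
    calc (#(chainsOf (F := F) (N + 1 + 1) M) : ℝ)
      ≤ ∑ e ∈ (range (M + 1)).filter fun e => (N + 1 + 1) * e ≤ M,
        (#(chainsOf (F := F) (N + 1) (M - (N + 1 + 1) * e)) : ℝ) * #(monicUnits (F := F) e) :=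
        card_chainsOf_succ (N + 1) M
    _ ≤ ∑ e ∈ (range (M + 1)).filter fun e => (N + 1 + 1) * e ≤ M, c * q ^ M * w e := by
        refine sum_le_sum fun e he => ?_
        have he := (mem_filter.1 he).2
        cases e with
        | zero =>
          rw [monicUnits, card_singleton, Nat.cast_one]
          exact mul_le_mul_of_nonneg_right (ih _) zero_le_one
        | succ e =>
          refine (mul_le_mul (ih _) (h2 e) (by positivity) (by positivity)).trans_eq ?_
          obtain ⟨k, rfl⟩ := Nat.exists_eq_add_of_le he
          rw [Nat.add_sub_cancel_left]
          change _ = c * _ * ((1 - q⁻¹) * (q⁻¹ ^ (N + 1)) ^ (e + 1))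
          have : q ^ ((N + 1 + 1) * (e + 1) + k) * (q⁻¹ ^ (N + 1)) ^ (e + 1) =
              q ^ k * q ^ (e + 1) := by
            rw [← pow_mul, add_mul _ 1 (e + 1), one_mul, pow_add, pow_add, inv_pow]
            field_simp
          linear_combination -(c * (1 - q⁻¹)) * this
    _ ≤ ∑ e ∈ range (M + 1), c * q ^ M * w e :=
        sum_le_sum_of_subset_of_nonneg (filter_subset _ _) fun e _ _ =>
          mul_nonneg (by positivity) (hw e)
    _ = c * q ^ M * ((1 - q⁻¹) * (q⁻¹ ^ (N + 1)) * ∑ e ∈ range M, (q⁻¹ ^ (N + 1)) ^ e + 1) := by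
        rw [← mul_sum, sum_range_succ', mul_sum]
        congr 2
        refine sum_congr rfl fun e _ => ?_
        change (1 - q⁻¹) * (q⁻¹ ^ (N + 1)) ^ (e + 1) = _
        ring
    _ ≤ c * q ^ M * ((1 - q⁻¹) * (q⁻¹ ^ (N + 1)) * (1 - q⁻¹ ^ (N + 1))⁻¹ + 1) := by
        have := sum_range_pow_le (x := q⁻¹ ^ (N + 1)) (by positivity) (sub_pos.1 hN) M
        gcongr
    _ = _ := by
        rw [hc]
        have := h1'.ne'
        have := hN.ne'
        rw [pow_succ _ (N + 1)]
        generalize q⁻¹ ^ (N + 1) = a at *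
        generalize q⁻¹ = b at *
        field_simp
        ring

end ChainCount

section FormCount

open Module Finset

namespace FormClass

variable {F : Type*} [Field F] [Fintype F]

lemma rad_eq_zero_of_mem_ofWeight {P : FormClass F → Prop} {n M : ℕ} (hM : M ≤ n) {c : FormClass F}
    (hc : c ∈ ofWeight P n M) : c.rad = 0 := by
  have h := (mem_ofWeight.1 hc).2
  by_contra h0
  have h1 : 2 * n + 1 ≤ (2 * n + 1) * c.rad := Nat.le_mul_of_pos_right _ (Nat.pos_of_ne_zero h0)
  omega

lemma ofWeight_not_alt_eq_empty {n M : ℕ} (hM : M ≤ n) :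
    ofWeight (F := F) (fun c => ¬ c.Alt) n M = ∅ := by
  refine eq_empty_of_forall_notMem fun c hc => (mem_ofWeight.1 hc).1 ?_
  have hr := rad_eq_zero_of_mem_ofWeight hM hc
  obtain ⟨d, B, hB, rfl⟩ := exists_rep c
  rw [rad_mk] at hr
  rw [alt_mk]
  intro r hr'
  rw [Submodule.finrank_eq_zero.1 hr] at hr'
  rw [(Submodule.mem_bot F).1 hr', map_zero]

lemma card_ofWeight_alt_le_pow [CharP F 2] {n M : ℕ} (hM : M ≤ n) :
    (#(ofWeight (F := F) Alt n M) : ℝ) ≤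
      (Fintype.card F : ℝ) ^ M / (1 - (Fintype.card F : ℝ)⁻¹) := by
  have h : ∀ c ∈ ofWeight (F := F) Alt n M, ∃ fs ∈ chainsOf (F := F) (M + 1) M, IsUnitChain fs ∧
      ∃ (d : ℕ) (B : LinearMap.BilinForm F (Fin d → F)) (hB : B.Nondegenerate),
        mk B hB = c ∧ HasChain fs (Fin d → F) B := by
    intro c hc
    have hr := rad_eq_zero_of_mem_ofWeight hM hc
    have hd := (mem_ofWeight.1 hc).2
    rw [hr, mul_zero, add_zero] at hd
    obtain ⟨d, B, hB, rfl⟩ := exists_rep c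
    rw [rad_mk] at hr
    rw [dim_mk] at hd
    obtain ⟨x, hx⟩ := exists_isSymbol hB (LinearMap.BilinForm.nondegenerate_iff_ker_eq_bot.2
      (Submodule.finrank_eq_zero.1 hr))
    obtain ⟨fs, hl, hfs, -, hch, hdeg⟩ := hx.exists_hasChain (M + 1) (by omega)
    exact ⟨fs, hfs.mem_chainsOf hl (by omega), hfs, d, B, hB, rfl, hch⟩
  choose! f hf hfs d B hB hc hch using h
  have hq : (1 : ℝ) < Fintype.card F := mod_cast Fintype.one_lt_card
  have hq' : (Fintype.card F : ℝ)⁻¹ < 1 := inv_lt_one_of_one_lt₀ hq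
  calc (#(ofWeight (F := F) Alt n M) : ℝ) ≤ #(chainsOf (F := F) (M + 1) M) := by
        refine Nat.cast_le.2 (card_le_card_of_injOn f hf fun c hc₁ c' hc₂ e => ?_)
        rw [← hc c hc₁, ← hc c' hc₂, mk_eq_mk]
        exact (hch c hc₁).isometric (hfs c hc₁) (e ▸ hch c' hc₂)
    _ ≤ _ := card_chainsOf_le M M
    _ ≤ _ := by
        rw [div_mul_eq_mul_div]
        refine div_le_div_of_nonneg_right (mul_le_of_le_one_left (by positivity) ?_) (by linarith)
        linarith [show (0 : ℝ) ≤ (Fintype.card F : ℝ)⁻¹ ^ (M + 1) by positivity]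

theorem card_ofWeight_zero_le [CharP F 2] (n : ℕ) :
    (#(ofWeight (F := F) Alt 0 n) : ℝ) + #(ofWeight (F := F) (fun c => ¬ c.Alt) 0 n) ≤
      (Fintype.card F : ℝ) ^ n * ∏' i, boundFactor (Fintype.card F : ℝ)⁻¹ i := by
  have hq : (2 : ℝ) ≤ Fintype.card F := mod_cast Fintype.one_lt_card (α := F)
  have h0 : (0 : ℝ) < (Fintype.card F : ℝ)⁻¹ := by positivity
  have h1 : (Fintype.card F : ℝ)⁻¹ < 1 := inv_lt_one_of_one_lt₀ (by linarith)
  have hA := fun M hM => card_ofWeight_alt_le_pow (F := F) (n := n) (M := M) hM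
  have hA' := fun C => card_ofWeight_le (F := F) (C := C) (n := n) h0 h1
  rw [inv_inv] at hA'
  refine le_mul_tprod_boundFactor h0 (by rw [one_div]; gcongr) (by positivity) (N₀ := 2 * n + 1)
    fun N hN => ?_
  generalize (Fintype.card F : ℝ) = q at *
  obtain ⟨C, hC⟩ : ∃ C, C = ((1 - q⁻¹) * qPoch q⁻¹ N ^ 2)⁻¹ := ⟨_, rfl⟩
  have h1' : 0 < 1 - q⁻¹ := sub_pos.2 h1
  have hP := qPoch_pos h0 h1 N
  have hC0 : 0 < C := hC ▸ by positivity
  have hCP : C * ((1 - q⁻¹) * qPoch q⁻¹ N ^ 2) = 1 := hC ▸ inv_mul_cancel₀ (by positivity)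
  have h5 : (1 - q⁻¹)⁻¹ ≤ C * majA q⁻¹ n :=
    calc (1 - q⁻¹)⁻¹ = C * qPoch q⁻¹ N ^ 2 :=
          inv_eq_of_mul_eq_one_left (by linear_combination hCP)
      _ ≤ _ := mul_le_mul_of_nonneg_left (le_majA h0 h1 n N hN) hC0.le
  have h6 := majN_nonneg h0 h1 n
  obtain ⟨h2, h3⟩ := hA' C hC0.le
    (fun M hM => (hA M hM).trans (by
      rw [div_eq_inv_mul]
      exact mul_le_mul_of_nonneg_right h5 (by positivity)))
    (fun M hM => by
      rw [ofWeight_not_alt_eq_empty hM, card_empty, Nat.cast_zero]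
      positivity) n 0 (zero_add n) n le_rfl
  have h4 := majA_zero_add_majN_zero h0 h1
  generalize ∑' l : ℕ, q⁻¹ ^ (l ^ 2 + l) = S at *
  calc _ ≤ (C * majA q⁻¹ 0 * q ^ n + C * majN q⁻¹ 0 * q ^ n) * qPoch q⁻¹ N ^ 2 := by gcongr
    _ = _ := by linear_combination C * q ^ n * qPoch q⁻¹ N ^ 2 * h4 + q ^ n * S * hCP

end FormClass

end FormCount

section WallForm

open Module

open LinearMap (BilinForm)

variable {F : Type*} [Field F] {V : Type*} [AddCommGroup V] [Module F V]

/-- `χ` is the Wall form of the isometry `g` of `B`, defined on the range of `1 - g`. -/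
def IsWallForm (B : BilinForm F V) (g : End F V) (χ : BilinForm F (LinearMap.range (1 - g))) :
    Prop := ∀ x v, χ x ⟨(1 - g) v, v, rfl⟩ = B x v

lemma exists_isWallForm {B : BilinForm F V} {g : End F V} (hg : ∀ u v, B (g u) (g v) = B u v) :
    ∃ χ, IsWallForm B g χ := by
  obtain ⟨σ, hσ⟩ := (1 - g).rangeRestrict.exists_rightInverse_of_surjective
    (1 - g).range_rangeRestrict
  refine ⟨(B.compl₂ σ).domRestrict _, ?_⟩
  rintro ⟨_, u, rfl⟩ v
  have h1 : (1 - g) (σ ⟨(1 - g) v, v, rfl⟩) = (1 - g) v :=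
    congrArg Subtype.val (LinearMap.congr_fun hσ ⟨(1 - g) v, v, rfl⟩)
  have h2 : ∀ w, (1 - g) w = 0 → B ((1 - g) u) w = 0 := fun w hw => by
    have h3 : g w = w := (sub_eq_zero.1 hw).symm
    have h4 := hg u w
    rw [h3] at h4
    change B (u - g u) w = 0
    rw [map_sub, LinearMap.sub_apply, h4, sub_self]
  have h3 := h2 (σ ⟨(1 - g) v, v, rfl⟩ - v) (by rw [map_sub, h1, sub_self])
  rw [map_sub] at h3
  exact sub_eq_zero.1 h3

namespace IsWallForm

variable {B : BilinForm F V} {g : End F V} {χ : BilinForm F (LinearMap.range (1 - g))}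

lemma nondegenerate [FiniteDimensional F V] (h : IsWallForm B g χ) (hB : B.Nondegenerate) :
    χ.Nondegenerate :=
  LinearMap.BilinForm.nondegenerate_of_left fun x hx => Subtype.ext (hB.1 _ fun v => by
    rw [← h, hx])

lemma sub_flip (h : IsWallForm B g χ) (hB : B.IsAlt) (hg : ∀ u v, B (g u) (g v) = B u v)
    (x y : LinearMap.range (1 - g)) : χ x y - χ y x = B x y := by
  obtain ⟨_, u, rfl⟩ := x
  obtain ⟨_, v, rfl⟩ := y
  rw [h, h]
  change B (u - g u) v - B (v - g v) u = B (u - g u) (v - g v)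
  rw [← hB.neg_eq u (v - g v)]
  simp only [map_sub, LinearMap.sub_apply, hg]
  ring

lemma finrank_add_le [FiniteDimensional F V] (h : IsWallForm B g χ) (hB : B.IsAlt)
    (hB' : B.Nondegenerate) (hg : ∀ u v, B (g u) (g v) = B u v) :
    finrank F (LinearMap.range (1 - g)) + finrank F (symRad χ) ≤ finrank F V := by
  have h1 : (symRad χ).map (Submodule.subtype _) ≤ B.orthogonal (LinearMap.range (1 - g)) := by
    rintro _ ⟨r, hr, rfl⟩ y hy
    have := h.sub_flip hB hg ⟨y, hy⟩ r
    rw [(mem_symRad.1 hr _).symm, sub_self] at this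
    exact this.symm
  have h2 := Submodule.finrank_mono h1
  rw [Submodule.finrank_map_subtype_eq, LinearMap.BilinForm.finrank_orthogonal hB'] at h2
  have h3 := Submodule.finrank_le (LinearMap.range (1 - g))
  omega

lemma exists_conj [FiniteDimensional F V] {g' : End F V}
    {χ' : BilinForm F (LinearMap.range (1 - g'))} (h : IsWallForm B g χ) (h' : IsWallForm B g' χ')
    (hB : B.IsAlt) (hB' : B.Nondegenerate) (hg : ∀ u v, B (g u) (g v) = B u v)
    (hg' : ∀ u v, B (g' u) (g' v) = B u v) (e : Isometric χ χ') :
    ∃ f : V ≃ₗ[F] V, (∀ u v, B (f u) (f v) = B u v) ∧ ∀ v, f (g v) = g' (f v) := by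
  obtain ⟨i, hi⟩ := e
  obtain ⟨k, hk⟩ := LinearMap.exists_extend (Submodule.subtype _ ∘ₗ i.toLinearMap)
  have hk : ∀ x : LinearMap.range (1 - g), k x = i x := fun x => LinearMap.congr_fun hk x
  obtain ⟨f, hf, hfk⟩ := exists_isometry_extending hB' hB' hB hB rfl (LinearMap.range (1 - g)) k
    (fun x hx y hy => by
      rw [hk ⟨x, hx⟩, hk ⟨y, hy⟩, ← h'.sub_flip hB hg', hi, hi, h.sub_flip hB hg])
    (fun x hx h0 => by
      rw [hk ⟨x, hx⟩, Submodule.coe_eq_zero, LinearEquiv.map_eq_zero_iff] at h0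
      exact congrArg Subtype.val h0)
  refine ⟨f, hf, fun v => ?_⟩
  have hfi : ∀ x : LinearMap.range (1 - g), f x = i x := fun x => by rw [hfk _ x.2, hk]
  have h1 : (⟨(1 - g') (f v), f v, rfl⟩ : LinearMap.range (1 - g')) =
      i ⟨(1 - g) v, v, rfl⟩ := by
    refine sub_eq_zero.1 ((h'.nondegenerate hB').2 _ fun y => ?_)
    obtain ⟨x, rfl⟩ := i.surjective y
    rw [map_sub, h', hi, h, ← hfi, hf, sub_self]
  have h2 := congrArg Subtype.val h1
  rw [← hfi] at h2
  change f v - g' (f v) = f (v - g v) at h2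
  rw [map_sub] at h2
  exact (sub_right_injective h2).symm

end IsWallForm

end WallForm

section Symplectic

open Module Finset

open LinearMap (BilinForm)

open scoped Matrix

variable {n : ℕ} {F : Type*} [Field F]

/-- The standard symplectic form. -/
noncomputable def sympForm (n : ℕ) (F : Type*) [Field F] : BilinForm F (Fin n ⊕ Fin n → F) :=
  Matrix.toBilin' (sympJ n F)

lemma sympForm_apply (u v : Fin n ⊕ Fin n → F) :
    sympForm n F u v = ∑ i, (u (.inl i) * v (.inr i) - u (.inr i) * v (.inl i)) := by
  rw [sympForm, Matrix.toBilin'_apply', sympJ, Matrix.fromBlocks_mulVec, dotProduct,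
    Fintype.sum_sum_type, ← Finset.sum_add_distrib]
  simp [sub_eq_add_neg, Matrix.neg_mulVec]

lemma sympForm_isAlt : (sympForm n F).IsAlt := fun u => by
  rw [sympForm_apply]
  exact Finset.sum_eq_zero fun i _ => by ring

lemma sympForm_nondegenerate : (sympForm n F).Nondegenerate := by
  refine LinearMap.BilinForm.nondegenerate_of_left fun u h => funext fun j => ?_
  obtain j | j := j
  · simpa [sympForm_apply, Pi.single_apply] using h (Pi.single (.inr j) 1)
  · simpa [sympForm_apply, Pi.single_apply] using h (Pi.single (.inl j) 1)

lemma mem_Sp_iff {A : GL (Fin n ⊕ Fin n) F} :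
    A ∈ Sp n F ↔ ∀ u v, sympForm n F (Matrix.toLin' A.1 u) (Matrix.toLin' A.1 v) =
      sympForm n F u v := by
  have h := Matrix.toBilin'_comp (sympJ n F) A.1 A.1
  change A.1ᵀ * sympJ n F * A.1 = sympJ n F ↔ _
  rw [← (Matrix.toBilin' (n := Fin n ⊕ Fin n) (R₁ := F)).injective.eq_iff, ← h]
  exact LinearMap.ext_iff₂

lemma exists_Sp_of_isometry (f : (Fin n ⊕ Fin n → F) ≃ₗ[F] (Fin n ⊕ Fin n → F))
    (hf : ∀ u v, sympForm n F (f u) (f v) = sympForm n F u v) :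
    ∃ C : Sp n F, Matrix.toLin' C.1.1 = f := by
  have h : Matrix.toLin' (LinearMap.toMatrix' f.toLinearMap) = f := Matrix.toLin'_toMatrix' _
  refine ⟨⟨⟨LinearMap.toMatrix' f.toLinearMap, LinearMap.toMatrix' f.symm.toLinearMap, ?_, ?_⟩,
    mem_Sp_iff.2 fun u v => ?_⟩, h⟩
  · rw [← LinearMap.toMatrix'_comp, LinearEquiv.comp_symm, LinearMap.toMatrix'_id]
  · rw [← LinearMap.toMatrix'_comp, LinearEquiv.symm_comp, LinearMap.toMatrix'_id]
  · rw [h]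
    exact hf u v

lemma isConj_Sp_iff {A A' : Sp n F} : IsConj A A' ↔
    ∃ f : (Fin n ⊕ Fin n → F) ≃ₗ[F] (Fin n ⊕ Fin n → F),
      (∀ u v, sympForm n F (f u) (f v) = sympForm n F u v) ∧
        ∀ v, f (Matrix.toLin' A.1.1 v) = Matrix.toLin' A'.1.1 (f v) := by
  rw [isConj_iff]
  constructor
  · rintro ⟨C, h⟩
    refine ⟨(Matrix.GeneralLinearGroup.toLin C.1).toLinearEquiv, mem_Sp_iff.1 C.2, fun v => ?_⟩
    have h1 : C.1.1 * A.1.1 = A'.1.1 * C.1.1 :=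
      congrArg (fun X : Sp n F => X.1.1) (mul_inv_eq_iff_eq_mul.1 h)
    change C.1.1 *ᵥ (A.1.1 *ᵥ v) = A'.1.1 *ᵥ (C.1.1 *ᵥ v)
    rw [Matrix.mulVec_mulVec, Matrix.mulVec_mulVec, h1]
  · rintro ⟨f, hf, h⟩
    obtain ⟨C, hC⟩ := exists_Sp_of_isometry f hf
    refine ⟨C, mul_inv_eq_iff_eq_mul.2 (Subtype.ext (Units.ext ?_))⟩
    apply Matrix.toLin'.injective
    change Matrix.toLin' (C.1.1 * A.1.1) = Matrix.toLin' (A'.1.1 * C.1.1)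
    rw [Matrix.toLin'_mul, Matrix.toLin'_mul, hC]
    exact LinearMap.ext h

instance [Fintype F] : Finite (ConjClasses (Sp n F)) :=
  Quotient.finite _

theorem card_conjClasses_Sp_le [Fintype F] (n : ℕ) :
    Nat.card (ConjClasses (Sp n F)) ≤ #(FormClass.ofWeight (F := F) FormClass.Alt 0 n) +
      #(FormClass.ofWeight (F := F) (fun c => ¬c.Alt) 0 n) := by
  classical
  choose χ hχ using fun A : Sp n F => exists_isWallForm (mem_Sp_iff.1 A.2)
  have hn := fun A : Sp n F => (hχ A).nondegenerate sympForm_nondegenerate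
  let φ : ConjClasses (Sp n F) → FormClass F := fun c => FormClass.mk (χ c.exists_rep.choose)
    (hn _)
  have hφ : Function.Injective φ := fun c c' h => by
    rw [← c.exists_rep.choose_spec, ← c'.exists_rep.choose_spec, ConjClasses.mk_eq_mk_iff_isConj,
      isConj_Sp_iff]
    exact (hχ _).exists_conj (hχ _) sympForm_isAlt sympForm_nondegenerate
      (mem_Sp_iff.1 (Subtype.prop _)) (mem_Sp_iff.1 (Subtype.prop _)) (FormClass.mk_eq_mk.1 h)
  have hm : ∀ c, φ c ∈ FormClass.ofWeight (F := F) FormClass.Alt 0 n ∪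
      FormClass.ofWeight (F := F) (fun c => ¬c.Alt) 0 n := fun c => by
    have h1 := (hχ c.exists_rep.choose).finrank_add_le sympForm_isAlt sympForm_nondegenerate
      (mem_Sp_iff.1 (Subtype.prop _))
    rw [finrank_fintype_fun_eq_card, Fintype.card_sum, Fintype.card_fin] at h1
    have h2 : (φ c).dim + (2 * 0 + 1) * (φ c).rad ≤ 2 * n := by
      rw [FormClass.dim_mk, FormClass.rad_mk]
      omega
    rw [mem_union, FormClass.mem_ofWeight, FormClass.mem_ofWeight]
    exact (em (φ c).Alt).imp (fun h => ⟨h, h2⟩) fun h => ⟨h, h2⟩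
  refine le_trans ?_ (card_union_le _ _)
  rw [← Nat.card_eq_finsetCard]
  exact Nat.card_le_card_of_injective (fun c => (⟨φ c, hm c⟩ : {x // x ∈ _}))
    fun c c' h => hφ (congrArg Subtype.val h)

end Symplectic

section LowerBound

open Module Polynomial

open LinearMap (BilinForm)

variable {F : Type*} [Field F] {p : F[X]}

namespace AdjoinRoot

/-- The top coefficient of an element of `AdjoinRoot p` in the power basis. -/
noncomputable def topCoeff (hp : p.Monic) : AdjoinRoot p →ₗ[F] F :=
  lcoeff F (p.natDegree - 1) ∘ₗ modByMonicHom hp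

lemma exists_topCoeff_mul_ne_zero (hp : p.Monic) {a : AdjoinRoot p} (ha : a ≠ 0) :
    ∃ b, topCoeff hp (a * b) ≠ 0 := by
  obtain ⟨s, rfl⟩ := mk_surjective a
  set r := s %ₘ p with hr
  have hsr : mk p s = mk p r := by rw [← mk_leftInverse hp (mk p s), modByMonicHom_mk]
  have hr0 : r ≠ 0 := fun h => ha (by rw [hsr, h, map_zero])
  have hp1 : p ≠ 1 := fun h => hr0 (by rw [hr, h, modByMonic_one])
  have hd : r.natDegree < p.natDegree := natDegree_modByMonic_lt _ hp hp1
  refine ⟨mk p (X ^ (p.natDegree - 1 - r.natDegree)), ?_⟩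
  have h1 : (r * X ^ (p.natDegree - 1 - r.natDegree)).natDegree = p.natDegree - 1 := by
    rw [natDegree_mul_X_pow _ hr0]
    omega
  have h2 : (r * X ^ (p.natDegree - 1 - r.natDegree)).degree < p.degree :=
    degree_lt_degree (by omega)
  have h3 : r * X ^ (p.natDegree - 1 - r.natDegree) ≠ 0 := mul_ne_zero hr0 (pow_ne_zero _ X_ne_zero)
  rw [hsr, ← map_mul, topCoeff, LinearMap.comp_apply, modByMonicHom_mk,
    (modByMonic_eq_self_iff hp).2 h2, lcoeff_apply]
  intro h4
  exact leadingCoeff_ne_zero.2 h3 (by rwa [leadingCoeff, h1])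

/-- The alternating form `(a, b), (c, d) ↦ topCoeff (a d - b c)`. -/
noncomputable def detForm (hp : p.Monic) : BilinForm F (AdjoinRoot p × AdjoinRoot p) :=
  LinearMap.mk₂ F (fun u v => topCoeff hp (u.1 * v.2 - u.2 * v.1))
    (fun u u' v => by rw [← map_add]; congr 1; simp only [Prod.fst_add, Prod.snd_add]; ring)
    (fun c u v => by
      rw [← map_smul]; congr 1
      simp only [Prod.smul_fst, Prod.smul_snd, smul_mul_assoc, smul_sub])
    (fun u v v' => by rw [← map_add]; congr 1; simp only [Prod.fst_add, Prod.snd_add]; ring)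
    (fun c u v => by
      rw [← map_smul]; congr 1
      simp only [Prod.smul_fst, Prod.smul_snd, mul_smul_comm, smul_sub])

lemma detForm_apply (hp : p.Monic) (u v : AdjoinRoot p × AdjoinRoot p) :
    detForm hp u v = topCoeff hp (u.1 * v.2 - u.2 * v.1) := rfl

lemma detForm_isAlt (hp : p.Monic) : (detForm hp).IsAlt := fun u => by
  rw [detForm_apply, mul_comm, sub_self, map_zero]

lemma detForm_nondegenerate (hp : p.Monic) : (detForm hp).Nondegenerate := by
  have := (powerBasis' hp).finite
  refine LinearMap.BilinForm.nondegenerate_of_left fun u h => ?_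
  by_contra hu
  have hu' : u.1 ≠ 0 ∨ u.2 ≠ 0 := by
    by_contra! h'
    exact hu (Prod.ext h'.1 h'.2)
  obtain h1 | h1 := hu'
  · obtain ⟨b, hb⟩ := exists_topCoeff_mul_ne_zero hp h1
    exact hb (by simpa [detForm_apply] using h (0, b))
  · obtain ⟨b, hb⟩ := exists_topCoeff_mul_ne_zero hp h1
    exact hb (by simpa [detForm_apply] using h (b, 0))

/-- The isometry of `detForm` with `g + g⁻¹` equal to multiplication by the root. -/
noncomputable def companion (p : F[X]) :
    (AdjoinRoot p × AdjoinRoot p) ≃ₗ[F] (AdjoinRoot p × AdjoinRoot p) where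
  toFun u := (-u.2, u.1 + root p * u.2)
  invFun u := (u.2 + root p * u.1, -u.1)
  map_add' u v := by
    ext <;> simp only [Prod.fst_add, Prod.snd_add] <;> ring
  map_smul' c u := by
    ext <;> simp only [Prod.smul_fst, Prod.smul_snd, RingHom.id_apply, smul_neg, smul_add,
      mul_smul_comm]
  left_inv u := by ext <;> simp
  right_inv u := by ext <;> simp

lemma detForm_companion (hp : p.Monic) (u v : AdjoinRoot p × AdjoinRoot p) :
    detForm hp (companion p u) (companion p v) = detForm hp u v := by
  rw [detForm_apply, detForm_apply]
  congr 1
  change -u.2 * (v.1 + root p * v.2) - (u.1 + root p * u.2) * -v.2 = _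
  ring

lemma companion_add_symm (u : AdjoinRoot p × AdjoinRoot p) :
    companion p u + (companion p).symm u = root p • u := by
  change ((-u.2, u.1 + root p * u.2) : AdjoinRoot p × AdjoinRoot p) +
    (u.2 + root p * u.1, -u.1) = (root p * u.1, root p * u.2)
  ext <;> simp only [Prod.mk_add_mk] <;> ring

end AdjoinRoot

variable {n : ℕ}

lemma toLin'_inv_eq_of_semiconj {V : Type*} [AddCommGroup V] [Module F V] {A : Sp n F}
    {f : (Fin n ⊕ Fin n → F) ≃ₗ[F] V} {g : V ≃ₗ[F] V}
    (h : ∀ v, f (Matrix.toLin' A.1.1 v) = g (f v)) (v : Fin n ⊕ Fin n → F) :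
    f (Matrix.toLin' (A⁻¹).1.1 v) = g.symm (f v) := by
  rw [LinearEquiv.eq_symm_apply, ← h, ← Matrix.toLin'_mul_apply]
  have h1 : A.1.1 * (A⁻¹).1.1 = 1 := congrArg (fun X : Sp n F => X.1.1) (mul_inv_cancel A)
  rw [h1, Matrix.toLin'_one, LinearMap.id_apply]

/-- The endomorphism `A + A⁻¹`. -/
noncomputable def addInv (A : Sp n F) : End F (Fin n ⊕ Fin n → F) :=
  Matrix.toLin' A.1.1 + Matrix.toLin' (A⁻¹).1.1

lemma aeval_addInv_eq_zero_of_isConj {A A' : Sp n F} (h : IsConj A A') {r : F[X]}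
    (hr : aeval (addInv A) r = 0) : aeval (addInv A') r = 0 := by
  obtain ⟨f, -, hf⟩ := isConj_Sp_iff.1 h
  have h1 := toLin'_inv_eq_of_semiconj
    (g := (Matrix.GeneralLinearGroup.toLin A'.1).toLinearEquiv) hf
  have h2 : ∀ u, f.toLinearMap (addInv A u) = addInv A' (f u) := fun u => by
    change f (_ + _) = _ + _
    rw [map_add, hf, h1]
    rfl
  refine LinearMap.ext fun v => ?_
  obtain ⟨u, rfl⟩ := f.surjective v
  have h3 := aeval_apply_of_comp_eq h2 r u
  rw [hr, LinearMap.zero_apply, map_zero] at h3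
  exact h3.symm

lemma exists_Sp_aeval_addInv_eq_zero_iff (hp : p.Monic) (hn : p.natDegree = n) :
    ∃ A : Sp n F, ∀ r : F[X], aeval (addInv A) r = 0 ↔ p ∣ r := by
  have := (AdjoinRoot.powerBasis' hp).finite
  have : Module.Free F (AdjoinRoot p) := inferInstance
  obtain ⟨f, hf⟩ := isometric_of_isAlt sympForm_nondegenerate
    (AdjoinRoot.detForm_nondegenerate hp) sympForm_isAlt (AdjoinRoot.detForm_isAlt hp)
    (by rw [finrank_fintype_fun_eq_card, Fintype.card_sum, Fintype.card_fin, finrank_prod,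
      finrank_adjoinRoot hp, hn])
  obtain ⟨A, hA⟩ := exists_Sp_of_isometry (f ≪≫ₗ AdjoinRoot.companion p ≪≫ₗ f.symm) fun u v => by
    rw [← hf]
    simp only [LinearEquiv.trans_apply, LinearEquiv.apply_symm_apply, AdjoinRoot.detForm_companion,
      hf]
  have h1 : ∀ v, f (Matrix.toLin' A.1.1 v) = AdjoinRoot.companion p (f v) := fun v => by
    rw [hA]
    exact f.apply_symm_apply _
  have h2 : ∀ v, f.toLinearMap (addInv A v) = Algebra.lsmul F F (AdjoinRoot p × AdjoinRoot p)
      (AdjoinRoot.root p) (f v) := fun v => by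
    change f (_ + _) = _
    rw [map_add, h1, toLin'_inv_eq_of_semiconj h1, AdjoinRoot.companion_add_symm]
    rfl
  refine ⟨A, fun r => ?_⟩
  have h3 : ∀ v, f (aeval (addInv A) r v) = AdjoinRoot.mk p r • f v := fun v => by
    have := aeval_apply_of_comp_eq h2 r v
    rwa [aeval_algHom_apply, AdjoinRoot.aeval_eq] at this
  rw [← AdjoinRoot.mk_eq_zero]
  constructor
  · intro h
    have := h3 (f.symm (1, 0))
    rw [h, LinearMap.zero_apply, map_zero, LinearEquiv.apply_symm_apply] at this
    simpa using (congrArg Prod.fst this).symm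
  · intro h
    refine LinearMap.ext fun v => f.injective ?_
    rw [h3, h, zero_smul, LinearMap.zero_apply, map_zero]

theorem pow_le_card_conjClasses_Sp [Fintype F] (n : ℕ) :
    Fintype.card F ^ n ≤ Nat.card (ConjClasses (Sp n F)) := by
  let P : (Fin n → F) → F[X] := fun a => X ^ n + ((degreeLTEquiv F n).symm a : F[X])
  have hd : ∀ a, ((degreeLTEquiv F n).symm a : F[X]).degree < n :=
    fun a => mem_degreeLT.1 (Subtype.prop _)
  have hP : ∀ a, (P a).Monic := fun a => monic_X_pow_add (hd a)
  have hPn : ∀ a, (P a).natDegree = n := fun a => natDegree_eq_of_degree_eq_some (by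
    rw [degree_add_eq_left_of_degree_lt ((hd a).trans_eq (degree_X_pow n).symm), degree_X_pow])
  have hPi : Function.Injective P := fun a b h =>
    (degreeLTEquiv F n).symm.injective (Subtype.ext (add_left_cancel h))
  choose A hA using fun a => exists_Sp_aeval_addInv_eq_zero_iff (hP a) (hPn a)
  have hdvd : ∀ a b, IsConj (A a) (A b) → P b ∣ P a := fun a b h =>
    (hA b _).1 (aeval_addInv_eq_zero_of_isConj h ((hA a _).2 dvd_rfl))
  have hi : Function.Injective fun a => ConjClasses.mk (A a) := fun a b h => by
    have h' := ConjClasses.mk_eq_mk_iff_isConj.1 h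
    exact hPi (eq_of_monic_of_associated (hP a) (hP b)
      (associated_of_dvd_dvd (hdvd b a h'.symm) (hdvd a b h')))
  have h := Nat.card_le_card_of_injective _ hi
  rwa [Nat.card_fun, Nat.card_eq_fintype_card, Nat.card_eq_fintype_card, Fintype.card_fin] at h

end LowerBound

/-- Theorem 3.14(2): for `q` even,
`q^n ≤ k(Sp(2n,q)) ≤ q^n ∏_{i≥1} (1-q^{-4i})/((1-q^{-(4i-2)})(1-q^{-i})²) ≤ 15.2 q^n`. -/
theorem stmt_14 (q : ℕ) (hq : ∃ k : ℕ, 0 < k ∧ q = 2 ^ k)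
    (F : Type*) [Field F] [Fintype F] (hF : Fintype.card F = q) (n : ℕ) (hn : 1 ≤ n) :
    ((q : ℝ) ^ n ≤ (Nat.card (ConjClasses (Sp n F)) : ℝ)) ∧
    (Nat.card (ConjClasses (Sp n F)) : ℝ) ≤
      (q : ℝ) ^ n * ∏' i : ℕ, (1 - ((q : ℝ) ^ (4 * i + 4))⁻¹) /
        ((1 - ((q : ℝ) ^ (4 * i + 2))⁻¹) * (1 - ((q : ℝ) ^ (i + 1))⁻¹) ^ 2) ∧
    (q : ℝ) ^ n * (∏' i : ℕ, (1 - ((q : ℝ) ^ (4 * i + 4))⁻¹) /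
        ((1 - ((q : ℝ) ^ (4 * i + 2))⁻¹) * (1 - ((q : ℝ) ^ (i + 1))⁻¹) ^ 2)) ≤
      15.2 * (q : ℝ) ^ n := by
  obtain ⟨k, hk, hq2⟩ := hq
  have : CharP F 2 := by
    have := Fact.mk Nat.prime_two
    refine charP_of_card_eq_prime_pow (f := k) ?_
    rw [hF, hq2]
  have h2 : (2 : ℝ) ≤ q := by
    rw [hq2]
    exact_mod_cast Nat.le_self_pow hk.ne' 2
  have hb : ∀ i : ℕ, boundFactor (q : ℝ)⁻¹ i = (1 - ((q : ℝ) ^ (4 * i + 4))⁻¹) /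
      ((1 - ((q : ℝ) ^ (4 * i + 2))⁻¹) * (1 - ((q : ℝ) ^ (i + 1))⁻¹) ^ 2) := fun i => by
    simp only [boundFactor, inv_pow]
  simp only [← hb]
  refine ⟨?_, ?_, ?_⟩
  · rw [← hF]
    exact_mod_cast pow_le_card_conjClasses_Sp n
  · refine le_trans ?_ (hF ▸ FormClass.card_ofWeight_zero_le (F := F) n)
    exact_mod_cast card_conjClasses_Sp_le n
  · rw [mul_comm]
    refine mul_le_mul_of_nonneg_right (tprod_boundFactor_le (by positivity) ?_) (by positivity)
    rw [one_div]
    exact inv_anti₀ two_pos h2
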